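/- arXiv:1406.6785 — 2 statements merged into one kernel-verified Lean document; each statement's English description precedes it below -/
import Mathlib

section
/- Let T : [0,1] → [0,1] have an invariant Borel probability measure μ that is absolutely continuous with respect to Lebesgue measure, with density h satisfying c_h⁻¹ < h < c_h Lebesgue-a.e. for some constant c_h > 0. Assume there is a function p : ℕ → (0,∞) with Σ_{n=0}^∞ p(n) < ∞ such that for every f ∈ L¹(μ) and every g : [0,1] → ℝ of bounded variation, |∫ (f∘Tⁿ)·g dμ − ∫ f dμ · ∫ g dμ| ≤ ‖f‖₁ (‖g‖₁ + Var g) p(n) for all n. Let α ≥ 1 and r_n = n^{−α}. Then for Lebesgue-almost every x ∈ [0,1], the Hausdorff dimension of E(x,r) equals 1/α. -/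
open MeasureTheory Filter Set

/-- `E(x,r)`: the set of `y ∈ [0,1]` such that `|Tⁿ x − y| < r n` for infinitely many `n`. -/
def hitSet (T : ℝ → ℝ) (x : ℝ) (r : ℕ → ℝ) : Set ℝ :=
  {y ∈ Set.Icc (0 : ℝ) 1 | ∃ᶠ n in Filter.atTop, |T^[n] x - y| < r n}

/-- dyadic cell -/
def DD (e : ℕ) (j : ℤ) : Set ℝ := {x | ⌊x * 2 ^ e⌋ = j}

lemma toNat_two (n : ℕ) : ((2 : ℤ) ^ n).toNat = 2 ^ n := by
  exact_mod_cast Int.toNat_natCast (2 ^ n)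

lemma floor_coarse (x : ℝ) {e e' : ℕ} (h : e ≤ e') :
    ⌊x * 2 ^ e⌋ = ⌊x * 2 ^ e'⌋ / (2 ^ (e' - e) : ℤ) := by
  have := Int.floor_div_natCast (x * 2 ^ e') (2 ^ (e' - e))
  push_cast at this
  rw [← this]
  congr 1
  rw [eq_div_iff (by positivity), mul_assoc, ← pow_add]
  congr 2; omega

lemma mem_DD {e : ℕ} {j : ℤ} {x : ℝ} : x ∈ DD e j ↔ ⌊x * 2 ^ e⌋ = j := Iff.rfl

lemma DD_nonempty (e : ℕ) (j : ℤ) : (DD e j).Nonempty := by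
  refine ⟨j / 2 ^ e, ?_⟩
  rw [mem_DD, div_mul_cancel₀ _ (by positivity)]
  simp

lemma DD_sub {e e' : ℕ} {j j' : ℤ} (h : e ≤ e') (hj : j' / 2 ^ (e' - e) = j) :
    DD e' j' ⊆ DD e j := by
  intro x hx
  rw [mem_DD] at *
  rw [floor_coarse x h, hx, hj]

lemma DD_idx {e e' : ℕ} {j j' : ℤ} (h : e ≤ e') (hm : (DD e j ∩ DD e' j').Nonempty) :
    j' / 2 ^ (e' - e) = j := by
  obtain ⟨x, h1, h2⟩ := hm
  rw [mem_DD] at *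
  rw [← h1, floor_coarse x h, h2]

open Classical in
lemma count_le (F : Finset ℤ) (e l : ℕ) (i : ℤ) :
    ((F.filter (fun j => (DD l i ∩ DD e j).Nonempty)).card : ℝ) ≤ max 1 (2 ^ e * (1 / 2) ^ l) := by
  rcases le_total l e with h | h
  · refine le_trans ?_ (le_max_right _ _)
    have : F.filter (fun j => (DD l i ∩ DD e j).Nonempty) ⊆
        Finset.Ico (i * 2 ^ (e - l)) ((i + 1) * 2 ^ (e - l)) := by
      intro j hj
      have := DD_idx h (Finset.mem_filter.1 hj).2
      rw [Finset.mem_Ico]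
      have hp : (0 : ℤ) < 2 ^ (e - l) := by positivity
      rw [← this]
      exact ⟨Int.ediv_mul_le _ hp.ne', Int.lt_ediv_add_one_mul_self _ hp⟩
    have h2 := Finset.card_le_card this
    rw [Int.card_Ico] at h2
    have h3 : ((i + 1) * 2 ^ (e - l) - i * 2 ^ (e - l) : ℤ).toNat = 2 ^ (e - l) := by
      rw [← sub_mul]; simp [toNat_two]
    rw [h3] at h2
    have h4 : (2 : ℝ) ^ e * (1 / 2) ^ l = 2 ^ (e - l) := by
      obtain ⟨d, rfl⟩ := Nat.exists_eq_add_of_le h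
      rw [one_div, inv_pow, pow_add]; field_simp; simp
    rw [h4]; exact_mod_cast h2
  · refine le_trans ?_ (le_max_left _ _)
    have : (F.filter (fun j => (DD l i ∩ DD e j).Nonempty)).card ≤ 1 := by
      rw [Finset.card_le_one]
      intro a ha b hb
      have h1 := DD_idx h (by rw [inter_comm]; exact (Finset.mem_filter.1 ha).2)
      have h2 := DD_idx h (by rw [inter_comm]; exact (Finset.mem_filter.1 hb).2)
      rw [← h1, ← h2]
    exact_mod_cast this

open Classical in
/-- weight -/
noncomputable def vv (s : ℝ) (lev : ℕ → ℕ) (idx : ℕ → ℤ) (e : ℕ) (j : ℤ) (i : ℕ) : ℝ :=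
  if (DD (lev i) (idx i) ∩ DD e j).Nonempty then (min 1 ((1 / 2) ^ lev i * 2 ^ e)) ^ s else 0

lemma vv_nonneg (s : ℝ) (lev : ℕ → ℕ) (idx : ℕ → ℤ) (e : ℕ) (j : ℤ) (i : ℕ) :
    0 ≤ vv s lev idx e j i := by
  unfold vv; split_ifs <;> positivity

lemma vv_le {s : ℝ} (hs : 0 < s) (lev : ℕ → ℕ) (idx : ℕ → ℤ) (e : ℕ) (j : ℤ) (i : ℕ) :
    vv s lev idx e j i ≤ (((1 / 2 : ℝ) ^ lev i) ^ s) * ((2:ℝ) ^ e) ^ s := by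
  unfold vv; split_ifs
  · rw [← Real.mul_rpow (by positivity) (by positivity)]
    exact Real.rpow_le_rpow (by positivity) (min_le_right _ _) hs.le
  · positivity

lemma vv_summable {s : ℝ} (hs : 0 < s) (lev : ℕ → ℕ) (idx : ℕ → ℤ)
    (hsum : Summable (fun i => ((1 / 2 : ℝ) ^ lev i) ^ s)) (e : ℕ) (j : ℤ) :
    Summable (vv s lev idx e j) :=
  Summable.of_nonneg_of_le (vv_nonneg s lev idx e j) (vv_le hs lev idx e j) (hsum.mul_right _)

lemma lev_gt {s : ℝ} (hs : 0 < s) (lev : ℕ → ℕ) (idx : ℕ → ℤ)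
    (hsum : Summable (fun i => ((1 / 2 : ℝ) ^ lev i) ^ s)) {e : ℕ} {j : ℤ}
    (hS : ∑' i, vv s lev idx e j i ≤ 1 / 2) {i : ℕ}
    (hm : (DD (lev i) (idx i) ∩ DD e j).Nonempty) : e < lev i := by
  by_contra hlt
  push Not at hlt
  have h1 := (vv_summable hs lev idx hsum e j).le_tsum i
    (fun k _ => vv_nonneg s lev idx e j k)
  have h2 : vv s lev idx e j i = 1 := by
    unfold vv
    rw [if_pos hm, min_eq_left, Real.one_rpow]
    rw [one_div, inv_pow, ← div_eq_inv_mul, le_div_iff₀ (by positivity), one_mul]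
    exact pow_le_pow_right₀ (by norm_num) hlt
  linarith

open Classical in
/-- good cells -/
noncomputable def GG (lev : ℕ → ℕ) (idx : ℕ → ℤ) (e0 : ℕ) (j0 : ℤ) (e : ℕ) : Finset ℤ :=
  (Finset.Ico (j0 * 2 ^ (e - e0)) ((j0 + 1) * 2 ^ (e - e0))).filter
    (fun j => ∀ i, lev i ≤ e → ¬ (DD (lev i) (idx i) ∩ DD e j).Nonempty)

lemma GG_card {s : ℝ} (hs : 0 < s) (hs1 : s < 1) (lev : ℕ → ℕ) (idx : ℕ → ℤ)
    (hsum : Summable (fun i => ((1 / 2 : ℝ) ^ lev i) ^ s)) {e0 : ℕ} {j0 : ℤ}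
    (hS : ∑' i, vv s lev idx e0 j0 i ≤ 1 / 2) {e : ℕ} (he : e0 ≤ e) :
    (2 : ℝ) ^ (e - e0) / 2 ≤ (GG lev idx e0 j0 e).card := by
  classical
  set F := Finset.Ico (j0 * 2 ^ (e - e0)) ((j0 + 1) * 2 ^ (e - e0)) with hF
  have hFc : F.card = 2 ^ (e - e0) := by
    rw [hF, Int.card_Ico, ← sub_mul]; simp [toNat_two]
  have hFm : ∀ j ∈ F, DD e j ⊆ DD e0 j0 := by
    intro j hj
    apply DD_sub he
    rw [hF, Finset.mem_Ico] at hj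
    have hp : (0 : ℤ) < 2 ^ (e - e0) := by positivity
    apply le_antisymm
    · have := Int.ediv_lt_of_lt_mul hp hj.2
      omega
    · exact Int.le_ediv_of_mul_le hp hj.1
  set χ : ℕ → ℤ → ℝ := fun i j =>
    if lev i ≤ e ∧ (DD (lev i) (idx i) ∩ DD e j).Nonempty then 1 else 0 with hχ
  have hχ0 : ∀ i j, 0 ≤ χ i j := by
    intro i j; simp only [hχ]; split_ifs <;> norm_num
  have key : ∀ i, ∑ j ∈ F, χ i j ≤ 2 ^ (e - e0) * vv s lev idx e0 j0 i := by
    intro i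
    by_cases hex : ∃ j ∈ F, lev i ≤ e ∧ (DD (lev i) (idx i) ∩ DD e j).Nonempty
    · obtain ⟨j, hj, hle, hne⟩ := hex
      have hm : (DD (lev i) (idx i) ∩ DD e0 j0).Nonempty :=
        hne.mono (inter_subset_inter_right _ (hFm j hj))
      have hgt := lev_gt hs lev idx hsum hS hm
      have h1 : ∑ j ∈ F, χ i j = (F.filter (fun j => (DD (lev i) (idx i) ∩ DD e j).Nonempty)).card := by
        rw [Finset.card_filter]; push_cast
        apply Finset.sum_congr rfl
        intro j _; simp [hχ, hle]
      rw [h1]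
      refine (count_le F e (lev i) (idx i)).trans ?_
      have hx : (1 / 2 : ℝ) ^ lev i * 2 ^ e0 ≤ 1 := by
        rw [one_div, inv_pow, ← div_eq_inv_mul, div_le_iff₀ (by positivity), one_mul]
        exact pow_le_pow_right₀ (by norm_num) hgt.le
      have hy : (1:ℝ) ≤ 2 ^ e * (1 / 2) ^ lev i := by
        rw [one_div, inv_pow, ← div_eq_mul_inv, le_div_iff₀ (by positivity), one_mul]
        exact pow_le_pow_right₀ (by norm_num) hle
      rw [max_eq_right hy]
      unfold vv
      rw [if_pos hm, min_eq_right hx]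
      have h2 : (2:ℝ) ^ e * (1 / 2) ^ lev i = 2 ^ (e - e0) * ((1 / 2 : ℝ) ^ lev i * 2 ^ e0) := by
        have : (2:ℝ) ^ e = 2 ^ (e - e0) * 2 ^ e0 := by rw [← pow_add]; congr 1; omega
        rw [this]; ring
      rw [h2]
      gcongr
      conv_lhs => rw [← Real.rpow_one ((1 / 2 : ℝ) ^ lev i * 2 ^ e0)]
      exact Real.rpow_le_rpow_of_exponent_ge (by positivity) hx hs1.le
    · push Not at hex
      have : ∑ j ∈ F, χ i j = 0 := by
        apply Finset.sum_eq_zero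
        intro j hj
        simp only [hχ]
        rw [if_neg]
        rintro ⟨h1, h2⟩
        rw [hex j hj h1] at h2; simp at h2
      rw [this]
      have := vv_nonneg s lev idx e0 j0 i
      positivity
  have hχs : ∀ j ∈ F, Summable (fun i => χ i j) := by
    intro j hj
    refine Summable.of_nonneg_of_le (fun i => hχ0 i j) (fun i => ?_)
      ((vv_summable hs lev idx hsum e0 j0).mul_left (2 ^ (e - e0)))
    exact (Finset.single_le_sum (f := fun j => χ i j) (fun j _ => hχ0 i j) hj).trans (key i)
  have hbad : ((F.filter (fun j => ¬ ∀ i, lev i ≤ e → ¬ (DD (lev i) (idx i) ∩ DD e j).Nonempty)).card : ℝ)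
      ≤ ∑ j ∈ F, ∑' i, χ i j := by
    rw [Finset.card_filter]; push_cast
    apply Finset.sum_le_sum
    intro j hj
    split_ifs with hc
    · exact tsum_nonneg (fun i => hχ0 i j)
    · push Not at hc
      obtain ⟨i, hi, hi2⟩ := hc
      have h1 := (hχs j hj).le_tsum i (fun k _ => hχ0 k j)
      have h2 : χ i j = 1 := by simp only [hχ]; rw [if_pos ⟨hi, hi2⟩]
      linarith
  rw [← Summable.tsum_finsetSum hχs] at hbad
  have h3 : ∑' i, ∑ j ∈ F, χ i j ≤ 2 ^ (e - e0) * (1 / 2) := by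
    calc ∑' i, ∑ j ∈ F, χ i j ≤ ∑' i, 2 ^ (e - e0) * vv s lev idx e0 j0 i :=
          Summable.tsum_le_tsum key (summable_sum hχs)
            ((vv_summable hs lev idx hsum e0 j0).mul_left _)
      _ = 2 ^ (e - e0) * ∑' i, vv s lev idx e0 j0 i := tsum_mul_left
      _ ≤ _ := by gcongr
  have h4 := Finset.card_filter_add_card_filter_not (s := F)
    (fun j => ∀ i, lev i ≤ e → ¬ (DD (lev i) (idx i) ∩ DD e j).Nonempty)
  rw [hFc] at h4
  have h5 : ((GG lev idx e0 j0 e).card : ℝ) + ((F.filter (fun j => ¬ ∀ i, lev i ≤ e → ¬ (DD (lev i) (idx i) ∩ DD e j).Nonempty)).card : ℝ) = 2 ^ (e - e0) := by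
    unfold GG
    rw [← hF]
    exact_mod_cast h4
  linarith

open Classical in
/-- visits to `A` at times in `[2^k, 2^(k+1))` -/
noncomputable def cnt (a : ℕ → ℝ) (k : ℕ) (A : Set ℝ) : ℕ :=
  ((Finset.Ico (2 ^ k) (2 ^ (k + 1))).filter (fun n => a n ∈ A)).card

lemma DD_dist {e : ℕ} {j : ℤ} {x y : ℝ} (hx : x ∈ DD e j) (hy : y ∈ DD e j) :
    |x - y| < (1 / 2) ^ e := by
  rw [mem_DD] at *
  have := Int.abs_sub_lt_one_of_floor_eq_floor (hx.trans hy.symm)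
  rw [← sub_mul, abs_mul, abs_of_pos (by positivity : (0:ℝ) < 2 ^ e)] at this
  rw [one_div, inv_pow, ← one_div, lt_div_iff₀ (by positivity)]
  exact this

lemma occupied {a : ℕ → ℝ} {M c : ℝ} {e0 : ℕ} {e k : ℕ} (he : e0 ≤ e) (hk : e ≤ k)
    (hc : 0 < c) (hM : 0 < M)
    (h1 : ∑ j ∈ Finset.Ico (0:ℤ) (2 ^ k), (cnt a k (DD k j) : ℝ) ^ 2 ≤ M * 2 ^ k)
    (G : Finset ℤ) (hG : (2 : ℝ) ^ (e - e0) / 2 ≤ G.card)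
    (hGm : ∀ j ∈ G, 0 ≤ j ∧ j < 2 ^ e)
    (h2 : ∀ j ∈ G, c * 2 ^ k / 2 ^ e ≤ cnt a k (DD e j)) :
    ∃ Q : Finset ℤ, (∀ j ∈ Q, j / 2 ^ (k - e) ∈ G ∧
        ∃ n, 2 ^ k ≤ n ∧ n < 2 ^ (k + 1) ∧ a n ∈ DD k j) ∧
      c ^ 2 / (4 * M * 4 ^ e0) * 2 ^ k ≤ Q.card := by
  classical
  set A := (Finset.Ico (2 ^ k) (2 ^ (k + 1))).filter (fun n => ⌊a n * 2 ^ e⌋ ∈ G) with hA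
  set Q := A.image (fun n => ⌊a n * 2 ^ k⌋) with hQ
  have hp : (0 : ℤ) < 2 ^ (k - e) := by positivity
  have hQm : ∀ j ∈ Q, j / 2 ^ (k - e) ∈ G ∧
        ∃ n, 2 ^ k ≤ n ∧ n < 2 ^ (k + 1) ∧ a n ∈ DD k j := by
    intro j hj
    rw [hQ, Finset.mem_image] at hj
    obtain ⟨n, hn, rfl⟩ := hj
    rw [hA, Finset.mem_filter, Finset.mem_Ico] at hn
    refine ⟨?_, n, hn.1.1, hn.1.2, rfl⟩
    rw [← floor_coarse _ hk]; exact hn.2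
  refine ⟨Q, hQm, ?_⟩
  have hAG : (c * 2 ^ k / 2 ^ e0 / 2 : ℝ) ≤ A.card := by
    have h3 := Finset.card_eq_sum_card_fiberwise (s := A) (t := G)
      (f := fun n => ⌊a n * 2 ^ e⌋) (fun n hn => by
        have hn : n ∈ A := hn
        rw [hA, Finset.mem_filter] at hn; exact hn.2)
    rw [h3]; push_cast
    calc (c * 2 ^ k / 2 ^ e0 / 2 : ℝ) = (2 : ℝ) ^ (e - e0) / 2 * (c * 2 ^ k / 2 ^ e) := by
          have : (2:ℝ) ^ e = 2 ^ (e - e0) * 2 ^ e0 := by rw [← pow_add]; congr 1; omega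
          rw [this]; field_simp
      _ ≤ G.card * (c * 2 ^ k / 2 ^ e) := by gcongr
      _ = ∑ j ∈ G, (c * 2 ^ k / 2 ^ e) := by simp
      _ ≤ _ := by
          apply Finset.sum_le_sum
          intro j hj
          refine (h2 j hj).trans ?_
          unfold cnt
          refine Nat.cast_le.2 ?_
          apply Finset.card_le_card
          intro n hn
          rw [Finset.mem_filter] at hn
          rw [Finset.mem_filter, hA, Finset.mem_filter]
          have h5 : ⌊a n * 2 ^ e⌋ = j := hn.2
          exact ⟨⟨hn.1, h5 ▸ hj⟩, h5⟩
  have hAQ : (A.card : ℝ) ≤ ∑ j ∈ Q, (cnt a k (DD k j) : ℝ) := by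
    have h3 := Finset.card_eq_sum_card_fiberwise (s := A) (t := Q)
      (f := fun n => ⌊a n * 2 ^ k⌋) (fun n hn => Finset.mem_image_of_mem _ hn)
    rw [h3]; push_cast
    apply Finset.sum_le_sum
    intro j hj
    unfold cnt
    refine Nat.cast_le.2 ?_
    apply Finset.card_le_card
    intro n hn
    rw [Finset.mem_filter, hA, Finset.mem_filter] at hn
    rw [Finset.mem_filter]
    exact ⟨hn.1.1, hn.2⟩
  have hQsub : Q ⊆ Finset.Ico (0:ℤ) (2 ^ k) := by
    intro j hj
    obtain ⟨h4, -⟩ := hQm j hj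
    obtain ⟨h5, h6⟩ := hGm _ h4
    rw [Finset.mem_Ico]
    constructor
    · by_contra hneg
      push Not at hneg
      have := Int.ediv_neg_of_neg_of_pos hneg hp
      omega
    · have h7 := Int.lt_mul_of_ediv_lt hp h6
      rwa [← pow_add, Nat.add_sub_cancel' hk] at h7
  have hCS := sq_sum_le_card_mul_sum_sq (s := Q) (f := fun j => (cnt a k (DD k j) : ℝ))
  have h8 : ∑ j ∈ Q, (cnt a k (DD k j) : ℝ) ^ 2 ≤ M * 2 ^ k :=
    (Finset.sum_le_sum_of_subset_of_nonneg hQsub (fun _ _ _ => by positivity)).trans h1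
  have h9 : (c * 2 ^ k / 2 ^ e0 / 2 : ℝ) ^ 2 ≤ Q.card * (M * 2 ^ k) :=
    calc (c * 2 ^ k / 2 ^ e0 / 2 : ℝ) ^ 2 ≤ (∑ j ∈ Q, (cnt a k (DD k j) : ℝ)) ^ 2 := by
          apply pow_le_pow_left₀ (by positivity) (hAG.trans hAQ)
      _ ≤ _ := hCS
      _ ≤ _ := by gcongr
  have h10 : (c * 2 ^ k / 2 ^ e0 / 2 : ℝ) ^ 2 = (c ^ 2 / (4 * M * 4 ^ e0) * 2 ^ k) * (M * 2 ^ k) := by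
    have : (4:ℝ) ^ e0 = 2 ^ e0 * 2 ^ e0 := by rw [← mul_pow]; norm_num
    rw [this]; field_simp; norm_num
  rw [h10] at h9
  exact le_of_mul_le_mul_right h9 (by positivity)

lemma step {s α : ℝ} (hs : 0 < s) (hα : 1 ≤ α) (hsα : s * α < 1)
    {a : ℕ → ℝ} {M c : ℝ} (hc : 0 < c) (hM : 0 < M)
    (h1 : ∃ᶠ k in atTop,
      ∑ j ∈ Finset.Ico (0:ℤ) (2 ^ k), (cnt a k (DD k j) : ℝ) ^ 2 ≤ M * 2 ^ k)
    (h2 : ∀ (e : ℕ) (j : ℤ), 0 ≤ j → j < 2 ^ e →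
      ∀ᶠ k in atTop, c * 2 ^ k / 2 ^ e ≤ cnt a k (DD e j))
    (lev : ℕ → ℕ) (idx : ℕ → ℤ)
    (hsum : Summable (fun i => ((1 / 2 : ℝ) ^ lev i) ^ s))
    (hle : ∑' i, ((1 / 2 : ℝ) ^ lev i) ^ s ≤ 1 / 2)
    (e0 : ℕ) (j0 : ℤ) (hj0 : 0 ≤ j0) (hj1 : j0 < 2 ^ e0)
    (hS : ∑' i, vv s lev idx e0 j0 i ≤ 1 / 2) (n0 : ℕ) :
    ∃ n e1 j1, n0 ≤ n ∧ e0 < e1 ∧ 0 ≤ j1 ∧ j1 < 2 ^ e1 ∧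
      DD (e1 - 1) (j1 / 2) ⊆ DD e0 j0 ∧ j1 % 2 = 0 ∧
      (∀ y ∈ DD e1 j1, |a n - y| < (n : ℝ) ^ (-α)) ∧
      ∑' i, vv s lev idx e1 j1 i ≤ 1 / 2 := by
  classical
  have hs1 : s < 1 := by nlinarith
  set κ : ℝ := c ^ 2 / (4 * M * 4 ^ e0) with hκ
  have hκ0 : 0 < κ := by positivity
  -- choose e
  obtain ⟨e, hee, heκ⟩ : ∃ e, e0 ≤ e ∧ ((1 / 2 : ℝ) ^ e) ^ (1 - s) ≤ κ / 2 := by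
    have t1 : Tendsto (fun e : ℕ => ((1 / 2 : ℝ) ^ e) ^ (1 - s)) atTop (nhds 0) := by
      have := (tendsto_pow_atTop_nhds_zero_of_lt_one (r := (1/2:ℝ)) (by norm_num)
        (by norm_num)).rpow_const (p := 1 - s) (Or.inr (by linarith))
      rwa [Real.zero_rpow (by linarith)] at this
    have t2 := t1.eventually (gt_mem_nhds (by positivity : (0:ℝ) < κ / 2))
    obtain ⟨e, h3, h4⟩ := (t2.and (eventually_ge_atTop e0)).exists
    exact ⟨e, h4, h3.le⟩
  set G := GG lev idx e0 j0 e with hGdef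
  have hGc := GG_card hs hs1 lev idx hsum hS hee
  have hGbound : ∀ j ∈ G, j / 2 ^ (e - e0) = j0 ∧ 0 ≤ j ∧ j < 2 ^ e := by
    intro j hj
    rw [hGdef, GG, Finset.mem_filter, Finset.mem_Ico] at hj
    obtain ⟨⟨h3, h4⟩, -⟩ := hj
    have hp : (0 : ℤ) < 2 ^ (e - e0) := by positivity
    refine ⟨?_, ?_, ?_⟩
    · apply le_antisymm
      · have := Int.ediv_lt_of_lt_mul hp h4
        omega
      · exact Int.le_ediv_of_mul_le hp h3
    · exact (by positivity : (0:ℤ) ≤ j0 * 2 ^ (e - e0)).trans h3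
    · have : (2:ℤ) ^ e = 2 ^ e0 * 2 ^ (e - e0) := by rw [← pow_add]; congr 1; omega
      rw [this]
      exact h4.trans_le (by gcongr; omega)
  have ev2 : ∀ᶠ k in atTop, ∀ j ∈ G, c * 2 ^ k / 2 ^ e ≤ cnt a k (DD e j) := by
    rw [Filter.eventually_all_finset]
    intro j hj
    exact h2 e j (hGbound j hj).2.1 (hGbound j hj).2.2
  have ev3 : ∀ᶠ k : ℕ in atTop, ((2:ℝ) ^ (⌈α * (k + 1)⌉₊ + 1)) ^ s ≤ κ / 2 * 2 ^ k := by
    have t1 : Tendsto (fun k : ℕ => (2:ℝ) ^ (s * (α + 2)) * ((2:ℝ) ^ (s * α - 1)) ^ k) atTop (nhds 0) := by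
      have := (tendsto_pow_atTop_nhds_zero_of_lt_one (r := (2:ℝ) ^ (s * α - 1)) (by positivity)
        (Real.rpow_lt_one_of_one_lt_of_neg (by norm_num) (by linarith))).const_mul
          ((2:ℝ) ^ (s * (α + 2)))
      rwa [mul_zero] at this
    filter_upwards [t1.eventually (gt_mem_nhds (by positivity : (0:ℝ) < κ / 2))] with k hk
    have hceil : ((⌈α * (k + 1)⌉₊ : ℕ) : ℝ) < α * (k + 1) + 1 :=
      Nat.ceil_lt_add_one (by positivity)
    calc ((2:ℝ) ^ (⌈α * (k + 1)⌉₊ + 1)) ^ s = (2:ℝ) ^ (s * ((⌈α * (k + 1)⌉₊ : ℕ) + 1)) := by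
          rw [← Real.rpow_natCast, ← Real.rpow_mul (by norm_num)]
          push_cast; ring_nf
      _ ≤ (2:ℝ) ^ (s * (α + 2) + (s * α - 1) * k + k) := by
          apply Real.rpow_le_rpow_of_exponent_le (by norm_num)
          nlinarith
      _ = (2:ℝ) ^ (s * (α + 2)) * ((2:ℝ) ^ (s * α - 1)) ^ k * 2 ^ k := by
          rw [Real.rpow_add (by norm_num), Real.rpow_add (by norm_num), Real.rpow_mul (by norm_num) (s * α - 1),
            Real.rpow_natCast, Real.rpow_natCast]
      _ ≤ κ / 2 * 2 ^ k := by gcongr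
  obtain ⟨k, hk1, ⟨hk2, hk3⟩, hk4, hk5⟩ := (h1.and_eventually ((ev2.and ev3).and
    ((eventually_ge_atTop e).and (eventually_ge_atTop n0)))).exists
  obtain ⟨Q, hQ1, hQ2⟩ := occupied hee hk4 hc hM hk1 G hGc (fun j hj => (hGbound j hj).2) hk2
  rw [← hκ] at hQ2
  choose! hQG nn hn1 hn2 hn3 using hQ1
  set b := ⌈α * (k + 1)⌉₊ with hb
  have hbk : k + 1 ≤ b := by
    have : ((k + 1 : ℕ) : ℝ) ≤ b := by
      refine le_trans ?_ (Nat.le_ceil _)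
      push_cast; nlinarith
    exact_mod_cast this
  -- child
  set ch : ℤ → ℤ := fun j => 2 * ⌊a (nn j) * 2 ^ b⌋ with hch
  have hsub1 : ∀ j, DD (b + 1) (ch j) ⊆ DD b ⌊a (nn j) * 2 ^ b⌋ := by
    intro j; apply DD_sub (by omega)
    simp [hch]
  have hsub2 : ∀ j ∈ Q, DD b ⌊a (nn j) * 2 ^ b⌋ ⊆ DD k j := by
    intro j hj
    apply DD_sub (by omega)
    rw [← floor_coarse _ (by omega)]
    exact hn3 j hj
  have hsub3 : ∀ j ∈ Q, DD k j ⊆ DD e (j / 2 ^ (k - e)) := fun j hj => DD_sub hk4 rfl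
  have hsub4 : ∀ j ∈ Q, DD e (j / 2 ^ (k - e)) ⊆ DD e0 j0 := fun j hj =>
    DD_sub hee (hGbound _ (hQG j hj)).1
  have hexist : ∃ j ∈ Q, ∑' i, vv s lev idx (b + 1) (ch j) i ≤ 1 / 2 := by
    by_contra hcon
    push Not at hcon
    have hlow : (Q.card : ℝ) * (1 / 2) ≤ ∑ j ∈ Q, ∑' i, vv s lev idx (b + 1) (ch j) i := by
      calc (Q.card : ℝ) * (1 / 2) = ∑ j ∈ Q, (1 / 2 : ℝ) := by simp
        _ ≤ _ := Finset.sum_le_sum (fun j hj => (hcon j hj).le)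
    have hQpos : 0 < (Q.card : ℝ) := lt_of_lt_of_le (by positivity) hQ2
    have hQne : Q.Nonempty := Finset.card_pos.1 (by exact_mod_cast hQpos)
    have hlow : (Q.card : ℝ) * (1 / 2) < ∑ j ∈ Q, ∑' i, vv s lev idx (b + 1) (ch j) i := by
      calc (Q.card : ℝ) * (1 / 2) = ∑ j ∈ Q, (1 / 2 : ℝ) := by simp
        _ < _ := Finset.sum_lt_sum_of_nonempty hQne hcon
    have hss : ∀ j ∈ Q, Summable (vv s lev idx (b + 1) (ch j)) :=
      fun j _ => vv_summable hs lev idx hsum _ _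
    rw [← Summable.tsum_finsetSum hss] at hlow
    have hterm : ∀ i, ∑ j ∈ Q, vv s lev idx (b + 1) (ch j) i ≤
        ((1 / 2 : ℝ) ^ lev i) ^ s * (κ * 2 ^ k) := by
      intro i
      by_cases hex : ∃ j ∈ Q, (DD (lev i) (idx i) ∩ DD (b + 1) (ch j)).Nonempty
      · obtain ⟨j, hj, hne⟩ := hex
        have hlev : e < lev i := by
          by_contra hlt
          push Not at hlt
          have hg := hQG j hj
          rw [hGdef, GG, Finset.mem_filter] at hg
          refine hg.2 i hlt (hne.mono (inter_subset_inter_right _ ?_))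
          exact (hsub1 j).trans ((hsub2 j hj).trans (hsub3 j hj))
        set w : ℝ := (1 / 2 : ℝ) ^ lev i with hw
        have hw0 : 0 < w := by positivity
        set m : ℝ := (min 1 (w * 2 ^ (b + 1))) ^ s with hm
        have hm0 : 0 ≤ m := by positivity
        have hm1 : m ≤ 1 := Real.rpow_le_one (by positivity) (min_le_left _ _) hs.le
        have hm2 : m ≤ w ^ s * (κ / 2 * 2 ^ k) := by
          calc m ≤ (w * 2 ^ (b + 1)) ^ s :=
                Real.rpow_le_rpow (by positivity) (min_le_right _ _) hs.le
            _ = w ^ s * ((2:ℝ) ^ (b + 1)) ^ s := Real.mul_rpow (by positivity) (by positivity)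
            _ ≤ _ := by gcongr
        have hcount := count_le Q k (lev i) (idx i)
        rw [← hw] at hcount
        have hw2 : w ≤ w ^ s * (κ / 2) := by
          calc w = w ^ s * w ^ (1 - s) := by
                rw [← Real.rpow_add hw0]; simp
            _ ≤ w ^ s * ((1 / 2 : ℝ) ^ e) ^ (1 - s) := by
                gcongr
                rw [hw]
                exact pow_le_pow_of_le_one (by norm_num) (by norm_num) hlev.le
            _ ≤ _ := by gcongr
        calc ∑ j ∈ Q, vv s lev idx (b + 1) (ch j) i
            ≤ ∑ j ∈ Q, if (DD (lev i) (idx i) ∩ DD k j).Nonempty then m else 0 := by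
              apply Finset.sum_le_sum
              intro j hj
              unfold vv
              split_ifs with ha hb
              · exact le_rfl
              · exact absurd (ha.mono (inter_subset_inter_right _
                  ((hsub1 j).trans (hsub2 j hj)))) hb
              · exact hm0
              · exact le_rfl
          _ = (Q.filter (fun j => (DD (lev i) (idx i) ∩ DD k j).Nonempty)).card * m := by
              rw [← Finset.sum_filter, Finset.sum_const, nsmul_eq_mul]
          _ ≤ max 1 (2 ^ k * w) * m := by gcongr
          _ ≤ (1 + 2 ^ k * w) * m := by
              gcongr
              apply max_le <;> nlinarith [(by positivity : (0:ℝ) ≤ 2 ^ k * w)]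
          _ ≤ m + 2 ^ k * w := by
              nlinarith [(by positivity : (0:ℝ) ≤ 2 ^ k * w)]
          _ ≤ w ^ s * (κ / 2 * 2 ^ k) + 2 ^ k * (w ^ s * (κ / 2)) := by gcongr
          _ = _ := by ring
      · push Not at hex
        have : ∑ j ∈ Q, vv s lev idx (b + 1) (ch j) i = 0 := by
          apply Finset.sum_eq_zero
          intro j hj
          unfold vv
          rw [if_neg]
          rw [hex j hj]; simp
        rw [this]; positivity
    have hup : ∑' i, ∑ j ∈ Q, vv s lev idx (b + 1) (ch j) i ≤ 1 / 2 * (κ * 2 ^ k) := by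
      calc _ ≤ ∑' i, ((1 / 2 : ℝ) ^ lev i) ^ s * (κ * 2 ^ k) :=
            Summable.tsum_le_tsum hterm (summable_sum hss) (hsum.mul_right _)
        _ = (∑' i, ((1 / 2 : ℝ) ^ lev i) ^ s) * (κ * 2 ^ k) := tsum_mul_right
        _ ≤ _ := by gcongr
    linarith
  obtain ⟨j, hj, hjS⟩ := hexist
  have hD0 : DD b ⌊a (nn j) * 2 ^ b⌋ ⊆ DD e0 j0 :=
    (hsub2 j hj).trans ((hsub3 j hj).trans (hsub4 j hj))
  have hchild0 : DD e0 j0 ⊆ DD 0 0 := by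
    apply DD_sub (by omega)
    exact Int.ediv_eq_zero_of_lt hj0 (by simpa using hj1)
  have hunit : ∀ x ∈ DD (0:ℕ) (0:ℤ), 0 ≤ x ∧ x < 1 := by
    intro x hx
    rw [mem_DD, Int.floor_eq_iff] at hx
    simpa using hx
  refine ⟨nn j, b + 1, ch j, ?_, by omega, ?_, ?_, ?_, by simp [hch], ?_, hjS⟩
  · exact (hk5.trans Nat.lt_two_pow_self.le).trans (hn1 j hj)
  · obtain ⟨x, hx⟩ := DD_nonempty (b + 1) (ch j)
    have := hunit x (hchild0 (hD0 (hsub1 j hx)))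
    rw [mem_DD] at hx
    rw [← hx]; apply Int.floor_nonneg.2
    have := this.1
    positivity
  · obtain ⟨x, hx⟩ := DD_nonempty (b + 1) (ch j)
    have := hunit x (hchild0 (hD0 (hsub1 j hx)))
    rw [mem_DD] at hx
    rw [← hx, Int.floor_lt]
    push_cast
    have h3 := this.2
    have h4 : (0:ℝ) < 2 ^ (b + 1) := by positivity
    nlinarith
  · have : ch j / 2 = ⌊a (nn j) * 2 ^ b⌋ := by simp [hch]
    rw [this]; simpa using hD0
  · intro y hy
    have h3 : |a (nn j) - y| < (1 / 2) ^ b := DD_dist rfl (hsub1 j hy)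
    refine h3.trans_le ?_
    have hpos : (0:ℝ) < nn j := by
      have : 0 < nn j := lt_of_lt_of_le (by positivity) (hn1 j hj)
      exact_mod_cast this
    calc (1 / 2 : ℝ) ^ b = (2:ℝ) ^ (-(b:ℝ)) := by
          rw [Real.rpow_neg (by norm_num), Real.rpow_natCast, one_div, inv_pow]
      _ ≤ (2:ℝ) ^ (((k + 1 : ℕ) : ℝ) * (-α)) := by
          apply Real.rpow_le_rpow_of_exponent_le (by norm_num)
          have := Nat.le_ceil (α * ((k:ℝ) + 1))
          push_cast; linarith
      _ = ((2:ℝ) ^ (k + 1)) ^ (-α) := by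
          rw [Real.rpow_mul (by norm_num), Real.rpow_natCast]
      _ ≤ (nn j : ℝ) ^ (-α) := by
          apply Real.rpow_le_rpow_of_nonpos hpos
          · exact_mod_cast (hn2 j hj).le
          · linarith

lemma exists_point {s α : ℝ} (hs : 0 < s) (hα : 1 ≤ α) (hsα : s * α < 1)
    {a : ℕ → ℝ} {M c : ℝ} (hc : 0 < c) (hM : 0 < M)
    (h1 : ∃ᶠ k in atTop,
      ∑ j ∈ Finset.Ico (0:ℤ) (2 ^ k), (cnt a k (DD k j) : ℝ) ^ 2 ≤ M * 2 ^ k)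
    (h2 : ∀ (e : ℕ) (j : ℤ), 0 ≤ j → j < 2 ^ e →
      ∀ᶠ k in atTop, c * 2 ^ k / 2 ^ e ≤ cnt a k (DD e j))
    (lev : ℕ → ℕ) (idx : ℕ → ℤ)
    (hsum : Summable (fun i => ((1 / 2 : ℝ) ^ lev i) ^ s))
    (hle : ∑' i, ((1 / 2 : ℝ) ^ lev i) ^ s ≤ 1 / 2) :
    ∃ y ∈ Icc (0:ℝ) 1, (∃ᶠ n : ℕ in atTop, |a n - y| < (n : ℝ) ^ (-α)) ∧
      ∀ i, y ∉ DD (lev i) (idx i) := by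
  let P : ℕ × ℕ × ℤ → Prop := fun q => 0 ≤ q.2.2 ∧ q.2.2 < 2 ^ q.2.1 ∧
    ∑' i, vv s lev idx q.2.1 q.2.2 i ≤ 1 / 2
  have hstep : ∀ q : {q // P q}, ∃ q' : {q // P q}, q.1.1 + 1 ≤ q'.1.1 ∧ q.1.2.1 < q'.1.2.1 ∧
      DD (q'.1.2.1 - 1) (q'.1.2.2 / 2) ⊆ DD q.1.2.1 q.1.2.2 ∧ q'.1.2.2 % 2 = 0 ∧
      (∀ y ∈ DD q'.1.2.1 q'.1.2.2, |a q'.1.1 - y| < (q'.1.1 : ℝ) ^ (-α)) := by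
    rintro ⟨⟨n, e, j⟩, hq⟩
    obtain ⟨n', e', j', g1, g2, g3, g4, g5, g6, g7, g8⟩ :=
      step hs hα hsα hc hM h1 h2 lev idx hsum hle e j hq.1 hq.2.1 hq.2.2 (n + 1)
    exact ⟨⟨⟨n', e', j'⟩, g3, g4, g8⟩, g1, g2, g5, g6, g7⟩
  choose nx hx using hstep
  have hP0 : P (0, 0, 0) := by
    refine ⟨le_rfl, by simp, ?_⟩
    refine le_trans (Summable.tsum_le_tsum (fun i => ?_) (vv_summable hs lev idx hsum 0 0) hsum) hle
    simpa using vv_le hs lev idx 0 0 i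
  let q : ℕ → {q // P q} := fun t => Nat.rec ⟨(0, 0, 0), hP0⟩ (fun _ x => nx x) t
  have hq : ∀ t, q (t + 1) = nx (q t) := fun t => rfl
  let K : ℕ → Set ℝ := fun t => Icc ((q t).1.2.2 / 2 ^ (q t).1.2.1 : ℝ)
    (((q t).1.2.2 + 1) / 2 ^ (q t).1.2.1)
  have hKmem : ∀ t x, x ∈ K t ↔ ((q t).1.2.2 : ℝ) ≤ x * 2 ^ (q t).1.2.1 ∧
      x * 2 ^ (q t).1.2.1 ≤ (q t).1.2.2 + 1 := by
    intro t x
    simp only [K, mem_Icc]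
    rw [div_le_iff₀ (by positivity), le_div_iff₀ (by positivity)]
  have hKD : ∀ t, K (t + 1) ⊆ DD (q t).1.2.1 (q t).1.2.2 := by
    intro t x hxK
    have hxK := (hKmem (t+1) x).1 hxK
    obtain ⟨g1, g2, g3, g4, g5⟩ := hx (q t)
    rw [← hq] at g1 g2 g3 g4 g5
    apply g3
    rw [mem_DD, Int.floor_eq_iff]
    have e1 : (2:ℝ) ^ (q (t+1)).1.2.1 = 2 ^ ((q (t+1)).1.2.1 - 1) * 2 := by
      rw [← pow_succ]; congr 1; omega
    have e2 : (((q (t+1)).1.2.2 : ℤ) : ℝ) = (((q (t+1)).1.2.2 / 2 : ℤ) : ℝ) * 2 := by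
      have : (q (t+1)).1.2.2 = (q (t+1)).1.2.2 / 2 * 2 := by omega
      exact_mod_cast this
    rw [e1, e2] at hxK
    constructor <;> nlinarith [hxK.1, hxK.2]
  have hDK : ∀ t, DD (q t).1.2.1 (q t).1.2.2 ⊆ K t := by
    intro t x hxD
    rw [mem_DD, Int.floor_eq_iff] at hxD
    refine (hKmem t x).2 ?_
    exact ⟨hxD.1, hxD.2.le⟩
  obtain ⟨y, hy⟩ := IsCompact.nonempty_iInter_of_sequence_nonempty_isCompact_isClosed K
    (fun t => (hKD t).trans (hDK t)) (fun t => (DD_nonempty _ _).mono (hDK t)) isCompact_Icc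
    (fun t => isClosed_Icc)
  rw [mem_iInter] at hy
  have hyD : ∀ t, y ∈ DD (q t).1.2.1 (q t).1.2.2 := fun t => hKD t (hy (t + 1))
  have hn : ∀ t, t ≤ (q t).1.1 := by
    intro t
    induction t with
    | zero => simp
    | succ t ih => have := (hx (q t)).1; rw [← hq] at this; omega
  have he : ∀ t, t ≤ (q t).1.2.1 := by
    intro t
    induction t with
    | zero => simp
    | succ t ih => have := (hx (q t)).2.1; rw [← hq] at this; omega
  refine ⟨y, ?_, ?_, ?_⟩
  · have := hy 0
    simpa [K, q] using this
  · rw [frequently_atTop]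
    intro N
    refine ⟨(q (N + 1)).1.1, by have := hn (N + 1); omega, ?_⟩
    exact (hx (q N)).2.2.2.2 y (hyD (N + 1))
  · intro i hi
    have := lev_gt hs lev idx hsum (q (lev i)).2.2.2 (i := i) ⟨y, hi, hyD _⟩
    have := he (lev i)
    omega

lemma level_choice {s : ℝ} (hs : 0 < s) (hs1 : s < 1) {d ε : ℝ} (hd : 0 ≤ d) (hd1 : d ≤ 1)
    (hε : 0 < ε) : ∃ k : ℕ, d ≤ (1 / 2) ^ k ∧ ((1 / 2 : ℝ) ^ k) ^ s ≤ 2 * d ^ s + ε := by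
  rcases hd.eq_or_lt with rfl | hd0
  · have t1 : Tendsto (fun e : ℕ => ((1 / 2 : ℝ) ^ e) ^ s) atTop (nhds 0) := by
      have := (tendsto_pow_atTop_nhds_zero_of_lt_one (r := (1/2:ℝ)) (by norm_num)
        (by norm_num)).rpow_const (p := s) (Or.inr (by linarith))
      rwa [Real.zero_rpow (by linarith)] at this
    obtain ⟨k, hk⟩ := (t1.eventually (gt_mem_nhds hε)).exists
    exact ⟨k, by positivity, by rw [Real.zero_rpow hs.ne']; linarith⟩
  · obtain ⟨n, h1, h2⟩ := exists_nat_pow_near_of_lt_one hd0 hd1 (by norm_num : (0:ℝ) < 1 / 2)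
      (by norm_num)
    refine ⟨n, h2, ?_⟩
    have h3 : (1 / 2 : ℝ) ^ n ≤ 2 * d := by rw [pow_succ] at h1; linarith
    calc ((1 / 2 : ℝ) ^ n) ^ s ≤ (2 * d) ^ s := Real.rpow_le_rpow (by positivity) h3 hs.le
      _ = 2 ^ s * d ^ s := Real.mul_rpow (by norm_num) hd
      _ ≤ 2 * d ^ s := by
          gcongr
          calc (2:ℝ) ^ s ≤ 2 ^ (1:ℝ) := Real.rpow_le_rpow_of_exponent_le (by norm_num) hs1.le
            _ = 2 := by simp
      _ ≤ _ := by linarith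

lemma two_cells {t : Set ℝ} {d : ℝ} {k : ℕ} (ht : ∀ x ∈ t, ∀ z ∈ t, |x - z| ≤ d)
    (hk : d ≤ (1 / 2) ^ k) : ∃ j : ℤ, t ⊆ DD k j ∪ DD k (j + 1) := by
  rcases t.eq_empty_or_nonempty with rfl | hne
  · exact ⟨0, empty_subset _⟩
  obtain ⟨x0, hx0⟩ := hne
  have hlow : ∀ x ∈ t, x - d ∈ lowerBounds t := by
    intro x hx z hz
    have := (abs_le.1 (ht x hx z hz)).2
    linarith
  refine ⟨⌊sInf t * 2 ^ k⌋, ?_⟩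
  intro x hx
  have h1 : sInf t ≤ x := csInf_le ⟨_, hlow x0 hx0⟩ hx
  have h2 : x - d ≤ sInf t := le_csInf ⟨x0, hx0⟩ (fun z hz => hlow x hx hz)
  have h3 : sInf t * 2 ^ k ≤ x * 2 ^ k := by gcongr
  have h4 : x * 2 ^ k ≤ sInf t * 2 ^ k + 1 := by
    have : (1 / 2 : ℝ) ^ k * 2 ^ k = 1 := by rw [← mul_pow]; norm_num
    have h5 : x ≤ sInf t + (1 / 2) ^ k := by linarith
    calc x * 2 ^ k ≤ (sInf t + (1 / 2) ^ k) * 2 ^ k := by gcongr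
      _ = _ := by rw [add_mul, this]
  have h6 : ⌊sInf t * 2 ^ k⌋ ≤ ⌊x * 2 ^ k⌋ := Int.floor_mono h3
  have h7 : ⌊x * 2 ^ k⌋ ≤ ⌊sInf t * 2 ^ k⌋ + 1 := by
    rw [← Int.floor_add_one]; exact Int.floor_mono h4
  simp only [mem_union, mem_DD]
  omega

lemma dyadic_cover {s : ℝ} (hs : 0 < s) (hs1 : s < 1) {E : Set ℝ}
    (hE : μH[s] E = 0) : ∃ (lev : ℕ → ℕ) (idx : ℕ → ℤ),
      Summable (fun i => ((1 / 2 : ℝ) ^ lev i) ^ s) ∧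
      ∑' i, ((1 / 2 : ℝ) ^ lev i) ^ s ≤ 1 / 2 ∧ ∀ y ∈ E, ∃ i, y ∈ DD (lev i) (idx i) := by
  rw [Measure.hausdorffMeasure_apply] at hE
  simp only [ENNReal.iSup_eq_zero] at hE
  have h0 := hE 1 (by norm_num)
  have hlt : (⨅ (t : ℕ → Set ℝ) (_ : E ⊆ ⋃ n, t n) (_ : ∀ n, Metric.ediam (t n) ≤ 1),
      ∑' n, ⨆ _ : (t n).Nonempty, Metric.ediam (t n) ^ s) < ENNReal.ofReal (1 / 16) := by
    rw [h0]; simp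
  simp only [iInf_lt_iff] at hlt
  obtain ⟨t, ht1, ht2, ht3⟩ := hlt
  set d : ℕ → ℝ := fun n => (Metric.ediam (t n)).toReal with hd
  have hfin : ∀ n, Metric.ediam (t n) ≠ ⊤ := fun n => ((ht2 n).trans_lt ENNReal.one_lt_top).ne
  have hd1 : ∀ n, d n ≤ 1 := fun n => ENNReal.toReal_le_of_le_ofReal zero_le_one (by simpa using ht2 n)
  have hterm : ∀ n, ENNReal.ofReal (d n ^ s) ≤ ⨆ _ : (t n).Nonempty, Metric.ediam (t n) ^ s := by
    intro n
    rcases (t n).eq_empty_or_nonempty with h | h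
    · simp [hd, h, Real.zero_rpow hs.ne']
    · rw [iSup_pos h, ← ENNReal.ofReal_rpow_of_nonneg ENNReal.toReal_nonneg hs.le,
        ENNReal.ofReal_toReal (hfin n)]
  have hk : ∀ n, ∃ k : ℕ, d n ≤ (1 / 2) ^ k ∧
      ((1 / 2 : ℝ) ^ k) ^ s ≤ 2 * d n ^ s + 1 / 16 * (1 / 2) ^ n :=
    fun n => level_choice hs hs1 ENNReal.toReal_nonneg (hd1 n) (by positivity)
  choose k hk1 hk2 using hk
  have hj : ∀ n, ∃ j : ℤ, t n ⊆ DD (k n) j ∪ DD (k n) (j + 1) := by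
    intro n
    refine two_cells (fun x hx z hz => ?_) (hk1 n)
    have := Metric.edist_le_ediam_of_mem hx hz
    rw [← Real.dist_eq, ← ENNReal.ofReal_le_ofReal_iff ENNReal.toReal_nonneg,
      ENNReal.ofReal_toReal (hfin n), ← edist_dist]
    exact this
  choose j hj using hj
  let φ := Equiv.boolProdNatEquivNat
  let lev : ℕ → ℕ := fun i => k (φ.symm i).2
  let idx : ℕ → ℤ := fun i => j (φ.symm i).2 + (if (φ.symm i).1 then 1 else 0)
  have hsumE : ∑' i, ENNReal.ofReal (((1 / 2 : ℝ) ^ lev i) ^ s) ≤ ENNReal.ofReal (1 / 2) := by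
    have e1 : ∑' i, ENNReal.ofReal (((1 / 2 : ℝ) ^ lev i) ^ s) =
        ∑' p : Bool × ℕ, ENNReal.ofReal (((1 / 2 : ℝ) ^ k p.2) ^ s) :=
      φ.symm.tsum_eq (fun p : Bool × ℕ => ENNReal.ofReal (((1 / 2 : ℝ) ^ k p.2) ^ s))
    rw [e1, ENNReal.tsum_prod (f := fun (_ : Bool) (n : ℕ) => ENNReal.ofReal (((1 / 2 : ℝ) ^ k n) ^ s))]
    simp only [tsum_fintype, Fintype.sum_bool]
    have e2 : ∑' n, ENNReal.ofReal (((1 / 2 : ℝ) ^ k n) ^ s) ≤ ENNReal.ofReal (1 / 4) := by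
      have e3 : ∑' n : ℕ, ENNReal.ofReal (1 / 16 * (1 / 2) ^ n) = ENNReal.ofReal (1 / 8) := by
        rw [← ENNReal.ofReal_tsum_of_nonneg (fun n => by positivity)
          (summable_geometric_two.mul_left _), tsum_mul_left, tsum_geometric_two]
        norm_num
      calc ∑' n, ENNReal.ofReal (((1 / 2 : ℝ) ^ k n) ^ s)
          ≤ ∑' n, (2 * (⨆ _ : (t n).Nonempty, Metric.ediam (t n) ^ s) +
            ENNReal.ofReal (1 / 16 * (1 / 2) ^ n)) := by
            refine ENNReal.tsum_le_tsum (fun n => ?_)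
            refine (ENNReal.ofReal_le_ofReal (hk2 n)).trans ?_
            refine ENNReal.ofReal_add_le.trans ?_
            gcongr
            rw [ENNReal.ofReal_mul (by norm_num), ENNReal.ofReal_ofNat]
            gcongr
            exact hterm n
        _ = 2 * ∑' n, (⨆ _ : (t n).Nonempty, Metric.ediam (t n) ^ s) + ENNReal.ofReal (1 / 8) := by
            rw [ENNReal.tsum_add, ENNReal.tsum_mul_left, e3]
        _ ≤ 2 * ENNReal.ofReal (1 / 16) + ENNReal.ofReal (1 / 8) := by gcongr
        _ = ENNReal.ofReal (1 / 4) := by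
            rw [← ENNReal.ofReal_ofNat 2, ← ENNReal.ofReal_mul (by norm_num),
              ← ENNReal.ofReal_add (by norm_num) (by norm_num)]
            norm_num
    calc _ ≤ ENNReal.ofReal (1 / 4) + ENNReal.ofReal (1 / 4) := add_le_add e2 e2
      _ = _ := by rw [← ENNReal.ofReal_add (by norm_num) (by norm_num)]; norm_num
  have hnn : ∀ i, 0 ≤ ((1 / 2 : ℝ) ^ lev i) ^ s := fun i => by positivity
  have hS : Summable (fun i => ((1 / 2 : ℝ) ^ lev i) ^ s) := by
    have := ENNReal.summable_toReal (hsumE.trans_lt ENNReal.ofReal_lt_top).ne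
    refine this.congr (fun i => ENNReal.toReal_ofReal (hnn i))
  refine ⟨lev, idx, hS, ?_, ?_⟩
  · rw [← ENNReal.ofReal_tsum_of_nonneg hnn hS] at hsumE
    exact (ENNReal.ofReal_le_ofReal_iff (by norm_num)).1 hsumE
  · intro y hy
    obtain ⟨n, hn⟩ := mem_iUnion.1 (ht1 hy)
    rcases hj n hn with h | h
    · exact ⟨φ (false, n), by simpa [lev, idx] using h⟩
    · exact ⟨φ (true, n), by simpa [lev, idx] using h⟩

lemma upper {α s : ℝ} (hα : 1 ≤ α) (hs : 0 < s) (hsα : 1 < s * α) (a : ℕ → ℝ) (E : Set ℝ)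
    (hE : ∀ y ∈ E, ∃ᶠ n : ℕ in atTop, |a n - y| < (n : ℝ) ^ (-α)) : μH[s] E = 0 := by
  set ρ : ℕ → ℝ := fun n => (n : ℝ) ^ (-α) with hρ
  have hρ0 : ∀ n, 0 ≤ ρ n := fun n => by positivity
  set f : ℕ → ENNReal := fun n => (ENNReal.ofReal (2 * ρ n)) ^ s with hf
  have hfs : ∑' n, f n ≠ ⊤ := by
    have h1 : ∀ n, f n = ENNReal.ofReal ((2 * ρ n) ^ s) := fun n =>
      ENNReal.ofReal_rpow_of_nonneg (by have := hρ0 n; positivity) hs.le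
    have h2 : Summable (fun n => (2 * ρ n) ^ s) := by
      have h3 : ∀ n, (2 * ρ n) ^ s = 2 ^ s * (n : ℝ) ^ (-(s * α)) := by
        intro n
        rw [Real.mul_rpow (by norm_num) (hρ0 n), hρ, ← Real.rpow_mul (by positivity)]
        ring_nf
      simp_rw [h3]
      exact (Real.summable_nat_rpow.2 (by linarith)).mul_left _
    simp_rw [h1]
    exact h2.tsum_ofReal_ne_top
  have hlim := ENNReal.tendsto_sum_nat_add f hfs
  have hdiam : ∀ n, Metric.ediam (Ioo (a n - ρ n) (a n + ρ n)) = ENNReal.ofReal (2 * ρ n) := by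
    intro n; rw [Real.ediam_Ioo]; congr 1; ring
  have key := Measure.hausdorffMeasure_le_liminf_tsum (β := ℕ) (ι := fun _ => ℕ) s E (l := atTop)
    (fun m => ENNReal.ofReal (2 * ρ m)) ?_
    (fun m i => Ioo (a (i + m) - ρ (i + m)) (a (i + m) + ρ (i + m))) ?_ ?_
  · simp_rw [hdiam] at key
    rw [hlim.liminf_eq] at key
    exact le_antisymm key zero_le
  · have : Tendsto (fun m => 2 * ρ m) atTop (nhds 0) := by
      have := ((tendsto_rpow_neg_atTop (by linarith : 0 < α)).comp
        tendsto_natCast_atTop_atTop).const_mul 2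
      rwa [mul_zero] at this
    have := ENNReal.tendsto_ofReal this
    rwa [ENNReal.ofReal_zero] at this
  · filter_upwards [eventually_ge_atTop 1] with m hm i
    rw [hdiam]
    apply ENNReal.ofReal_le_ofReal
    apply mul_le_mul_of_nonneg_left _ (by norm_num)
    apply Real.rpow_le_rpow_of_nonpos (by exact_mod_cast hm) _ (by linarith)
    exact_mod_cast Nat.le_add_left m i
  · refine Eventually.of_forall (fun m y hy => ?_)
    obtain ⟨n, hn, hn2⟩ := frequently_atTop.1 (hE y hy) m
    rw [mem_iUnion]
    refine ⟨n - m, ?_⟩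
    rw [Nat.sub_add_cancel hn]
    rw [abs_lt] at hn2
    constructor <;> linarith [hn2.1, hn2.2]

lemma DD_eq_Ico (e : ℕ) (j : ℤ) : DD e j = Ico ((j:ℝ) / 2 ^ e) (((j:ℝ) + 1) / 2 ^ e) := by
  ext x
  rw [mem_DD, Int.floor_eq_iff, mem_Ico, div_le_iff₀ (by positivity), lt_div_iff₀ (by positivity)]

lemma DD_meas (e : ℕ) (j : ℤ) : MeasurableSet (DD e j) := by
  rw [DD_eq_Ico]; exact measurableSet_Ico

/-- the decay hypothesis -/
def Decay (T : ℝ → ℝ) (μ : Measure ℝ) (p : ℕ → ℝ) : Prop :=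
  ∀ f g : ℝ → ℝ, Integrable f μ → BoundedVariationOn g (Set.Icc (0:ℝ) 1) →
      ∀ n : ℕ,
        |(∫ x, f (T^[n] x) * g x ∂μ) - (∫ x, f x ∂μ) * (∫ x, g x ∂μ)| ≤
          (∫ x, |f x| ∂μ) *
            ((∫ x, |g x| ∂μ) + (eVariationOn g (Set.Icc (0:ℝ) 1)).toReal) * p n

lemma cov_Ici {T : ℝ → ℝ} (hT : Measurable T) {μ : Measure ℝ} [IsProbabilityMeasure μ]
    {p : ℕ → ℝ} (hp : ∀ n, 0 < p n) (hd : Decay T μ p) {A : Set ℝ} (hA : MeasurableSet A)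
    (b : ℝ) (n : ℕ) :
    |μ.real (T^[n] ⁻¹' A ∩ Ici b) - μ.real A * μ.real (Ici b)| ≤ μ.real A * 2 * p n := by
  have hmono : MonotoneOn ((Ici b).indicator (1 : ℝ → ℝ)) (Icc 0 1) := by
    intro x _ y _ hxy
    by_cases hx : x ∈ Ici b
    · have hy : y ∈ Ici b := le_trans hx hxy
      simp [indicator_of_mem hx, indicator_of_mem hy]
    · rw [indicator_of_notMem hx]
      exact indicator_nonneg (fun _ _ => zero_le_one) _
  have hv : eVariationOn ((Ici b).indicator (1 : ℝ → ℝ)) (Icc 0 1) ≤ 1 := by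
    have h1 := hmono.eVariationOn_le (a := 0) (b := 1) (by simp) (by simp)
    rw [inter_self] at h1
    refine h1.trans ?_
    rw [← ENNReal.ofReal_one]
    apply ENNReal.ofReal_le_ofReal
    have h2 : (Ici b).indicator (1 : ℝ → ℝ) 1 ≤ 1 := indicator_le_self' (by simp) _
    have h3 : 0 ≤ (Ici b).indicator (1 : ℝ → ℝ) 0 := indicator_nonneg (fun _ _ => zero_le_one) _
    linarith
  have hf : Integrable (A.indicator (1 : ℝ → ℝ)) μ := (integrable_const (1:ℝ)).indicator hA
  have key := hd _ _ hf (ne_top_of_le_ne_top ENNReal.one_ne_top hv) n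
  have hprod : ∀ x, A.indicator (1 : ℝ → ℝ) (T^[n] x) * (Ici b).indicator (1 : ℝ → ℝ) x
      = (T^[n] ⁻¹' A ∩ Ici b).indicator (1 : ℝ → ℝ) x := by
    intro x
    by_cases h1 : T^[n] x ∈ A <;> by_cases h2 : x ∈ Ici b <;> simp_all [indicator]
  have habsA : ∀ x, |A.indicator (1 : ℝ → ℝ) x| = A.indicator (1 : ℝ → ℝ) x := fun x =>
    abs_of_nonneg (indicator_nonneg (fun _ _ => zero_le_one) _)
  have habsB : ∀ x, |(Ici b).indicator (1 : ℝ → ℝ) x| = (Ici b).indicator (1 : ℝ → ℝ) x := fun x =>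
    abs_of_nonneg (indicator_nonneg (fun _ _ => zero_le_one) _)
  simp only [hprod, habsA, habsB] at key
  rw [integral_indicator_one (((hT.iterate n) hA).inter measurableSet_Ici),
    integral_indicator_one hA, integral_indicator_one measurableSet_Ici] at key
  refine key.trans ?_
  have h1 : (eVariationOn ((Ici b).indicator (1 : ℝ → ℝ)) (Icc 0 1)).toReal ≤ 1 := by
    have := ENNReal.toReal_mono ENNReal.one_ne_top hv
    simpa using this
  have h2 : μ.real (Ici b) ≤ 1 := measureReal_le_one
  have h3 : 0 ≤ μ.real A := measureReal_nonneg
  have := (hp n).le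
  gcongr
  linarith

lemma cov_DD {T : ℝ → ℝ} (hT : Measurable T) {μ : Measure ℝ} [IsProbabilityMeasure μ]
    {p : ℕ → ℝ} (hp : ∀ n, 0 < p n) (hd : Decay T μ p) (e : ℕ) (j : ℤ) (n : ℕ) :
    μ.real (T^[n] ⁻¹' (DD e j) ∩ DD e j) ≤ μ.real (DD e j) ^ 2 + 4 * μ.real (DD e j) * p n := by
  have hA := DD_meas e j
  have k1 := cov_Ici hT hp hd hA ((j:ℝ) / 2 ^ e) n
  have k2 := cov_Ici hT hp hd hA (((j:ℝ) + 1) / 2 ^ e) n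
  have hJ : DD e j = Ici ((j:ℝ) / 2 ^ e) \ Ici (((j:ℝ) + 1) / 2 ^ e) := by
    rw [DD_eq_Ico]; ext x; simp
  have hle : (j:ℝ) / 2 ^ e ≤ ((j:ℝ) + 1) / 2 ^ e := by gcongr; linarith
  have hsub : Ici (((j:ℝ) + 1) / 2 ^ e) ⊆ Ici ((j:ℝ) / 2 ^ e) := Ici_subset_Ici.2 hle
  have e1 : μ.real (DD e j) = μ.real (Ici ((j:ℝ) / 2 ^ e)) - μ.real (Ici (((j:ℝ) + 1) / 2 ^ e)) := by
    conv_lhs => rw [hJ]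
    exact measureReal_diff hsub measurableSet_Ici
  have e2 : μ.real (T^[n] ⁻¹' (DD e j) ∩ DD e j) =
      μ.real (T^[n] ⁻¹' (DD e j) ∩ Ici ((j:ℝ) / 2 ^ e)) -
      μ.real (T^[n] ⁻¹' (DD e j) ∩ Ici (((j:ℝ) + 1) / 2 ^ e)) := by
    rw [← measureReal_diff (inter_subset_inter_right _ hsub)
      (((hT.iterate n) hA).inter measurableSet_Ici)]
    congr 1
    rw [← inter_diff_distrib_left, ← hJ]
  rw [abs_le] at k1 k2
  rw [e2]
  have e3 : μ.real (DD e j) ^ 2 = μ.real (DD e j) * μ.real (Ici ((j:ℝ) / 2 ^ e))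
    - μ.real (DD e j) * μ.real (Ici (((j:ℝ) + 1) / 2 ^ e)) := by
    rw [← mul_sub, ← e1, sq]
  linarith [k1.2, k2.1]

lemma cov2 {T : ℝ → ℝ} (hT : Measurable T) {μ : Measure ℝ} [IsProbabilityMeasure μ]
    (hinv : μ.map T = μ)
    {p : ℕ → ℝ} (hp : ∀ n, 0 < p n) (hd : Decay T μ p) (e : ℕ) (j : ℤ) (m n : ℕ) (hmn : m ≤ n) :
    μ.real (T^[m] ⁻¹' (DD e j) ∩ T^[n] ⁻¹' (DD e j)) ≤
      μ.real (DD e j) ^ 2 + 4 * μ.real (DD e j) * p (n - m) := by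
  have hmp : MeasurePreserving T μ μ := ⟨hT, hinv⟩
  have : T^[m] ⁻¹' (DD e j) ∩ T^[n] ⁻¹' (DD e j) =
      T^[m] ⁻¹' (T^[n - m] ⁻¹' (DD e j) ∩ DD e j) := by
    have : T^[n] = T^[n - m] ∘ T^[m] := by rw [← Function.iterate_add]; congr 1; omega
    rw [this, preimage_inter, preimage_comp, inter_comm]
  rw [this, (hmp.iterate m).measureReal_preimage
    (((hT.iterate _) (DD_meas e j)).inter (DD_meas e j)).nullMeasurableSet]
  exact cov_DD hT hp hd e j (n - m)

lemma sum_p {p : ℕ → ℝ} (hp : ∀ n, 0 < p n) (hs : Summable p) (S : Finset ℕ) (m : ℕ) :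
    ∑ n ∈ S, p (max m n - min m n) ≤ 2 * ∑' n, p n := by
  rw [← Finset.sum_filter_add_sum_filter_not S (fun n => m ≤ n), two_mul]
  have aux : ∀ (R : Finset ℕ), Set.InjOn (fun n => max m n - min m n) R →
      ∑ n ∈ R, p (max m n - min m n) ≤ ∑' n, p n := by
    intro R hR
    rw [← Finset.sum_image (f := p) hR]
    exact hs.sum_le_tsum _ (fun i _ => (hp i).le)
  gcongr
  · apply aux
    intro x hx y hy hxy
    simp at hx hy hxy
    omega
  · apply aux
    intro x hx y hy hxy
    simp at hx hy hxy
    omega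

lemma cnt_eq (a : ℕ → ℝ) (k : ℕ) (A : Set ℝ) :
    (cnt a k A : ℝ) = ∑ n ∈ Finset.Ico (2 ^ k) (2 ^ (k + 1)), A.indicator (1 : ℝ → ℝ) (a n) := by
  classical
  unfold cnt
  rw [Finset.card_filter]
  push_cast
  refine Finset.sum_congr rfl fun n _ => ?_
  by_cases h : a n ∈ A <;> simp [h]

lemma int_ind {T : ℝ → ℝ} (hT : Measurable T) {μ : Measure ℝ} [IsProbabilityMeasure μ]
    {A : Set ℝ} (hA : MeasurableSet A) (n : ℕ) :
    Integrable (fun x => A.indicator (1 : ℝ → ℝ) (T^[n] x)) μ := by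
  have : (fun x => A.indicator (1 : ℝ → ℝ) (T^[n] x)) = (T^[n] ⁻¹' A).indicator 1 := by
    ext x; rfl
  rw [this]
  exact (integrable_const (1:ℝ)).indicator ((hT.iterate n) hA)

lemma cnt_int {T : ℝ → ℝ} (hT : Measurable T) {μ : Measure ℝ} [IsProbabilityMeasure μ]
    {A : Set ℝ} (hA : MeasurableSet A) (k : ℕ) :
    Integrable (fun x => (cnt (fun n => T^[n] x) k A : ℝ)) μ := by
  simp only [cnt_eq]
  exact integrable_finset_sum _ fun n _ => int_ind hT hA n

lemma card_Ico_two (k : ℕ) : ((Finset.Ico (2 ^ k) (2 ^ (k + 1))).card : ℝ) = 2 ^ k := by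
  rw [Nat.card_Ico, Nat.cast_sub (Nat.pow_le_pow_right (by norm_num) (by omega))]
  push_cast; ring

lemma cnt_mean {T : ℝ → ℝ} (hT : Measurable T) {μ : Measure ℝ} [IsProbabilityMeasure μ]
    (hinv : μ.map T = μ)
    {A : Set ℝ} (hA : MeasurableSet A) (k : ℕ) :
    ∫ x, (cnt (fun n => T^[n] x) k A : ℝ) ∂μ = 2 ^ k * μ.real A := by
  have hmp : MeasurePreserving T μ μ := ⟨hT, hinv⟩
  simp only [cnt_eq]
  rw [integral_finset_sum _ fun n _ => int_ind hT hA n]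
  have : ∀ n, ∫ x, A.indicator (1 : ℝ → ℝ) (T^[n] x) ∂μ = μ.real A := by
    intro n
    have : (fun x => A.indicator (1 : ℝ → ℝ) (T^[n] x)) = (T^[n] ⁻¹' A).indicator 1 := by
      ext x; rfl
    rw [this, integral_indicator_one ((hT.iterate n) hA),
      (hmp.iterate n).measureReal_preimage hA.nullMeasurableSet]
  simp only [this, Finset.sum_const, nsmul_eq_mul, card_Ico_two]

lemma cnt_sq_eq (T : ℝ → ℝ) (A : Set ℝ) (k : ℕ) (x : ℝ) :
    (cnt (fun n => T^[n] x) k A : ℝ) ^ 2 =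
      ∑ m ∈ Finset.Ico (2 ^ k) (2 ^ (k + 1)), ∑ n ∈ Finset.Ico (2 ^ k) (2 ^ (k + 1)),
        (T^[m] ⁻¹' A ∩ T^[n] ⁻¹' A).indicator (1 : ℝ → ℝ) x := by
  rw [cnt_eq, sq, Finset.sum_mul_sum]
  refine Finset.sum_congr rfl fun m _ => Finset.sum_congr rfl fun n _ => ?_
  by_cases h1 : T^[m] x ∈ A <;> by_cases h2 : T^[n] x ∈ A <;> simp_all [indicator]

lemma cnt_sq_int {T : ℝ → ℝ} (hT : Measurable T) {μ : Measure ℝ} [IsProbabilityMeasure μ]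
    {A : Set ℝ} (hA : MeasurableSet A) (k : ℕ) :
    Integrable (fun x => (cnt (fun n => T^[n] x) k A : ℝ) ^ 2) μ := by
  simp only [cnt_sq_eq]
  exact integrable_finset_sum _ fun m _ => integrable_finset_sum _ fun n _ =>
    (integrable_const (1:ℝ)).indicator (((hT.iterate m) hA).inter ((hT.iterate n) hA))

lemma cnt_sq_mean {T : ℝ → ℝ} (hT : Measurable T) {μ : Measure ℝ} [IsProbabilityMeasure μ]
    (hinv : μ.map T = μ)
    {p : ℕ → ℝ} (hp : ∀ n, 0 < p n) (hs : Summable p) (hd : Decay T μ p) (e : ℕ) (j : ℤ) (k : ℕ) :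
    ∫ x, (cnt (fun n => T^[n] x) k (DD e j) : ℝ) ^ 2 ∂μ ≤
      (2 ^ k) ^ 2 * μ.real (DD e j) ^ 2 + 8 * (∑' n, p n) * μ.real (DD e j) * 2 ^ k := by
  have hA := DD_meas e j
  have hi : ∀ m n, Integrable
      ((T^[m] ⁻¹' (DD e j) ∩ T^[n] ⁻¹' (DD e j)).indicator (1 : ℝ → ℝ)) μ := fun m n =>
    (integrable_const (1:ℝ)).indicator (((hT.iterate m) hA).inter ((hT.iterate n) hA))
  simp only [cnt_sq_eq]
  rw [integral_finset_sum _ fun m _ => integrable_finset_sum _ fun n _ => hi m n]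
  have hm0 : 0 ≤ μ.real (DD e j) := measureReal_nonneg
  have hb : ∀ m n, ∫ x, (T^[m] ⁻¹' (DD e j) ∩ T^[n] ⁻¹' (DD e j)).indicator (1 : ℝ → ℝ) x ∂μ ≤
      μ.real (DD e j) ^ 2 + 4 * μ.real (DD e j) * p (max m n - min m n) := by
    intro m n
    rw [integral_indicator_one (((hT.iterate m) hA).inter ((hT.iterate n) hA))]
    rcases le_total m n with h | h
    · rw [max_eq_right h, min_eq_left h]
      exact cov2 hT hinv hp hd e j m n h
    · rw [max_eq_left h, min_eq_right h, inter_comm]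
      exact cov2 hT hinv hp hd e j n m h
  calc _ ≤ ∑ m ∈ Finset.Ico (2 ^ k) (2 ^ (k + 1)),
        (2 ^ k * μ.real (DD e j) ^ 2 + 4 * μ.real (DD e j) * (2 * ∑' n, p n)) := by
        refine Finset.sum_le_sum fun m _ => ?_
        rw [integral_finset_sum _ fun n _ => hi m n]
        refine (Finset.sum_le_sum fun n _ => hb m n).trans ?_
        rw [Finset.sum_add_distrib, Finset.sum_const, nsmul_eq_mul, card_Ico_two, ← Finset.mul_sum]
        gcongr
        exact sum_p hp hs _ m
    _ = _ := by
        rw [Finset.sum_const, nsmul_eq_mul, card_Ico_two]; ring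

lemma fatou_ae {μ : Measure ℝ} [IsProbabilityMeasure μ] (Y : ℕ → ℝ → ℝ) (B : ℝ)
    (hm : ∀ k, Measurable (Y k))
    (hY : ∀ k, Integrable (Y k) μ) (h0 : ∀ k x, 0 ≤ Y k x) (hB : ∀ k, ∫ x, Y k x ∂μ ≤ B) :
    ∀ᵐ x ∂μ, ∃ M > 0, ∃ᶠ k in atTop, Y k x ≤ M := by
  have h1 : ∫⁻ x, liminf (fun k => ENNReal.ofReal (Y k x)) atTop ∂μ ≤ ENNReal.ofReal B := by
    refine (lintegral_liminf_le' fun k => (hY k).aemeasurable.ennreal_ofReal).trans ?_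
    refine (liminf_le_liminf (v := fun _ => ENNReal.ofReal B) (Eventually.of_forall fun k => ?_)).trans ?_
    · rw [← ofReal_integral_eq_lintegral_ofReal (hY k) (Eventually.of_forall (h0 k))]
      exact ENNReal.ofReal_le_ofReal (hB k)
    · simp
  have h2 := ae_lt_top (Measurable.liminf fun k => (hm k).ennreal_ofReal)
    (ne_top_of_le_ne_top ENNReal.ofReal_ne_top h1)
  filter_upwards [h2] with x hx
  obtain ⟨M, hM1, hM2⟩ := ENNReal.lt_iff_exists_nnreal_btwn.1 hx
  refine ⟨M + 1, by positivity, ?_⟩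
  refine (frequently_lt_of_liminf_lt (by isBoundedDefault) hM1).mono fun k hk => ?_
  have := (ENNReal.ofReal_lt_iff_lt_toReal (h0 k x) ENNReal.coe_ne_top).1 hk
  simp at this
  linarith

lemma bc_ae {μ : Measure ℝ} [IsProbabilityMeasure μ] (Y : ℕ → ℝ → ℝ) (B : ℝ) (hB0 : 0 ≤ B)
    (hY : ∀ k, Integrable (Y k) μ) (h0 : ∀ k x, 0 ≤ Y k x)
    (hB : ∀ k, ∫ x, Y k x ∂μ ≤ B * (1 / 2) ^ k) (ε : ℝ) (hε : 0 < ε) :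
    ∀ᵐ x ∂μ, ∀ᶠ k in atTop, Y k x < ε := by
  have hm : ∀ k, AEMeasurable (fun x => ENNReal.ofReal (Y k x)) μ :=
    fun k => (hY k).aemeasurable.ennreal_ofReal
  have h1 : ∫⁻ x, ∑' k, ENNReal.ofReal (Y k x) ∂μ ≠ ⊤ := by
    rw [lintegral_tsum hm]
    refine ne_top_of_le_ne_top (b := ∑' k : ℕ, ENNReal.ofReal (B * (1 / 2) ^ k)) ?_ ?_
    · rw [← ENNReal.ofReal_tsum_of_nonneg (fun n => by positivity)
          (summable_geometric_two.mul_left _)]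
      exact ENNReal.ofReal_ne_top
    · refine ENNReal.tsum_le_tsum fun k => ?_
      rw [← ofReal_integral_eq_lintegral_ofReal (hY k) (Eventually.of_forall (h0 k))]
      exact ENNReal.ofReal_le_ofReal (hB k)
  have h2 := ae_lt_top' (AEMeasurable.ennreal_tsum hm) h1
  filter_upwards [h2] with x hx
  have h3 := ENNReal.tendsto_atTop_zero_of_tsum_ne_top hx.ne
  filter_upwards [h3.eventually_lt_const (ENNReal.ofReal_pos.2 hε)] with k hk
  exact (ENNReal.ofReal_lt_ofReal_iff hε).1 hk

lemma cnt_meas {T : ℝ → ℝ} (hT : Measurable T) {A : Set ℝ} (hA : MeasurableSet A) (k : ℕ) :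
    Measurable (fun x => (cnt (fun n => T^[n] x) k A : ℝ)) := by
  simp only [cnt_eq]
  exact Finset.measurable_sum _ fun n _ => (measurable_one.indicator hA).comp (hT.iterate n)

lemma sum_DD {μ : Measure ℝ} [IsProbabilityMeasure μ] (e : ℕ) (S : Finset ℤ) :
    ∑ j ∈ S, μ.real (DD e j) ≤ 1 := by
  rw [← measureReal_biUnion_finset _ (fun j _ => DD_meas e j)]
  · exact measureReal_le_one
  · intro i _ j _ hij
    rw [Function.onFun, Set.disjoint_left]
    intro x hx hy
    exact hij (hx.symm.trans hy)

lemma hyp1_ae {T : ℝ → ℝ} (hT : Measurable T) {μ : Measure ℝ} [IsProbabilityMeasure μ]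
    (hinv : μ.map T = μ)
    {p : ℕ → ℝ} (hp : ∀ n, 0 < p n) (hs : Summable p) (hd : Decay T μ p) {c : ℝ}
    (hub : ∀ (e : ℕ) (j : ℤ), 0 ≤ j → j < 2 ^ e → μ.real (DD e j) ≤ c / 2 ^ e) :
    ∀ᵐ x ∂μ, ∃ M > 0, ∃ᶠ k in atTop,
      ∑ j ∈ Finset.Ico (0:ℤ) (2 ^ k), (cnt (fun n => T^[n] x) k (DD k j) : ℝ) ^ 2 ≤ M * 2 ^ k := by
  have hi : ∀ k, Integrable (fun x => ∑ j ∈ Finset.Ico (0:ℤ) (2 ^ k),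
      (cnt (fun n => T^[n] x) k (DD k j) : ℝ) ^ 2) μ := fun k =>
    integrable_finset_sum _ fun j _ => cnt_sq_int hT (DD_meas k j) k
  have := fatou_ae (μ := μ) (fun k x => (∑ j ∈ Finset.Ico (0:ℤ) (2 ^ k),
    (cnt (fun n => T^[n] x) k (DD k j) : ℝ) ^ 2) / 2 ^ k) (c + 8 * ∑' n, p n)
    (fun k => (Finset.measurable_sum _ fun j _ => (cnt_meas hT (DD_meas k j) k).pow_const 2).div_const _)
    (fun k => (hi k).div_const _) (fun k x => by positivity) ?_
  · filter_upwards [this] with x ⟨M, hM, hx⟩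
    refine ⟨M, hM, hx.mono fun k hk => ?_⟩
    rwa [div_le_iff₀ (by positivity)] at hk
  · intro k
    rw [integral_div, integral_finset_sum _ fun j _ => cnt_sq_int hT (DD_meas k j) k,
      div_le_iff₀ (by positivity)]
    have hP : 0 ≤ ∑' n, p n := tsum_nonneg fun n => (hp n).le
    have hc : 0 ≤ c := by
      have := (measureReal_nonneg (μ := μ) (s := DD 0 0)).trans (hub 0 0 le_rfl (by simp))
      simpa using this
    calc _ ≤ ∑ j ∈ Finset.Ico (0:ℤ) (2 ^ k), ((c + 8 * ∑' n, p n) * 2 ^ k) * μ.real (DD k j) := by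
          refine Finset.sum_le_sum fun j hj => ?_
          rw [Finset.mem_Ico] at hj
          refine (cnt_sq_mean hT hinv hp hs hd k j k).trans ?_
          have h1 := hub k j hj.1 hj.2
          rw [le_div_iff₀ (by positivity)] at h1
          have h0 : 0 ≤ μ.real (DD k j) := measureReal_nonneg
          have h2 : (0:ℝ) < 2 ^ k := by positivity
          have h3 := mul_le_mul_of_nonneg_left h1 (mul_nonneg h2.le h0)
          nlinarith
      _ ≤ _ := by
          rw [← Finset.mul_sum]
          exact mul_le_of_le_one_right (by positivity) (sum_DD k _)

lemma hyp2_ae {T : ℝ → ℝ} (hT : Measurable T) {μ : Measure ℝ} [IsProbabilityMeasure μ]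
    (hinv : μ.map T = μ)
    {p : ℕ → ℝ} (hp : ∀ n, 0 < p n) (hs : Summable p) (hd : Decay T μ p) {c : ℝ} (hc : 0 < c)
    (hlb : ∀ (e : ℕ) (j : ℤ), 0 ≤ j → j < 2 ^ e → c / 2 ^ e ≤ μ.real (DD e j)) :
    ∀ᵐ x ∂μ, ∀ (e : ℕ) (j : ℤ), 0 ≤ j → j < 2 ^ e →
      ∀ᶠ k in atTop, c / 2 * 2 ^ k / 2 ^ e ≤ cnt (fun n => T^[n] x) k (DD e j) := by
  rw [ae_all_iff]; intro e
  rw [ae_all_iff]; intro j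
  rw [ae_all_iff]; intro hj0
  rw [ae_all_iff]; intro hj1
  have hm := hlb e j hj0 hj1
  set m := μ.real (DD e j) with hmdef
  have hm0 : 0 < m := lt_of_lt_of_le (by positivity) hm
  have hP : 0 ≤ ∑' n, p n := tsum_nonneg fun n => (hp n).le
  have hexp : ∀ (k : ℕ) (x : ℝ), ((cnt (fun n => T^[n] x) k (DD e j) : ℝ) / 2 ^ k - m) ^ 2 =
      (1 / (2 ^ k) ^ 2) * (cnt (fun n => T^[n] x) k (DD e j) : ℝ) ^ 2
        - (2 * m / 2 ^ k) * (cnt (fun n => T^[n] x) k (DD e j) : ℝ) + m ^ 2 := by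
    intro k x
    field_simp
    ring
  have i1 : ∀ k : ℕ, Integrable (fun x => (1 / ((2:ℝ) ^ k) ^ 2) * (cnt (fun n => T^[n] x) k (DD e j) : ℝ) ^ 2) μ :=
    fun k => (cnt_sq_int hT (DD_meas e j) k).const_mul _
  have i2 : ∀ k : ℕ, Integrable (fun x => (2 * m / 2 ^ k) * (cnt (fun n => T^[n] x) k (DD e j) : ℝ)) μ :=
    fun k => (cnt_int hT (DD_meas e j) k).const_mul _
  have := bc_ae (μ := μ) (fun k x => ((cnt (fun n => T^[n] x) k (DD e j) : ℝ) / 2 ^ k - m) ^ 2)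
    (8 * (∑' n, p n) * m) (by positivity) (fun k => ?_) (fun k x => by positivity) (fun k => ?_)
    ((m / 2) ^ 2) (by positivity)
  · filter_upwards [this] with x hx
    filter_upwards [hx] with k hk
    have h1 := abs_lt_of_sq_lt_sq hk (by positivity)
    rw [abs_lt] at h1
    have h2 : m / 2 < (cnt (fun n => T^[n] x) k (DD e j) : ℝ) / 2 ^ k := by linarith [h1.1]
    rw [lt_div_iff₀ (by positivity)] at h2
    refine le_trans ?_ h2.le
    have : c / 2 * 2 ^ k / 2 ^ e = c / 2 ^ e / 2 * 2 ^ k := by ring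
    rw [this]
    gcongr
  · simp only [hexp]
    exact ((i1 k).sub (i2 k)).add (integrable_const _)
  · simp only [hexp]
    have i3 : Integrable (fun x => (1 / ((2:ℝ) ^ k) ^ 2) * (cnt (fun n => T^[n] x) k (DD e j) : ℝ) ^ 2
        - (2 * m / 2 ^ k) * (cnt (fun n => T^[n] x) k (DD e j) : ℝ)) μ := (i1 k).sub (i2 k)
    rw [integral_add i3 (integrable_const _), integral_sub (i1 k) (i2 k),
      integral_const_mul, integral_const_mul, cnt_mean hT hinv (DD_meas e j)]
    have h1 := cnt_sq_mean hT hinv hp hs hd e j k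
    rw [← hmdef] at h1 ⊢
    have h2 := mul_le_mul_of_nonneg_left h1 (by positivity : 0 ≤ 1 / ((2:ℝ) ^ k) ^ 2)
    have e1 : 1 / ((2:ℝ) ^ k) ^ 2 * ((2 ^ k) ^ 2 * m ^ 2 + 8 * (∑' n, p n) * m * 2 ^ k) =
        m ^ 2 + 8 * (∑' n, p n) * m * (1 / 2) ^ k := by
      rw [one_div_pow]
      field_simp
    have e2 : 2 * m / 2 ^ k * (2 ^ k * m) = 2 * m ^ 2 := by field_simp
    rw [e1] at h2
    rw [e2]
    simp only [integral_const, probReal_univ, smul_eq_mul]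
    linarith

lemma vol_DD {e : ℕ} {j : ℤ} (h0 : 0 ≤ j) (h1 : j < 2 ^ e) :
    volume (DD e j ∩ Icc 0 1) = ENNReal.ofReal (1 / 2 ^ e) := by
  have hsub : DD e j ⊆ Icc 0 1 := by
    rw [DD_eq_Ico]
    intro x hx
    have a1 : (0:ℝ) ≤ j / 2 ^ e := by
      have : (0:ℝ) ≤ j := by exact_mod_cast h0
      positivity
    have a2 : ((j:ℝ) + 1) / 2 ^ e ≤ 1 := by
      rw [div_le_one (by positivity)]
      exact_mod_cast h1
    exact ⟨a1.trans hx.1, hx.2.le.trans a2⟩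
  rw [inter_eq_left.2 hsub, DD_eq_Ico, Real.volume_Ico]
  congr 1; ring

lemma dens_bd {μ : Measure ℝ} [IsProbabilityMeasure μ] {h : ℝ → ℝ} {c_h : ℝ} (hch : 0 < c_h)
    (hdens : μ = (volume.restrict (Set.Icc (0:ℝ) 1)).withDensity
      (fun x => ENNReal.ofReal (h x)))
    (hhbd : ∀ᵐ x ∂(volume.restrict (Set.Icc (0:ℝ) 1)), c_h⁻¹ < h x ∧ h x < c_h) (A : Set ℝ)
    (hA : MeasurableSet A) :
    μ A ≤ ENNReal.ofReal c_h * volume (A ∩ Icc 0 1) ∧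
    ENNReal.ofReal c_h⁻¹ * volume (A ∩ Icc 0 1) ≤ μ A := by
  have e : μ A = ∫⁻ x in A, ENNReal.ofReal (h x) ∂(volume.restrict (Set.Icc (0:ℝ) 1)) := by
    conv_lhs => rw [hdens]
    exact withDensity_apply _ hA
  have e2 : ∀ c : ENNReal, ∫⁻ x in A, c ∂(volume.restrict (Set.Icc (0:ℝ) 1)) =
      c * volume (A ∩ Icc 0 1) := by
    intro c
    rw [setLIntegral_const, Measure.restrict_apply hA]
  rw [e, ← e2, ← e2]
  constructor
  · refine lintegral_mono_ae (ae_restrict_of_ae ?_)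
    filter_upwards [hhbd] with x hx using ENNReal.ofReal_le_ofReal hx.2.le
  · refine lintegral_mono_ae (ae_restrict_of_ae ?_)
    filter_upwards [hhbd] with x hx using ENNReal.ofReal_le_ofReal hx.1.le

lemma ae_transfer {μ : Measure ℝ} [IsProbabilityMeasure μ] {h : ℝ → ℝ} {c_h : ℝ} (hch : 0 < c_h)
    (hdens : μ = (volume.restrict (Set.Icc (0:ℝ) 1)).withDensity
      (fun x => ENNReal.ofReal (h x)))
    (hhbd : ∀ᵐ x ∂(volume.restrict (Set.Icc (0:ℝ) 1)), c_h⁻¹ < h x ∧ h x < c_h)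
    {P : ℝ → Prop} (hP : ∀ᵐ x ∂μ, P x) : ∀ᵐ x ∂(volume : Measure ℝ), x ∈ Icc (0:ℝ) 1 → P x := by
  rw [← ae_restrict_iff' measurableSet_Icc]
  have hac : volume.restrict (Icc (0:ℝ) 1) ≪ μ := by
    refine Measure.AbsolutelyContinuous.mk fun A hA hA0 => ?_
    have := (dens_bd hch hdens hhbd A hA).2
    rw [hA0, nonpos_iff_eq_zero, mul_eq_zero] at this
    rw [Measure.restrict_apply hA]
    rcases this with h | h
    · rw [ENNReal.ofReal_eq_zero] at h
      have := inv_pos.2 hch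
      linarith
    · exact h
  exact hac.ae_le hP

lemma det_dim {T : ℝ → ℝ} {x α : ℝ} (hα : 1 ≤ α) {r : ℕ → ℝ} (hr : ∀ n : ℕ, r n = (n : ℝ) ^ (-α))
    {M c : ℝ} (hc : 0 < c) (hM : 0 < M)
    (h1 : ∃ᶠ k in atTop,
      ∑ j ∈ Finset.Ico (0:ℤ) (2 ^ k), (cnt (fun n => T^[n] x) k (DD k j) : ℝ) ^ 2 ≤ M * 2 ^ k)
    (h2 : ∀ (e : ℕ) (j : ℤ), 0 ≤ j → j < 2 ^ e →
      ∀ᶠ k in atTop, c * 2 ^ k / 2 ^ e ≤ cnt (fun n => T^[n] x) k (DD e j)) :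
    dimH {y ∈ Set.Icc (0 : ℝ) 1 | ∃ᶠ n in Filter.atTop, |T^[n] x - y| < r n} =
      ENNReal.ofReal (1 / α) := by
  have hα0 : 0 < α := by linarith
  set E := {y ∈ Set.Icc (0 : ℝ) 1 | ∃ᶠ n in Filter.atTop, |T^[n] x - y| < r n} with hE
  apply le_antisymm
  · refine le_of_forall_gt fun d hd => ?_
    obtain ⟨s, hs1, hs2⟩ := ENNReal.lt_iff_exists_nnreal_btwn.1 hd
    refine lt_of_le_of_lt ?_ hs2
    have hs : 1 / α < s := by
      have := (ENNReal.ofReal_lt_iff_lt_toReal (by positivity) ENNReal.coe_ne_top).1 hs1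
      simpa using this
    have hs0 : (0:ℝ) < s := lt_trans (by positivity) hs
    apply dimH_le_of_hausdorffMeasure_ne_top
    rw [upper hα hs0 (by rwa [div_lt_iff₀ hα0] at hs) (fun n => T^[n] x) E ?_]
    · simp
    · intro y hy
      have := hy.2
      simpa only [hr] using this
  · refine le_of_forall_lt fun d hd => ?_
    obtain ⟨s, hs1, hs2⟩ := ENNReal.lt_iff_exists_nnreal_btwn.1 hd
    refine lt_of_lt_of_le hs1 ?_
    have hs : (s:ℝ) < 1 / α := by
      have := (ENNReal.lt_ofReal_iff_toReal_lt ENNReal.coe_ne_top).1 hs2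
      simpa using this
    have hs0 : (0:ℝ) < s := by
      have : 0 < s := by
        have := lt_of_le_of_lt zero_le hs1
        exact_mod_cast this
      exact_mod_cast this
    have hsα : s * α < 1 := by rwa [lt_div_iff₀ hα0] at hs
    apply le_dimH_of_hausdorffMeasure_ne_zero
    intro h0
    obtain ⟨lev, idx, g1, g2, g3⟩ := dyadic_cover hs0 (by nlinarith) h0
    obtain ⟨y, hy1, hy2, hy3⟩ := exists_point hs0 hα hsα hc hM h1 h2 lev idx g1 g2
    obtain ⟨i, hi⟩ := g3 y ⟨hy1, by simpa only [hr] using hy2⟩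
    exact hy3 i hi

theorem stmt_1
    (T : ℝ → ℝ) (hT : Set.MapsTo T (Set.Icc (0:ℝ) 1) (Set.Icc (0:ℝ) 1))
    (hTmeas : Measurable T)
    (μ : Measure ℝ) [IsProbabilityMeasure μ]
    (hinv : μ.map T = μ)
    (h : ℝ → ℝ) (c_h : ℝ) (hch : 0 < c_h)
    (hdens : μ = (volume.restrict (Set.Icc (0:ℝ) 1)).withDensity
      (fun x => ENNReal.ofReal (h x)))
    (hhbd : ∀ᵐ x ∂(volume.restrict (Set.Icc (0:ℝ) 1)), c_h⁻¹ < h x ∧ h x < c_h)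
    (p : ℕ → ℝ) (hppos : ∀ n, 0 < p n) (hpsum : Summable p)
    (hdecay : ∀ f g : ℝ → ℝ, Integrable f μ → BoundedVariationOn g (Set.Icc (0:ℝ) 1) →
      ∀ n : ℕ,
        |(∫ x, f (T^[n] x) * g x ∂μ) - (∫ x, f x ∂μ) * (∫ x, g x ∂μ)| ≤
          (∫ x, |f x| ∂μ) *
            ((∫ x, |g x| ∂μ) + (eVariationOn g (Set.Icc (0:ℝ) 1)).toReal) * p n)
    (α : ℝ) (hα : 1 ≤ α)
    (r : ℕ → ℝ) (hr : ∀ n : ℕ, r n = (n : ℝ) ^ (-α)) :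
    ∀ᵐ x ∂(volume : Measure ℝ), x ∈ Set.Icc (0:ℝ) 1 →
      dimH (hitSet T x r) = ENNReal.ofReal (1 / α) := by
  have hd : Decay T μ p := hdecay
  have hub : ∀ (e : ℕ) (j : ℤ), 0 ≤ j → j < 2 ^ e → μ.real (DD e j) ≤ c_h / 2 ^ e := by
    intro e j h0 h1
    have := (dens_bd hch hdens hhbd (DD e j) (DD_meas e j)).1
    rw [vol_DD h0 h1, ← ENNReal.ofReal_mul hch.le] at this
    have h2 := ENNReal.toReal_le_of_le_ofReal (by positivity) this
    rw [Measure.real]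
    refine h2.trans (le_of_eq (by ring))
  have hlb : ∀ (e : ℕ) (j : ℤ), 0 ≤ j → j < 2 ^ e → c_h⁻¹ / 2 ^ e ≤ μ.real (DD e j) := by
    intro e j h0 h1
    have := (dens_bd hch hdens hhbd (DD e j) (DD_meas e j)).2
    rw [vol_DD h0 h1, ← ENNReal.ofReal_mul (by positivity)] at this
    have h2 := (ENNReal.ofReal_le_iff_le_toReal (measure_ne_top _ _)).1 this
    rw [Measure.real]
    refine le_trans (le_of_eq (by ring)) h2
  refine ae_transfer hch hdens hhbd ?_
  filter_upwards [hyp1_ae hTmeas hinv hppos hpsum hd hub,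
    hyp2_ae hTmeas hinv hppos hpsum hd (inv_pos.2 hch) hlb] with x ⟨M, hM, h1⟩ h2
  exact det_dim hα hr (half_pos (inv_pos.2 hch)) hM h1 h2
end

section
/- Let T : [0,1] → [0,1] be piecewise monotone and uniformly expanding with respect to a finite partition of [0,1] into intervals (on each partition interval T extends to a monotone C¹ map on a neighbourhood of its closure with |T′| ≥ λ > 1), with bounded distortion for T′ (there is D ≥ 1 such that |(Tⁿ)′(x)/(Tⁿ)′(y)| ≤ D whenever x,y lie in the same cylinder of generation n). Let φ : [0,1] → ℝ have bounded distortion, and suppose μ_φ = h_φ·ν_φ is a T-invariant Borel probability measure, where h_φ is bounded and bounded away from zero and ν_φ is conformal: ν_φ(T(A)) = ∫_A e^{P(φ)−φ} dν_φ for every measurable set A contained in a single partition interval, P(φ) being a real constant. Assume there is p : ℕ → (0,∞) with Σ p(n) < ∞ such that |∫ (f∘Tⁿ)·g dμ_φ − ∫ f dμ_φ · ∫ g dμ_φ| ≤ ‖f‖₁ (‖g‖₁ + Var g) p(n) for all f ∈ L¹(μ_φ), all g of bounded variation and all n. Finally assume there is s₀ > 0 such that for each s < s₀ there is c_s with μ_φ(I)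 ≤ c_s|I|^s for every interval I ⊂ [0,1]. Let (r_n) be a decreasing sequence of positive reals and s = sup{ t < s₀ : ∃ c > 0 such that n⁻² Σ_{j=1}^n r_j^{−t} < c for all n }. Then for μ_φ-almost every x, the Hausdorff dimension of E(x,r) is at least s. -/
open MeasureTheory Filter Set

/-- `x` and `y` belong to the same cylinder of generation `n` for the map `T` with respect to
the partition `{[a i, a (i+1)) : i < m}` of `[0,1]`. -/
def SameCylinder (T : ℝ → ℝ) (m : ℕ) (a : ℕ → ℝ) (n : ℕ) (x y : ℝ) : Prop :=
  ∀ k < n, ∃ i < m, T^[k] x ∈ Set.Ico (a i) (a (i + 1)) ∧ T^[k] y ∈ Set.Ico (a i) (a (i + 1))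


section
open MeasureTheory Filter Set


def dcell (l : ℕ) (i : ℤ) : Set ℝ := {y | ⌊y * 2 ^ l⌋ = i}

noncomputable def dix (l : ℕ) (y : ℝ) : ℤ := ⌊y * 2 ^ l⌋

lemma mem_dcell {l : ℕ} {i : ℤ} {y : ℝ} : y ∈ dcell l i ↔ dix l y = i := Iff.rfl

lemma mem_dcell_dix (l : ℕ) (y : ℝ) : y ∈ dcell l (dix l y) := rfl

lemma dcell_eq_Ico (l : ℕ) (i : ℤ) :
    dcell l i = Ico ((i : ℝ) / 2 ^ l) (((i : ℝ) + 1) / 2 ^ l) := by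
  ext y
  have h : (0:ℝ) < 2 ^ l := by positivity
  simp only [dcell, mem_ofPred_eq, mem_Ico, Int.floor_eq_iff, div_le_iff₀ h, lt_div_iff₀ h]

lemma measurable_dix (l : ℕ) : Measurable (dix l) := by
  unfold dix
  exact Int.measurable_floor.comp (measurable_id.mul_const _)

lemma measurableSet_dcell (l : ℕ) (i : ℤ) : MeasurableSet (dcell l i) := by
  rw [dcell_eq_Ico]; exact measurableSet_Ico

lemma dix_of_le {l l' : ℕ} (h : l ≤ l') (y : ℝ) : dix l y = dix l' y / ((2 ^ (l' - l) : ℕ) : ℤ) := by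
  unfold dix
  rw [← Int.floor_div_natCast]
  congr 1
  obtain ⟨k, rfl⟩ := Nat.exists_eq_add_of_le h
  have h2 : (0:ℝ) < 2 ^ k := by positivity
  simp only [Nat.add_sub_cancel_left, Nat.cast_pow, Nat.cast_ofNat, pow_add]
  field_simp

lemma dix_eq_of_le {l l' : ℕ} (h : l ≤ l') {y z : ℝ} (hyz : dix l' y = dix l' z) :
    dix l y = dix l z := by
  rw [dix_of_le h, dix_of_le h, hyz]

lemma dcell_nested {l l' : ℕ} (h : l ≤ l') {i i' : ℤ} {y : ℝ} (hy : y ∈ dcell l i)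
    (hy' : y ∈ dcell l' i') : dcell l' i' ⊆ dcell l i := by
  intro z hz
  rw [mem_dcell] at *
  rw [← hy]
  exact dix_eq_of_le h (hz.trans hy'.symm)

lemma dcell_anti {l l' : ℕ} (h : l ≤ l') (y : ℝ) :
    dcell l' (dix l' y) ⊆ dcell l (dix l y) :=
  dcell_nested h (mem_dcell_dix l y) (mem_dcell_dix l' y)

lemma dcell_disj (l : ℕ) {i j : ℤ} (h : i ≠ j) : Disjoint (dcell l i) (dcell l j) := by
  rw [Set.disjoint_left]
  intro y h1 h2
  exact h (h1.symm.trans h2)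

lemma exists_maximal_cells (S : Set (ℕ × ℤ)) :
    ∃ D ⊆ S, (∀ c ∈ D, ∀ c' ∈ D, c ≠ c' → Disjoint (dcell c.1 c.2) (dcell c'.1 c'.2)) ∧
      ∀ l y, (l, dix l y) ∈ S → ∃ c ∈ D, y ∈ dcell c.1 c.2 := by
  classical
  refine ⟨{c ∈ S | ∀ c' ∈ S, c'.1 < c.1 → Disjoint (dcell c'.1 c'.2) (dcell c.1 c.2)},
    fun c hc => hc.1, ?_, ?_⟩
  · intro c hc c' hc' hne
    rcases lt_trichotomy c.1 c'.1 with h | h | h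
    · exact hc'.2 c hc.1 h
    · have : c.2 ≠ c'.2 := fun h2 => hne (Prod.ext h h2)
      rw [h]
      exact dcell_disj _ this
    · exact (hc.2 c' hc'.1 h).symm
  · intro l y hl
    have hex : ∃ l, (l, dix l y) ∈ S := ⟨l, hl⟩
    refine ⟨(Nat.find hex, dix (Nat.find hex) y), ⟨Nat.find_spec hex, ?_⟩, mem_dcell_dix _ _⟩
    intro c' hc' hlt
    by_contra hnd
    rw [Set.not_disjoint_iff] at hnd
    obtain ⟨z, hz, hz'⟩ := hnd
    have := dcell_nested hlt.le hz hz' (mem_dcell_dix _ y)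
    apply Nat.find_min hex hlt
    rw [mem_dcell] at this
    rw [this]
    exact hc'

lemma dyadic_maximal (ν μ : Measure ℝ) (δ : ENNReal) :
    ν {y | ∃ l, ν (dcell l (dix l y)) < δ * μ (dcell l (dix l y))} ≤ δ * μ univ := by
  obtain ⟨D, hDS, hdisj, hcov⟩ := exists_maximal_cells
    {c | ν (dcell c.1 c.2) < δ * μ (dcell c.1 c.2)}
  have hsub : {y | ∃ l, ν (dcell l (dix l y)) < δ * μ (dcell l (dix l y))} ⊆
      ⋃ c : D, dcell c.1.1 c.1.2 := by
    rintro y ⟨l, hl⟩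
    obtain ⟨c, hc, hy⟩ := hcov l y hl
    exact mem_iUnion.2 ⟨⟨c, hc⟩, hy⟩
  calc _ ≤ ν (⋃ c : D, dcell c.1.1 c.1.2) := measure_mono hsub
    _ ≤ ∑' c : D, ν (dcell c.1.1 c.1.2) := measure_iUnion_le _
    _ ≤ ∑' c : D, δ * μ (dcell c.1.1 c.1.2) := by
        apply ENNReal.tsum_le_tsum
        intro c
        exact (hDS c.2).le
    _ = δ * ∑' c : D, μ (dcell c.1.1 c.1.2) := ENNReal.tsum_mul_left
    _ ≤ δ * μ (⋃ c : D, dcell c.1.1 c.1.2) := by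
        gcongr
        apply tsum_meas_le_meas_iUnion_of_disjoint
        · intro c; exact measurableSet_dcell _ _
        · intro c c' hne
          exact hdisj c.1 c.2 c'.1 c'.2 (fun h => hne (Subtype.ext h))
    _ ≤ δ * μ univ := by gcongr; exact subset_univ _

lemma sum_cells_le (μ : Measure ℝ) (l : ℕ) : ∑' i : ℤ, μ (dcell l i) ≤ μ univ :=
  (tsum_meas_le_meas_iUnion_of_disjoint μ (fun i => measurableSet_dcell l i)
    (fun _ _ h => dcell_disj l h)).trans (measure_mono (subset_univ _))

lemma child_small (μ : Measure ℝ) (l : ℕ) (ε : ENNReal) :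
    μ {y | μ (dcell (l+1) (dix (l+1) y)) < ε * μ (dcell l (dix l y))} ≤ 2 * (ε * μ univ) := by
  classical
  have key : ∀ e : ℤ, μ (⋃ j : ℤ, if μ (dcell (l+1) (2*j+e)) < ε * μ (dcell l j) then
      dcell (l+1) (2*j+e) else ∅) ≤ ε * μ univ := by
    intro e
    calc _ ≤ ∑' j : ℤ, μ (if μ (dcell (l+1) (2*j+e)) < ε * μ (dcell l j) then
      dcell (l+1) (2*j+e) else ∅) := measure_iUnion_le _
      _ ≤ ∑' j : ℤ, ε * μ (dcell l j) := by
        apply ENNReal.tsum_le_tsum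
        intro j
        split_ifs with h
        · exact h.le
        · simp
      _ = ε * ∑' j : ℤ, μ (dcell l j) := ENNReal.tsum_mul_left
      _ ≤ _ := by gcongr; exact sum_cells_le μ l
  have hsub : {y | μ (dcell (l+1) (dix (l+1) y)) < ε * μ (dcell l (dix l y))} ⊆
      (⋃ j : ℤ, if μ (dcell (l+1) (2*j+0)) < ε * μ (dcell l j) then
      dcell (l+1) (2*j+0) else ∅) ∪ (⋃ j : ℤ, if μ (dcell (l+1) (2*j+1)) < ε * μ (dcell l j) then
      dcell (l+1) (2*j+1) else ∅) := by
    intro y hy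
    rw [mem_ofPred_eq] at hy
    have h1 : dix l y = dix (l+1) y / 2 := by
      have := dix_of_le (Nat.le_succ l) y
      simpa using this
    rcases Int.emod_two_eq_zero_or_one (dix (l+1) y) with h | h
    · left
      have h2 : dix (l+1) y = 2 * dix l y + 0 := by omega
      refine mem_iUnion.2 ⟨dix l y, ?_⟩
      rw [← h2, if_pos hy]; exact mem_dcell_dix _ _
    · right
      have h2 : dix (l+1) y = 2 * dix l y + 1 := by omega
      refine mem_iUnion.2 ⟨dix l y, ?_⟩
      rw [← h2, if_pos hy]; exact mem_dcell_dix _ _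
  calc _ ≤ _ := measure_mono hsub
    _ ≤ _ := measure_union_le _ _
    _ ≤ ε * μ univ + ε * μ univ := add_le_add (key 0) (key 1)
    _ = _ := (two_mul _).symm

lemma ball_measure_le {m : Measure ℝ} {C d : ℝ} (hC : 1 ≤ C) (hd : 0 < d) (hm1 : m univ ≤ 1)
    (hm : ∀ l i, m (dcell l i) ≤ ENNReal.ofReal (C * ((2:ℝ) ^ (-d)) ^ l)) (z ρ : ℝ) (hρ : 0 < ρ) :
    m (Metric.ball z ρ) ≤ ENNReal.ofReal (3 * C * 2 ^ d * ρ ^ d) := by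
  have hC0 : 0 < C := by linarith
  have h2d : (1:ℝ) ≤ 2 ^ d := Real.one_le_rpow (by norm_num) hd.le
  rcases le_or_gt ρ 1 with h1 | h1
  · obtain ⟨l, hl1, hl2⟩ := exists_nat_pow_near_of_lt_one hρ h1 (by norm_num : (0:ℝ) < 1/2) (by norm_num)
    have hsub : Metric.ball z ρ ⊆ dcell l (dix l z - 1) ∪ (dcell l (dix l z) ∪ dcell l (dix l z + 1)) := by
      intro y hy
      rw [Metric.mem_ball, Real.dist_eq] at hy
      have h3 : |y * 2 ^ l - z * 2 ^ l| < 1 := by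
        rw [← sub_mul, abs_mul, abs_of_pos (by positivity : (0:ℝ) < 2 ^ l)]
        calc |y - z| * 2 ^ l < ρ * 2 ^ l := by gcongr
          _ ≤ (1/2) ^ l * 2 ^ l := by gcongr
          _ = 1 := by rw [← mul_pow]; norm_num
      rw [abs_lt] at h3
      have a1 := Int.floor_le (y * 2 ^ l)
      have a2 := Int.lt_floor_add_one (y * 2 ^ l)
      have a3 := Int.floor_le (z * 2 ^ l)
      have a4 := Int.lt_floor_add_one (z * 2 ^ l)
      have b1 : ((⌊y * 2^l⌋ : ℤ):ℝ) < ((⌊z * 2 ^ l⌋ + 2 : ℤ) : ℝ) := by push_cast; linarith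
      have b2 : ((⌊z * 2^l⌋ : ℤ):ℝ) < ((⌊y * 2 ^ l⌋ + 2 : ℤ) : ℝ) := by push_cast; linarith
      have b1 := Int.cast_lt.1 b1
      have b2 := Int.cast_lt.1 b2
      simp only [mem_union, mem_dcell]
      unfold dix
      omega
    have ha : ((2:ℝ) ^ (-d)) ^ (l+1) ≤ ρ ^ d := by
      calc ((2:ℝ) ^ (-d)) ^ (l+1) = ((1/2 : ℝ) ^ (l+1)) ^ d := by
            rw [← Real.rpow_natCast, ← Real.rpow_natCast, ← Real.rpow_mul (by norm_num),
              ← Real.rpow_mul (by norm_num), one_div, Real.inv_rpow (by norm_num),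
              ← Real.rpow_neg (by norm_num)]
            congr 1; ring
        _ ≤ ρ ^ d := by
            apply Real.rpow_le_rpow (by positivity) hl1.le hd.le
    have hX : C * ((2:ℝ) ^ (-d)) ^ l ≤ C * 2 ^ d * ρ ^ d := by
      rw [mul_assoc]
      gcongr
      calc ((2:ℝ) ^ (-d)) ^ l = 2 ^ d * ((2:ℝ) ^ (-d)) ^ (l+1) := by
            rw [pow_succ, mul_comm _ ((2:ℝ) ^ (-d)), ← mul_assoc, ← Real.rpow_add (by norm_num)]
            simp
        _ ≤ _ := by gcongr
    calc m (Metric.ball z ρ) ≤ _ := measure_mono hsub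
      _ ≤ m (dcell l (dix l z - 1)) + (m (dcell l (dix l z)) + m (dcell l (dix l z + 1))) :=
        (measure_union_le _ _).trans (by gcongr; exact measure_union_le _ _)
      _ ≤ ENNReal.ofReal (C * 2 ^ d * ρ ^ d) + (ENNReal.ofReal (C * 2 ^ d * ρ ^ d) +
          ENNReal.ofReal (C * 2 ^ d * ρ ^ d)) := by
        have := ENNReal.ofReal_le_ofReal hX
        gcongr <;> exact (hm _ _).trans this
      _ = _ := by
        rw [← ENNReal.ofReal_add (by positivity) (by positivity),
          ← ENNReal.ofReal_add (by positivity) (by positivity)]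
        congr 1; ring
  · calc m (Metric.ball z ρ) ≤ m univ := measure_mono (subset_univ _)
      _ ≤ ENNReal.ofReal 1 := by simpa using hm1
      _ ≤ _ := by
        apply ENNReal.ofReal_le_ofReal
        have : (1:ℝ) ≤ ρ ^ d := Real.one_le_rpow h1.le hd.le
        have h3 : (1:ℝ) ≤ 3 * C := by linarith
        have h4 : (1:ℝ) ≤ 3 * C * 2 ^ d := one_le_mul_of_one_le_of_one_le h3 h2d
        exact one_le_mul_of_one_le_of_one_le h4 this

lemma dimH_iInter_ge {K : ℕ → Set ℝ} {m : ℕ → Measure ℝ} {C d : ℝ} (hC : 1 ≤ C) (hd : 0 < d)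
    (hK : ∀ n, IsCompact (K n)) (hanti : Antitone K) (hm1 : ∀ n, m n univ ≤ 1)
    (hm2 : ∀ n, 1 / 2 ≤ m n (K n))
    (hm : ∀ n l i, m n (dcell l i) ≤ ENNReal.ofReal (C * ((2:ℝ) ^ (-d)) ^ l)) :
    ENNReal.ofReal d ≤ dimH (⋂ n, K n) := by
  by_contra hlt
  rw [not_le] at hlt
  have h0 : μH[d] (⋂ n, K n) = 0 := by
    have := hausdorffMeasure_of_dimH_lt (d := d.toNNReal) hlt
    simpa [Real.coe_toNNReal d hd.le] using this
  set B : ℝ := 3 * C * 2 ^ d with hB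
  have hBpos : 0 < B := by positivity
  set ε : ℝ := 1 / (8 * B) with hε
  have hεpos : 0 < ε := by positivity
  rw [Measure.hausdorffMeasure_apply] at h0
  have h1 : (⨅ (t : ℕ → Set ℝ), ⨅ (_ : (⋂ n, K n) ⊆ ⋃ n, t n),
            ⨅ (_ : ∀ (n : ℕ), Metric.ediam (t n) ≤ 1), ∑' (n : ℕ), ⨆ (_ : (t n).Nonempty), Metric.ediam (t n) ^ d) < ENNReal.ofReal ε := by
    have h0' := le_of_eq h0
    rw [iSup_le_iff] at h0'
    have h0' := h0' 1
    rw [iSup_le_iff] at h0'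
    have h0' := h0' one_pos
    exact lt_of_le_of_lt h0' (by simpa using hεpos)
  simp only [iInf_lt_iff] at h1
  obtain ⟨t, hcov, hdiam, hsum⟩ := h1
  obtain ⟨e, hepos, esum, hesum, hele⟩ : ∃ e : ℕ → ℝ, (∀ n, 0 < e n) ∧ ∃ c, HasSum e c ∧ c ≤ ε := by
    obtain ⟨e, h1, c, h2, h3⟩ := posSumOfEncodable hεpos ℕ
    exact ⟨e, h1, c, h2, h3⟩

  have hrad : ∀ n, ∃ V : Set ℝ, IsOpen V ∧ t n ⊆ V ∧ ∀ k, m k V ≤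
      ENNReal.ofReal B * ((⨆ (_ : (t n).Nonempty), Metric.ediam (t n) ^ d) + ENNReal.ofReal (e n)) := by
    intro n
    rcases (t n).eq_empty_or_nonempty with hemp | hne
    · refine ⟨∅, isOpen_empty, by rw [hemp], fun k => by simp⟩
    · obtain ⟨z, hz⟩ := hne
      set D : ℝ := (Metric.ediam (t n)).toReal with hD
      have hfin : Metric.ediam (t n) ≠ ⊤ := ne_top_of_le_ne_top ENNReal.one_ne_top (hdiam n)
      have hD0 : 0 ≤ D := ENNReal.toReal_nonneg
      have hcont : ContinuousAt (fun x : ℝ => x ^ d) D := (Real.continuous_rpow_const hd.le).continuousAt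
      have hev : ∀ᶠ x in nhdsWithin D (Ioi D), x ^ d < D ^ d + e n :=
        nhdsWithin_le_nhds (hcont.eventually (gt_mem_nhds (by linarith [hepos n])))
      obtain ⟨ρ, hρ1, hρ2⟩ := (hev.and self_mem_nhdsWithin).exists
      refine ⟨Metric.ball z ρ, Metric.isOpen_ball, ?_, ?_⟩
      · intro y hy
        rw [Metric.mem_ball]
        have : edist y z ≤ Metric.ediam (t n) := Metric.edist_le_ediam_of_mem hy hz
        have h2 := ENNReal.toReal_mono hfin this
        rw [edist_dist, ENNReal.toReal_ofReal dist_nonneg] at h2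
        linarith
      · intro k
        refine (ball_measure_le hC hd (hm1 k) (hm k) z ρ (by linarith)).trans ?_
        have hpos : (t n).Nonempty := ⟨z, hz⟩
        rw [ciSup_pos hpos]
        have : Metric.ediam (t n) ^ d = ENNReal.ofReal (D ^ d) := by
          rw [hD, ENNReal.toReal_rpow, ENNReal.ofReal_toReal]
          exact ENNReal.rpow_ne_top_of_nonneg hd.le hfin
        rw [this, ← ENNReal.ofReal_add (by positivity) (hepos n).le, ← ENNReal.ofReal_mul hBpos.le]
        apply ENNReal.ofReal_le_ofReal
        gcongr
  choose V hVo hVt hVm using hrad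
  obtain ⟨k, hk⟩ := exists_subset_nhds_of_isCompact' (V := K) (directed_of_isDirected_le hanti) hK
    (fun n => (hK n).isClosed) (U := ⋃ n, V n) (fun x hx =>
      (isOpen_iUnion hVo).mem_nhds (by
        obtain ⟨n, hn⟩ := mem_iUnion.1 (hcov hx)
        exact mem_iUnion.2 ⟨n, hVt n hn⟩))
  have : (1/2 : ENNReal) ≤ ENNReal.ofReal (B * (ε + ε)) := by
    calc (1/2 : ENNReal) ≤ m k (K k) := hm2 k
      _ ≤ m k (⋃ n, V n) := measure_mono hk
      _ ≤ ∑' n, m k (V n) := measure_iUnion_le _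
      _ ≤ ∑' n, ENNReal.ofReal B * ((⨆ (_ : (t n).Nonempty), Metric.ediam (t n) ^ d) + ENNReal.ofReal (e n)) :=
        ENNReal.tsum_le_tsum (fun n => hVm n k)
      _ = ENNReal.ofReal B * (∑' n, (⨆ (_ : (t n).Nonempty), Metric.ediam (t n) ^ d) + ∑' n, ENNReal.ofReal (e n)) := by
        rw [ENNReal.tsum_mul_left, ENNReal.tsum_add]
      _ ≤ ENNReal.ofReal B * (ENNReal.ofReal ε + ENNReal.ofReal ε) := by
        gcongr
        rw [← ENNReal.ofReal_tsum_of_nonneg (fun n => (hepos n).le) hesum.summable, hesum.tsum_eq]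
        exact ENNReal.ofReal_le_ofReal hele
      _ = _ := by rw [← ENNReal.ofReal_add hεpos.le hεpos.le, ← ENNReal.ofReal_mul hBpos.le]
  have h4 : B * (ε + ε) = 1/4 := by rw [hε]; field_simp; norm_num
  rw [h4] at this
  have h5 := ENNReal.toReal_mono ENNReal.ofReal_ne_top this
  rw [ENNReal.toReal_ofReal (by norm_num)] at h5
  norm_num at h5


structure CSt (μ : Measure ℝ) (C d : ℝ) (m : Measure ℝ) (K : Set ℝ) : Prop where
  le_one : m univ ≤ 1
  dens : ∃ c : ENNReal, c ≠ ⊤ ∧ ∀ s, m s ≤ c * μ s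
  frost : ∀ l i, m (dcell l i) ≤ ENNReal.ofReal (C * ((2:ℝ) ^ (-d)) ^ l)
  cpt : IsCompact K
  supp : m (interior K)ᶜ = 0

structure CData (μ : Measure ℝ) (xs r : ℕ → ℝ) (d : ℝ) (n₀ : ℕ) (η : ℝ) (l : ℕ) (i : ℤ)
    (F K : Set ℝ) : Prop where
  meas : MeasurableSet F
  sub : F ⊆ dcell l i
  pos : μ F ≠ 0
  cpt : IsCompact K
  Ksub : K ⊆ closure (dcell l i)
  null : μ (F \ interior K) = 0
  hit : ∀ z ∈ K, ∃ j ≥ n₀, |xs j - z| < r j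
  frost : ∀ l' i', μ (dcell l i) * μ (F ∩ dcell l' i') ≤
    ENNReal.ofReal (η * ((2:ℝ) ^ (-d)) ^ l') * μ F

lemma closure_dcell_sub (l : ℕ) (y : ℝ) :
    closure (dcell l (dix l y)) ⊆ Metric.closedBall y ((1/2) ^ l) := by
  have hy := mem_dcell_dix l y
  rw [dcell_eq_Ico] at hy ⊢
  apply closure_minimal _ Metric.isClosed_closedBall
  intro z hz
  rw [Metric.mem_closedBall, Real.dist_eq, abs_le]
  have : (((dix l y : ℤ) : ℝ) + 1) / 2 ^ l = ((dix l y : ℤ) : ℝ) / 2 ^ l + (1/2)^l := by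
    rw [add_div, div_pow, one_pow]
  rw [this] at hy hz
  constructor <;> linarith [hy.1, hy.2, hz.1, hz.2]

lemma cantor_step {μ : Measure ℝ} [IsProbabilityMeasure μ] {xs r : ℕ → ℝ} {C d : ℝ} (hC : 1 ≤ C)
    (H : ∀ᵐ y ∂μ, ∀ n₀ : ℕ, ∀ η : ℝ, 0 < η → ∃ l ≥ n₀, ∃ F K, CData μ xs r d n₀ η l (dix l y) F K)
    {m : Measure ℝ} {K : Set ℝ} (hS : CSt μ C d m K) (n₀ : ℕ) {ε : ENNReal} (hε : ε ≠ 0) :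
    ∃ m' K', CSt μ C d m' K' ∧ K' ⊆ K ∧ m univ ≤ m' univ + ε ∧
      ∀ z ∈ K', ∃ j ≥ n₀, |xs j - z| < r j := by
  classical
  obtain ⟨c, hc, hmc⟩ := hS.dens
  have hac : m ≪ μ := by
    intro s hs
    have := hmc s
    rw [hs, mul_zero] at this
    exact le_antisymm this bot_le
  set η : ℝ := 1 / (c.toReal + 1) with hη
  have hcr : 0 ≤ c.toReal := ENNReal.toReal_nonneg
  have hηpos : 0 < η := by positivity
  have hcη : ∀ l : ℕ, c * ENNReal.ofReal (η * ((2:ℝ) ^ (-d)) ^ l) ≤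
      ENNReal.ofReal (C * ((2:ℝ) ^ (-d)) ^ l) := by
    intro l
    rw [← ENNReal.ofReal_toReal hc, ← ENNReal.ofReal_mul hcr]
    apply ENNReal.ofReal_le_ofReal
    rw [← mul_assoc]
    gcongr
    have : c.toReal * η ≤ 1 := by
      rw [hη, mul_one_div, div_le_one (by positivity)]; linarith
    linarith
  obtain ⟨D, hDS, hdisj, hcov⟩ := exists_maximal_cells
    {q : ℕ × ℤ | closure (dcell q.1 q.2) ⊆ K ∧ ∃ F K, CData μ xs r d n₀ η q.1 q.2 F K}
  have hfull : m (⋃ q : D, dcell q.1.1 q.1.2)ᶜ = 0 := by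
    have h1 : ∀ᵐ y ∂m, y ∈ interior K := by
      rw [ae_iff]; exact hS.supp
    have h2 : ∀ᵐ y ∂m, y ∈ ⋃ q : D, dcell q.1.1 q.1.2 := by
      filter_upwards [h1, hac.ae_le H] with y hy1 hy2
      obtain ⟨ρ, hρ, hball⟩ := Metric.mem_nhds_iff.1 (mem_interior_iff_mem_nhds.1 hy1)
      obtain ⟨n1, hn1⟩ := exists_pow_lt_of_lt_one hρ (by norm_num : (1/2:ℝ) < 1)
      obtain ⟨l, hl, F, K1, hD⟩ := hy2 (max n₀ n1) η hηpos
      have hD' : CData μ xs r d n₀ η l (dix l y) F K1 :=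
        ⟨hD.meas, hD.sub, hD.pos, hD.cpt, hD.Ksub, hD.null, fun z hz => by
          obtain ⟨j, hj, h⟩ := hD.hit z hz
          exact ⟨j, le_trans (le_max_left _ _) hj, h⟩, hD.frost⟩
      obtain ⟨q, hq, hyq⟩ := hcov l y ⟨by
        refine (closure_dcell_sub l y).trans (subset_trans ?_ hball)
        apply Metric.closedBall_subset_ball
        refine lt_of_le_of_lt ?_ hn1
        exact pow_le_pow_of_le_one (by norm_num) (by norm_num) (le_trans (le_max_right _ _) hl), F, K1, hD'⟩
      exact mem_iUnion.2 ⟨⟨q, hq⟩, hyq⟩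
    rw [ae_iff] at h2
    exact h2
  have hpd : Pairwise (Function.onFun Disjoint fun q : D => dcell q.1.1 q.1.2) := by
    intro q q' hne
    exact hdisj q.1 q.2 q'.1 q'.2 (fun h => hne (Subtype.ext h))
  have hmt : m univ = ∑' q : D, m (dcell q.1.1 q.1.2) := by
    rw [← measure_iUnion hpd (fun q => measurableSet_dcell _ _)]
    have hms : MeasurableSet (⋃ q : D, dcell q.1.1 q.1.2) :=
      MeasurableSet.iUnion (fun q => measurableSet_dcell _ _)
    rw [← measure_add_measure_compl hms, hfull, add_zero]
  have hmfin : m univ ≠ ⊤ := ne_top_of_le_ne_top ENNReal.one_ne_top hS.le_one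
  obtain ⟨s, hs⟩ : ∃ s : Finset D, m univ ≤ ∑ q ∈ s, m (dcell q.1.1 q.1.2) + ε := by
    by_cases h0 : m univ = 0
    · exact ⟨∅, by rw [h0]; exact bot_le⟩
    · have : m univ - ε < ∑' q : D, m (dcell q.1.1 q.1.2) := by
        rw [← hmt]; exact ENNReal.sub_lt_self hmfin h0 hε
      rw [ENNReal.tsum_eq_iSup_sum] at this
      obtain ⟨s, hs⟩ := lt_iSup_iff.1 this
      exact ⟨s, tsub_le_iff_right.1 hs.le⟩
  have hdat : ∀ q : D, ∃ F K, CData μ xs r d n₀ η q.1.1 q.1.2 F K := fun q => (hDS q.2).2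
  choose F K' hdat using hdat
  have hFtop : ∀ q, μ (F q) ≠ ⊤ := fun q => measure_ne_top _ _
  set m' : Measure ℝ := ∑ q ∈ s, (m (dcell q.1.1 q.1.2) / μ (F q)) • μ.restrict (F q) with hm'
  have happ : ∀ A, MeasurableSet A → m' A = ∑ q ∈ s, (m (dcell q.1.1 q.1.2) / μ (F q)) * μ (F q ∩ A) := by
    intro A hA
    rw [hm', Measure.finsetSum_apply]
    apply Finset.sum_congr rfl
    intro q _
    rw [Measure.smul_apply, Measure.restrict_apply hA, smul_eq_mul, inter_comm]
  have huniv : m' univ = ∑ q ∈ s, m (dcell q.1.1 q.1.2) := by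
    rw [happ _ MeasurableSet.univ]
    apply Finset.sum_congr rfl
    intro q _
    rw [inter_univ, ENNReal.div_mul_cancel (hdat q).pos (hFtop q)]
  have hsumle : ∀ s' : Finset D, ∀ A, MeasurableSet A → (∀ q ∈ s', dcell q.1.1 q.1.2 ⊆ A) →
      ∑ q ∈ s', m (dcell q.1.1 q.1.2) ≤ m A := by
    intro s' A hA hsub
    rw [← measure_biUnion_finset (fun q _ q' _ h => hpd h) (fun q _ => measurableSet_dcell _ _)]
    exact measure_mono (iUnion₂_subset hsub)
  refine ⟨m', ⋃ q ∈ s, K' q, ⟨?_, ?_, ?_, ?_, ?_⟩, ?_, ?_, ?_⟩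
  · rw [huniv]
    exact (hsumle s univ MeasurableSet.univ (fun _ _ => subset_univ _)).trans hS.le_one
  · refine ⟨∑ q ∈ s, (m (dcell q.1.1 q.1.2) / μ (F q)), ?_, ?_⟩
    · apply ENNReal.sum_ne_top.2
      intro q _
      exact ENNReal.div_ne_top (ne_top_of_le_ne_top hmfin (measure_mono (subset_univ _))) (hdat q).pos
    · intro A
      rw [hm', Measure.finsetSum_apply, Finset.sum_mul]
      apply Finset.sum_le_sum
      intro q _
      rw [Measure.smul_apply, smul_eq_mul]
      gcongr
      exact Measure.restrict_le_self
  · intro l i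
    rw [happ _ (measurableSet_dcell l i)]
    by_cases hbig : ∃ q ∈ s, dcell l i ⊆ dcell q.1.1 q.1.2
    · obtain ⟨q, hq, hsub⟩ := hbig
      rw [Finset.sum_eq_single_of_mem q hq]
      · refine le_trans ?_ (hcη l)
        rw [ENNReal.div_eq_inv_mul]
        calc (μ (F q))⁻¹ * m (dcell q.1.1 q.1.2) * μ (F q ∩ dcell l i)
            ≤ (μ (F q))⁻¹ * (c * μ (dcell q.1.1 q.1.2)) * μ (F q ∩ dcell l i) := by
              gcongr; exact hmc _
          _ = (μ (F q))⁻¹ * c * (μ (dcell q.1.1 q.1.2) * μ (F q ∩ dcell l i)) := by ring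
          _ ≤ (μ (F q))⁻¹ * c * (ENNReal.ofReal (η * ((2:ℝ) ^ (-d)) ^ l) * μ (F q)) := by
              exact mul_le_mul' le_rfl ((hdat q).frost l i)
          _ = c * ENNReal.ofReal (η * ((2:ℝ) ^ (-d)) ^ l) * ((μ (F q))⁻¹ * μ (F q)) := by ring
          _ = _ := by rw [ENNReal.inv_mul_cancel (hdat q).pos (hFtop q), mul_one]
      · intro q' _ hne
        have : F q' ∩ dcell l i = ∅ := by
          apply Set.disjoint_iff_inter_eq_empty.1
          exact (hpd hne).mono (hdat q').sub hsub
        rw [this]; simp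
    · push Not at hbig
      refine le_trans ?_ (hS.frost l i)
      calc _ ≤ ∑ q ∈ s with dcell q.1.1 q.1.2 ⊆ dcell l i, m (dcell q.1.1 q.1.2) := by
            rw [Finset.sum_filter]
            apply Finset.sum_le_sum
            intro q hq
            split_ifs with h
            · calc _ ≤ m (dcell q.1.1 q.1.2) / μ (F q) * μ (F q) := by
                    gcongr; exact inter_subset_left
                _ = _ := ENNReal.div_mul_cancel (hdat q).pos (hFtop q)
            · have : F q ∩ dcell l i = ∅ := by
                by_contra hne
                obtain ⟨z, hz1, hz2⟩ := nonempty_iff_ne_empty.2 hne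
                have hz1 := (hdat q).sub hz1
                rcases le_total q.1.1 l with hl | hl
                · exact hbig q hq (dcell_nested hl hz1 hz2)
                · exact h (dcell_nested hl hz2 hz1)
              rw [this]; simp
        _ ≤ _ := hsumle _ _ (measurableSet_dcell l i) (fun q hq => (Finset.mem_filter.1 hq).2)
  · exact s.isCompact_biUnion (fun q _ => (hdat q).cpt)
  · rw [happ _ isOpen_interior.measurableSet.compl]
    apply Finset.sum_eq_zero
    intro q hq
    have : μ (F q ∩ (interior (⋃ q ∈ s, K' q))ᶜ) = 0 := by
      apply measure_mono_null _ (hdat q).null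
      rintro z ⟨hz1, hz2⟩
      exact ⟨hz1, fun h => hz2 (interior_mono (subset_biUnion_of_mem (u := fun q => K' q) (Finset.mem_coe.2 hq)) h)⟩
    rw [this, mul_zero]
  · apply iUnion₂_subset
    intro q _
    exact (hdat q).Ksub.trans (hDS q.2).1
  · rw [huniv]; exact hs
  · intro z hz
    obtain ⟨q, hq, hz⟩ := mem_iUnion₂.1 hz
    exact (hdat q).hit z hz

theorem cantor_dim {μ : Measure ℝ} [IsProbabilityMeasure μ] {xs r : ℕ → ℝ} {C d : ℝ} (hC : 1 ≤ C)
    (hd : 0 < d) (hfr : ∀ l i, μ (dcell l i) ≤ ENNReal.ofReal (C * ((2:ℝ) ^ (-d)) ^ l))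
    (hsupp : μ (Ioo (0:ℝ) 1)ᶜ = 0)
    (H : ∀ᵐ y ∂μ, ∀ n₀ : ℕ, ∀ η : ℝ, 0 < η → ∃ l ≥ n₀, ∃ F K, CData μ xs r d n₀ η l (dix l y) F K) :
    ENNReal.ofReal d ≤ dimH {y ∈ Set.Icc (0 : ℝ) 1 | ∃ᶠ n in Filter.atTop, |xs n - y| < r n} := by
  classical
  have h0 : CSt μ C d μ (Icc 0 1) :=
    ⟨prob_le_one, ⟨1, ENNReal.one_ne_top, fun s => by simp⟩, hfr, isCompact_Icc, by
      rw [interior_Icc]; exact hsupp⟩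
  let S := {p : Measure ℝ × Set ℝ // CSt μ C d p.1 p.2}
  have step : ∀ (n : ℕ) (p : S), ∃ p' : S, p'.1.2 ⊆ p.1.2 ∧
      p.1.1 univ ≤ p'.1.1 univ + (2⁻¹ : ENNReal) ^ (n+2) ∧ ∀ z ∈ p'.1.2, ∃ j ≥ n, |xs j - z| < r j := by
    intro n p
    obtain ⟨m', K', h1, h2, h3, h4⟩ := cantor_step hC H p.2 n (ε := (2⁻¹ : ENNReal) ^ (n+2))
      (by simp)
    exact ⟨⟨(m', K'), h1⟩, h2, h3, h4⟩
  choose f hf using step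
  let seq : ℕ → S := fun n => Nat.rec ⟨(μ, Icc 0 1), h0⟩ (fun n p => f n p) n
  have hseq : ∀ n, seq (n+1) = f n (seq n) := fun n => rfl
  have hanti : Antitone (fun n => (seq n).1.2) := by
    apply antitone_nat_of_succ_le
    intro n
    rw [hseq]
    exact (hf n (seq n)).1
  have hmass : ∀ n, 2⁻¹ + (2⁻¹ : ENNReal) ^ (n+1) ≤ (seq n).1.1 univ := by
    intro n
    induction n with
    | zero =>
      have : (seq 0).1.1 = μ := rfl
      rw [this, measure_univ, zero_add, pow_one, ENNReal.inv_two_add_inv_two]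
    | succ n ih =>
      rw [hseq]
      have h := ih.trans (hf n (seq n)).2.1
      have e : (2⁻¹ : ENNReal) ^ (n+1) = (2⁻¹ : ENNReal) ^ (n+2) + (2⁻¹ : ENNReal) ^ (n+2) := by
        rw [pow_succ _ (n+1), ← mul_add, ENNReal.inv_two_add_inv_two, mul_one]
      rw [e, ← add_assoc] at h
      exact (ENNReal.add_le_add_iff_right (by simp)).1 h
  have hdim := dimH_iInter_ge (K := fun n => (seq n).1.2) (m := fun n => (seq n).1.1) hC hd
    (fun n => (seq n).2.cpt) hanti (fun n => (seq n).2.le_one) (fun n => by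
      have h1 : (seq n).1.1 univ ≤ (seq n).1.1 (seq n).1.2 := by
        calc _ ≤ (seq n).1.1 ((seq n).1.2 ∪ (interior (seq n).1.2)ᶜ) := by
              apply measure_mono
              intro z _
              by_cases hz : z ∈ interior (seq n).1.2
              · exact Or.inl (interior_subset hz)
              · exact Or.inr hz
          _ ≤ _ := measure_union_le _ _
          _ = _ := by rw [(seq n).2.supp, add_zero]
      refine le_trans ?_ h1
      refine le_trans ?_ (hmass n)
      rw [one_div]
      exact le_self_add) (fun n => (seq n).2.frost)
  refine hdim.trans (dimH_mono ?_)
  intro y hy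
  rw [mem_iInter] at hy
  refine ⟨hy 0, ?_⟩
  rw [Filter.frequently_atTop]
  intro n
  have := hy (n+1)
  have h2 : y ∈ (f n (seq n)).1.2 := this
  exact (hf n (seq n)).2.2 y h2


noncomputable def mq (μ : Measure ℝ) (l : ℕ) (y : ℝ) : ℝ := (μ (dcell l (dix l y))).toReal

lemma measurable_mq (μ : Measure ℝ) (l : ℕ) : Measurable (mq μ l) := by
  have : mq μ l = (fun i : ℤ => (μ (dcell l i)).toReal) ∘ dix l := rfl
  rw [this]
  exact (measurable_from_top).comp (measurable_dix l)

lemma mq_nonneg (μ : Measure ℝ) (l : ℕ) (y : ℝ) : 0 ≤ mq μ l y := ENNReal.toReal_nonneg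

lemma mq_anti (μ : Measure ℝ) [IsFiniteMeasure μ] {l l' : ℕ} (h : l ≤ l') (y : ℝ) :
    mq μ l' y ≤ mq μ l y :=
  ENNReal.toReal_mono (measure_ne_top _ _) (measure_mono (dcell_anti h y))

lemma mq_congr (μ : Measure ℝ) {l : ℕ} {y z : ℝ} (h : dix l y = dix l z) :
    mq μ l y = mq μ l z := by
  unfold mq; rw [h]

lemma dmax (μ : Measure ℝ) [IsProbabilityMeasure μ] (G : Set ℝ) {δ : ℝ} (hδ : 0 ≤ δ) :
    μ (G ∩ {y | ∃ l, mq (μ.restrict G) l y < δ * mq μ l y}) ≤ ENNReal.ofReal δ := by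
  have h := dyadic_maximal (μ.restrict G) μ (ENNReal.ofReal δ)
  rw [measure_univ, mul_one] at h
  refine le_trans ?_ h
  refine le_trans ?_ (Measure.le_restrict_apply _ _)
  apply measure_mono
  rintro y ⟨hyG, l, hl⟩
  refine ⟨⟨l, ?_⟩, hyG⟩
  unfold mq at hl
  rw [← ENNReal.ofReal_toReal (measure_ne_top (μ.restrict G) (dcell l (dix l y))),
    ← ENNReal.ofReal_toReal (measure_ne_top μ (dcell l (dix l y))), ← ENNReal.ofReal_mul hδ]
  exact (ENNReal.ofReal_lt_ofReal_iff_of_nonneg ENNReal.toReal_nonneg).2 hl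

lemma mq_lower (μ : Measure ℝ) [IsProbabilityMeasure μ] (hsupp : μ (Ioo (0:ℝ) 1)ᶜ = 0) :
    ∀ᵐ y ∂μ, ∃ δ : ℝ, 0 < δ ∧ ∀ l : ℕ, δ * (1/2) ^ l ≤ mq μ l y := by
  have hb : ∀ m : ℕ, μ {y | ¬ ∃ δ : ℝ, 0 < δ ∧ ∀ l : ℕ, δ * (1/2) ^ l ≤ mq μ l y} ≤
      ENNReal.ofReal (1 / ((m:ℝ) + 1)) := by
    intro m
    have h := dyadic_maximal μ (volume.restrict (Icc (0:ℝ) 1)) (ENNReal.ofReal (1 / ((m:ℝ) + 1)))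
    rw [Measure.restrict_apply_univ, Real.volume_Icc, sub_zero, ENNReal.ofReal_one, mul_one] at h
    refine le_trans ?_ h
    have hs : {y | ¬ ∃ δ : ℝ, 0 < δ ∧ ∀ l : ℕ, δ * (1/2) ^ l ≤ mq μ l y} ⊆
      {y | ∃ l, μ (dcell l (dix l y)) < ENNReal.ofReal (1 / ((m:ℝ) + 1)) *
        (volume.restrict (Icc (0:ℝ) 1)) (dcell l (dix l y))} ∪ (Ioo (0:ℝ) 1)ᶜ := by
      intro y hy
      by_cases h01 : y ∈ Ioo (0:ℝ) 1
      · left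
        rw [mem_ofPred_eq] at hy
        push Not at hy
        obtain ⟨l, hl⟩ := hy (1 / ((m:ℝ) + 1)) (by positivity)
        refine ⟨l, ?_⟩
        have hsub : dcell l (dix l y) ⊆ Icc (0:ℝ) 1 := by
          have h0 : dix 0 y = 0 := by
            unfold dix
            rw [Int.floor_eq_iff]
            simp; exact ⟨h01.1.le, h01.2⟩
          have := dcell_anti (Nat.zero_le l) y
          rw [h0, dcell_eq_Ico 0] at this
          refine this.trans ?_
          simp
          exact Ico_subset_Icc_self
        rw [Measure.restrict_eq_self _ hsub, dcell_eq_Ico l, Real.volume_Ico, ← dcell_eq_Ico,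
          ← ENNReal.ofReal_mul (by positivity),
          ← ENNReal.ofReal_toReal (measure_ne_top μ (dcell l (dix l y)))]
        apply (ENNReal.ofReal_lt_ofReal_iff_of_nonneg ENNReal.toReal_nonneg).2
        have : (((dix l y : ℤ) : ℝ) + 1) / 2 ^ l - ((dix l y : ℤ) : ℝ) / 2 ^ l = (1/2)^l := by
          rw [add_div, div_pow, one_pow]; ring
        rw [this]
        exact hl
      · right; exact h01
    calc _ ≤ _ := measure_mono hs
      _ ≤ _ := measure_union_le _ _
      _ = _ := by rw [hsupp, add_zero]
  have ht : Tendsto (fun m : ℕ => ENNReal.ofReal (1 / ((m:ℝ) + 1))) atTop (nhds 0) := by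
    have := ENNReal.tendsto_ofReal (tendsto_one_div_add_atTop_nhds_zero_nat (𝕜 := ℝ))
    simpa using this
  exact le_antisymm (ge_of_tendsto' ht hb) bot_le

lemma pw_eq (x : ℝ) (l : ℕ) : ((2:ℝ) ^ x) ^ l = (2:ℝ) ^ (x * l) := by
  rw [Real.rpow_mul (by norm_num), Real.rpow_natCast]

lemma pw_pos (x : ℝ) : 0 < (2:ℝ) ^ x := Real.rpow_pos_of_pos (by norm_num) x

lemma pw_mul (x y : ℝ) : (2:ℝ) ^ x * (2:ℝ) ^ y = (2:ℝ) ^ (x + y) :=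
  (Real.rpow_add (by norm_num) x y).symm

lemma pw_le {x y : ℝ} (h : x ≤ y) : (2:ℝ) ^ x ≤ (2:ℝ) ^ y :=
  Real.rpow_le_rpow_of_exponent_le (by norm_num) h

lemma half_pow (l : ℕ) : (1/2 : ℝ) ^ l = (2:ℝ) ^ (-(l:ℝ)) := by
  rw [Real.rpow_neg (by norm_num), Real.rpow_natCast, div_pow, one_pow, one_div]

lemma pw_tendsto {a : ℝ} (ha : 0 < a) (C : ℝ) :
    Tendsto (fun N : ℕ => C * (2:ℝ) ^ (-(a * N))) atTop (nhds 0) := by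
  have h : Tendsto (fun N : ℕ => ((2:ℝ) ^ (-a)) ^ N) atTop (nhds 0) := by
    apply tendsto_pow_atTop_nhds_zero_of_lt_one (pw_pos _).le
    exact Real.rpow_lt_one_of_one_lt_of_neg (by norm_num) (by linarith)
  have := h.const_mul C
  simp only [mul_zero, pw_eq] at this
  convert this using 3
  ring_nf

def Gset (μ : Measure ℝ) (d : ℝ) (N k : ℕ) : Set ℝ :=
  {y | 0 < mq μ k y ∧ ∀ l ≥ k, mq μ l y * (2:ℝ) ^ (d * l) ≤ (2:ℝ) ^ (d * (k + N)) * mq μ k y}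

def Hset (μ : Measure ℝ) (d δ : ℝ) (N k : ℕ) : Set ℝ :=
  {z | z ∈ Gset μ d N k ∧ δ * mq μ k z ≤ mq (μ.restrict (Gset μ d N k)) k z}

lemma measurableSet_Gset (μ : Measure ℝ) (d : ℝ) (N k : ℕ) : MeasurableSet (Gset μ d N k) := by
  unfold Gset
  have hm := measurable_mq μ
  apply MeasurableSet.inter
  · exact measurableSet_lt measurable_const (hm k)
  · have : {y | ∀ l ≥ k, mq μ l y * (2:ℝ) ^ (d * l) ≤ (2:ℝ) ^ (d * (k + N)) * mq μ k y} =
      ⋂ l : ℕ, ⋂ (_ : l ≥ k), {y | mq μ l y * (2:ℝ) ^ (d * l) ≤ (2:ℝ) ^ (d * (k + N)) * mq μ k y} := by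
      ext y; simp
    change MeasurableSet {y | ∀ l ≥ k, mq μ l y * (2:ℝ) ^ (d * l) ≤ (2:ℝ) ^ (d * (k + N)) * mq μ k y}
    rw [this]
    refine MeasurableSet.iInter fun l => MeasurableSet.iInter fun _ => ?_
    exact measurableSet_le ((hm l).mul_const _) ((hm k).const_mul _)

lemma measurableSet_Hset (μ : Measure ℝ) (d δ : ℝ) (N k : ℕ) : MeasurableSet (Hset μ d δ N k) := by
  apply (measurableSet_Gset μ d N k).inter
  exact measurableSet_le ((measurable_mq _ _).const_mul _) (measurable_mq _ _)

lemma good_scale {μ : Measure ℝ} [IsProbabilityMeasure μ] {C d τ : ℝ} (hC : 0 < C) (hd : 0 < d)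
    (hfr : ∀ l y, mq μ l y ≤ C * (2:ℝ) ^ (-(τ * l))) {q M : ℕ} (hdτ : d < τ)
    (hM : (q : ℝ) + 1 ≤ (τ - d) * (q + M)) {y : ℝ}
    {δ : ℝ} (hδ : 0 < δ) (hlow : ∀ l : ℕ, δ * (1/2) ^ l ≤ mq μ l y) :
    ∀ᶠ N : ℕ in atTop, ∃ i ≤ M, y ∈ Gset μ d N (N * (q + i)) := by
  have hev : ∀ᶠ N : ℕ in atTop, C * (2:ℝ) ^ (-((1:ℝ) * N)) < δ :=
    (pw_tendsto one_pos C).eventually (gt_mem_nhds hδ)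
  filter_upwards [hev, eventually_gt_atTop 0] with N hN hN0
  set a : ℕ → ℝ := fun l => mq μ l y * (2:ℝ) ^ (d * l) with ha
  have hne : (Finset.Icc (N * q) (N * (q + M))).Nonempty := by
    rw [Finset.nonempty_Icc]; gcongr; omega
  obtain ⟨ls, hls, hmax⟩ := Finset.exists_max_image _ a hne
  rw [Finset.mem_Icc] at hls
  have haq : δ * (2:ℝ) ^ (-((N * q : ℕ):ℝ)) ≤ a (N * q) := by
    have h1 := hlow (N * q)
    rw [half_pow] at h1
    refine h1.trans ?_
    rw [ha]
    apply le_mul_of_one_le_right (mq_nonneg _ _ _)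
    exact Real.one_le_rpow (by norm_num) (by positivity)
  have hmaxall : ∀ l ≥ N * q, a l ≤ a ls := by
    intro l hl
    by_cases hl2 : l ≤ N * (q + M)
    · exact hmax l (Finset.mem_Icc.2 ⟨hl, hl2⟩)
    · push Not at hl2
      have h0 := hmax (N * q) (Finset.mem_Icc.2 ⟨le_rfl, by gcongr; omega⟩)
      refine le_trans ?_ (haq.trans h0)
      have hl3 : (N:ℝ) * (q + M) ≤ l := by exact_mod_cast hl2.le
      have hN0' : (0:ℝ) < N := by exact_mod_cast hN0
      calc a l ≤ C * (2:ℝ) ^ (-(τ * l)) * (2:ℝ) ^ (d * l) := by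
            exact mul_le_mul_of_nonneg_right (hfr l y) (pw_pos _).le
        _ = C * (2:ℝ) ^ (-((τ - d) * l)) := by rw [mul_assoc, pw_mul]; ring_nf
        _ ≤ C * (2:ℝ) ^ (-((1:ℝ) * N) + (-((N * q : ℕ):ℝ))) := by
            gcongr
            · norm_num
            · push_cast
              have h1 : (τ - d) * (N * (q + M)) ≤ (τ - d) * l :=
                mul_le_mul_of_nonneg_left hl3 (by linarith)
              have h2 : N * ((q : ℝ) + 1) ≤ N * ((τ - d) * (q + M)) :=
                mul_le_mul_of_nonneg_left hM hN0'.le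
              linarith
        _ = C * (2:ℝ) ^ (-((1:ℝ) * N)) * (2:ℝ) ^ (-((N * q : ℕ):ℝ)) := by rw [← pw_mul, mul_assoc]
        _ ≤ _ := by gcongr
  have hd1 : q ≤ ls / N := by
    rw [Nat.le_div_iff_mul_le hN0]; linarith [mul_comm N q]
  have hd2 : ls / N ≤ q + M := by
    have h2 := Nat.div_le_div_right (c := N) hls.2
    rwa [Nat.mul_div_cancel_left _ hN0] at h2
  have hk : N * (q + (ls / N - q)) = N * (ls / N) := by congr 1; omega
  refine ⟨ls / N - q, by omega, ?_⟩
  rw [hk]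
  have hk1 : N * (ls / N) ≤ ls := Nat.mul_div_le _ _
  have hk2 : ls < N * (ls / N) + N := Nat.lt_mul_div_succ ls hN0
  have hk3 : N * q ≤ N * (ls / N) := by gcongr
  refine ⟨lt_of_lt_of_le (by positivity) (hlow _), ?_⟩
  intro l hl
  refine (hmaxall l (hk3.trans hl)).trans ?_
  rw [mul_comm ((2:ℝ) ^ _)]
  have hk2' : (ls : ℝ) ≤ ((N * (ls / N) : ℕ) : ℝ) + N := by exact_mod_cast hk2.le
  have := mq_anti μ hk1 y
  have h0 := mq_nonneg μ ls y
  refine mul_le_mul this ?_ (pw_pos _).le (mq_nonneg _ _ _)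
  apply pw_le
  gcongr

lemma nice_scale {μ : Measure ℝ} [IsProbabilityMeasure μ] (hsupp : μ (Ioo (0:ℝ) 1)ᶜ = 0)
    {C b t τ : ℝ} (hb : 0 < b)
    (hfr : ∀ l y, mq μ l y ≤ C * (2:ℝ) ^ (-(τ * l))) (hbt : b < t) (hbτ : b < τ) :
    ∀ᵐ y ∂μ, ∀ᶠ k : ℕ in atTop, ∃ l ≤ k, (2:ℝ) ^ (-(t * k)) ≤ mq μ l y ∧
      mq μ l y ≤ (2:ℝ) ^ (-(b * k)) := by
  set B : ℕ → Set ℝ := fun k => ⋃ l ∈ Finset.range k,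
    {y | μ (dcell (l+1) (dix (l+1) y)) < ENNReal.ofReal ((2:ℝ) ^ (-((t-b) * k))) *
      μ (dcell l (dix l y))} with hB
  have hBm : ∀ k, μ (B k) ≤ ENNReal.ofReal (2 * ((k:ℝ) ^ 1 * ((2:ℝ) ^ (-(t-b))) ^ k)) := by
    intro k
    calc μ (B k) ≤ ∑ l ∈ Finset.range k, _ := measure_biUnion_finset_le _ _
      _ ≤ ∑ l ∈ Finset.range k, 2 * (ENNReal.ofReal ((2:ℝ) ^ (-((t-b) * k))) * μ univ) :=
        Finset.sum_le_sum fun l _ => child_small μ l _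
      _ = _ := by
        rw [Finset.sum_const, Finset.card_range, measure_univ, mul_one, pw_eq, nsmul_eq_mul,
          ENNReal.ofReal_mul (by norm_num), ENNReal.ofReal_mul (by positivity)]
        simp
        ring_nf
  have hsum : Summable (fun k : ℕ => 2 * ((k:ℝ) ^ 1 * ((2:ℝ) ^ (-(t-b))) ^ k)) := by
    apply Summable.mul_left
    apply summable_pow_mul_geometric_of_norm_lt_one
    rw [Real.norm_of_nonneg (pw_pos _).le]
    exact Real.rpow_lt_one_of_one_lt_of_neg (by norm_num) (by linarith)
  have hfin : ∑' k, μ (B k) ≠ ⊤ := by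
    refine ne_top_of_le_ne_top ?_ (ENNReal.tsum_le_tsum hBm)
    rw [← ENNReal.ofReal_tsum_of_nonneg (fun k => by positivity) hsum]
    exact ENNReal.ofReal_ne_top
  have hbc := ae_eventually_notMem hfin
  filter_upwards [hbc, mq_lower μ hsupp] with y hy ⟨δ, hδ, hlow⟩
  have h1 : ∀ᶠ k : ℕ in atTop, (1:ℝ) * (2:ℝ) ^ (-(b * k)) < δ :=
    (pw_tendsto hb 1).eventually (gt_mem_nhds hδ)
  have h2 : ∀ᶠ k : ℕ in atTop, C * (2:ℝ) ^ (-((τ - b) * k)) < 1 :=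
    (pw_tendsto (by linarith) C).eventually (gt_mem_nhds one_pos)
  filter_upwards [hy, h1, h2] with k hyk h1 h2
  have hex : ∃ l, mq μ l y ≤ (2:ℝ) ^ (-(b * k)) := by
    refine ⟨k, (hfr k y).trans ?_⟩
    have : (2:ℝ) ^ (-(τ * k)) = (2:ℝ) ^ (-((τ - b) * k)) * (2:ℝ) ^ (-(b * k)) := by
      rw [pw_mul]; ring_nf
    rw [this, ← mul_assoc]
    exact mul_le_of_le_one_left (pw_pos _).le h2.le
  have hlek : Nat.find hex ≤ k := by
    apply Nat.find_min'
    refine (hfr k y).trans ?_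
    have : (2:ℝ) ^ (-(τ * k)) = (2:ℝ) ^ (-((τ - b) * k)) * (2:ℝ) ^ (-(b * k)) := by
      rw [pw_mul]; ring_nf
    rw [this, ← mul_assoc]
    exact mul_le_of_le_one_left (pw_pos _).le h2.le
  refine ⟨Nat.find hex, hlek, ?_, Nat.find_spec hex⟩
  rcases hl : Nat.find hex with _ | l'
  · exfalso
    have h3 := Nat.find_spec hex
    rw [hl] at h3
    have h4 := hlow 0
    simp only [pow_zero, mul_one] at h4
    linarith
  · have h3 := Nat.find_min hex (m := l') (by omega)
    push Not at h3
    have h4 : y ∉ {y | μ (dcell (l'+1) (dix (l'+1) y)) < ENNReal.ofReal ((2:ℝ) ^ (-((t-b) * k))) *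
      μ (dcell l' (dix l' y))} := by
      intro hcon
      apply hyk
      rw [hB]
      simp only [mem_iUnion]
      exact ⟨l', Finset.mem_range.2 (by omega), hcon⟩
    rw [mem_ofPred_eq, not_lt] at h4
    have h5 := ENNReal.toReal_mono (measure_ne_top _ _) h4
    rw [ENNReal.toReal_mul, ENNReal.toReal_ofReal (pw_pos _).le] at h5
    calc (2:ℝ) ^ (-(t * k)) = (2:ℝ) ^ (-((t-b) * k)) * (2:ℝ) ^ (-(b * k)) := by
          rw [pw_mul]; ring_nf
      _ ≤ (2:ℝ) ^ (-((t-b) * k)) * mq μ l' y := by gcongr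
      _ ≤ _ := h5

def Evt (μ : Measure ℝ) (d b t δ : ℝ) (N k l : ℕ) (y : ℝ) : Prop :=
  (2:ℝ) ^ (-(t * k)) ≤ mq μ l y ∧ mq μ l y ≤ (2:ℝ) ^ (-(b * k)) ∧
    δ * mq μ l y ≤ mq (μ.restrict (Hset μ d δ N k)) l y

lemma spatial {μ : Measure ℝ} [IsProbabilityMeasure μ] (hsupp : μ (Ioo (0:ℝ) 1)ᶜ = 0)
    {C d b t τ : ℝ} (hC : 0 < C) (hd : 0 < d) (hdb : d < b) (hbt : b < t) (htτ : t < τ)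
    (hfr : ∀ l y, mq μ l y ≤ C * (2:ℝ) ^ (-(τ * l))) {q M : ℕ} (hq : 0 < q)
    (hM : (q : ℝ) + 1 ≤ (τ - d) * (q + M)) :
    ∀ᵐ y ∂μ, ∃ m : ℕ, ∃ᶠ N : ℕ in atTop, ∃ i ≤ M, ∃ l ≤ N * (q + i),
      Evt μ d b t (1 / ((m:ℝ) + 1)) N (N * (q + i)) l y := by
  classical
  set Bad : ℝ → ℕ → Set ℝ := fun δ N => ⋃ i ∈ Finset.range (M+1),
    ((Gset μ d N (N * (q+i)) ∩ {y | ∃ l, mq (μ.restrict (Gset μ d N (N * (q+i)))) l y < δ * mq μ l y}) ∪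
     (Hset μ d δ N (N * (q+i)) ∩ {y | ∃ l, mq (μ.restrict (Hset μ d δ N (N * (q+i)))) l y < δ * mq μ l y}))
    with hBad
  have hBadm : ∀ δ ≥ 0, ∀ N, μ (Bad δ N) ≤ ENNReal.ofReal ((2 * (M + 1)) * δ) := by
    intro δ hδ N
    calc μ (Bad δ N) ≤ ∑ i ∈ Finset.range (M+1), _ := measure_biUnion_finset_le _ _
      _ ≤ ∑ i ∈ Finset.range (M+1), (ENNReal.ofReal δ + ENNReal.ofReal δ) := by
        apply Finset.sum_le_sum
        intro i _
        exact (measure_union_le _ _).trans (add_le_add (dmax μ _ hδ) (dmax μ _ hδ))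
      _ = _ := by
        rw [Finset.sum_const, Finset.card_range, nsmul_eq_mul, ← ENNReal.ofReal_add hδ hδ,
          ← ENNReal.ofReal_natCast, ← ENNReal.ofReal_mul (by positivity)]
        congr 1; push_cast; ring
  have hgood : ∀ᵐ y ∂μ, ∀ δ : ℝ, ∀ᶠ N : ℕ in atTop, (∃ i ≤ M, ∃ l ≤ N * (q + i),
      Evt μ d b t δ N (N * (q + i)) l y) ∨ y ∈ Bad δ N := by
    filter_upwards [mq_lower μ hsupp, nice_scale hsupp (hd.trans hdb) hfr hbt (hbt.trans htτ)]
      with y ⟨δ₀, hδ₀, hlow⟩ hnice δ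
    obtain ⟨k₀, hk₀⟩ := eventually_atTop.1 hnice
    filter_upwards [good_scale hC hd hfr (by linarith) hM hδ₀ hlow, eventually_ge_atTop k₀]
      with N ⟨i, hi, hG⟩ hN
    by_cases hbad : y ∈ Bad δ N
    · right; exact hbad
    · left
      have hnb : ∀ x, x = y → x ∉ ((Gset μ d N (N * (q+i)) ∩ {y | ∃ l, mq (μ.restrict (Gset μ d N (N * (q+i)))) l y < δ * mq μ l y}) ∪
     (Hset μ d δ N (N * (q+i)) ∩ {y | ∃ l, mq (μ.restrict (Hset μ d δ N (N * (q+i)))) l y < δ * mq μ l y})) := by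
        rintro x rfl hx
        apply hbad
        rw [hBad]
        simp only [mem_iUnion]
        exact ⟨i, Finset.mem_range.2 (by omega), hx⟩
      have hnb := hnb y rfl
      rw [mem_union, not_or] at hnb
      have hH : y ∈ Hset μ d δ N (N * (q+i)) := by
        refine ⟨hG, ?_⟩
        by_contra hc
        exact hnb.1 ⟨hG, _, not_le.1 hc⟩
      obtain ⟨l, hl, h1, h2⟩ := hk₀ (N * (q+i)) (hN.trans (Nat.le_mul_of_pos_right _ (by omega)))
      refine ⟨i, hi, l, hl, h1, h2, ?_⟩
      by_contra hc
      exact hnb.2 ⟨hH, _, not_le.1 hc⟩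
  set Bset := {y | ¬ ∃ m : ℕ, ∃ᶠ N : ℕ in atTop, ∃ i ≤ M, ∃ l ≤ N * (q + i),
      Evt μ d b t (1 / ((m:ℝ) + 1)) N (N * (q + i)) l y} with hBset
  have hb : ∀ m : ℕ, μ Bset ≤ ENNReal.ofReal ((2 * (M + 1)) * (1 / ((m:ℝ) + 1))) := by
    intro m
    set Gd := {y | ∀ δ : ℝ, ∀ᶠ N : ℕ in atTop, (∃ i ≤ M, ∃ l ≤ N * (q + i),
      Evt μ d b t δ N (N * (q + i)) l y) ∨ y ∈ Bad δ N} with hGd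
    have hsub : Bset ⊆ Gdᶜ ∪ ⋃ n : ℕ, ⋂ N ≥ n, Bad (1 / ((m:ℝ) + 1)) N := by
      intro y hy
      by_cases hyG : y ∈ Gd
      · right
        rw [hBset, mem_ofPred_eq] at hy
        push Not at hy
        obtain ⟨n, hn⟩ := eventually_atTop.1 ((hyG (1 / ((m:ℝ) + 1))).and (hy m))
        refine mem_iUnion.2 ⟨n, ?_⟩
        simp only [mem_iInter]
        intro N hN
        obtain ⟨h1 | h1, h2⟩ := hn N hN
        · obtain ⟨i, hi, l, hl, h⟩ := h1
          exact absurd h (h2 i hi l hl)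
        · exact h1
      · left; exact hyG
    calc μ Bset ≤ _ := measure_mono hsub
      _ ≤ _ := measure_union_le _ _
      _ = μ (⋃ n : ℕ, ⋂ N ≥ n, Bad (1 / ((m:ℝ) + 1)) N) := by
        have : μ Gdᶜ = 0 := hgood
        rw [this, zero_add]
      _ = ⨆ n : ℕ, μ (⋂ N ≥ n, Bad (1 / ((m:ℝ) + 1)) N) := by
        apply Monotone.measure_iUnion
        intro n n' h
        exact biInter_subset_biInter_left (fun N hN => le_trans h hN)
      _ ≤ _ := by
        apply iSup_le
        intro n
        exact (measure_mono (biInter_subset_of_mem (le_refl n))).trans (hBadm _ (by positivity) n)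
  have ht : Tendsto (fun m : ℕ => ENNReal.ofReal ((2 * (M + 1)) * (1 / ((m:ℝ) + 1)))) atTop (nhds 0) := by
    have := ENNReal.tendsto_ofReal
      ((tendsto_one_div_add_atTop_nhds_zero_nat (𝕜 := ℝ)).const_mul (2 * ((M:ℝ) + 1)))
    rw [mul_zero, ENNReal.ofReal_zero] at this
    exact this
  exact le_antisymm (ge_of_tendsto' ht hb) bot_le


lemma var_sub_le (f g : ℝ → ℝ) (s : Set ℝ) :
    eVariationOn (fun x => f x - g x) s ≤ eVariationOn f s + eVariationOn g s := by
  apply iSup_le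
  rintro ⟨n, u, hu, hus⟩
  calc _ ≤ ∑ i ∈ Finset.range n, (edist (f (u (i+1))) (f (u i)) + edist (g (u (i+1))) (g (u i))) := by
        apply Finset.sum_le_sum
        intro i _
        change edist (f (u (i+1)) - g (u (i+1))) (f (u i) - g (u i)) ≤ _
        rw [edist_dist, edist_dist, edist_dist, ← ENNReal.ofReal_add dist_nonneg dist_nonneg]
        apply ENNReal.ofReal_le_ofReal
        exact dist_sub_sub_le _ _ _ _
    _ = _ := Finset.sum_add_distrib
    _ ≤ _ := add_le_add (eVariationOn.sum_le hu hus) (eVariationOn.sum_le hu hus)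

lemma var_Ici (u : ℝ) : eVariationOn ((Ici u).indicator (1 : ℝ → ℝ)) (Icc 0 1) ≤ 1 := by
  classical
  have hm : MonotoneOn ((Ici u).indicator (1 : ℝ → ℝ)) (Icc 0 1) := by
    intro x _ y _ hxy
    by_cases hx : u ≤ x
    · have hy : u ≤ y := hx.trans hxy
      simp [indicator, hx, hy]
    · simp only [indicator, mem_Ici, hx, if_false]
      split_ifs <;> simp
  have h := hm.eVariationOn_eq (a := 0) (b := 1) (by simp) (by simp)
  rw [inter_self] at h
  rw [h, ← ENNReal.ofReal_one]
  apply ENNReal.ofReal_le_ofReal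
  simp only [indicator]
  split_ifs <;> simp

lemma var_Ico {u v : ℝ} (huv : u ≤ v) :
    eVariationOn ((Ico u v).indicator (1 : ℝ → ℝ)) (Icc 0 1) ≤ 2 := by
  classical
  have : (Ico u v).indicator (1 : ℝ → ℝ) =
      fun x => (Ici u).indicator (1 : ℝ → ℝ) x - (Ici v).indicator (1 : ℝ → ℝ) x := by
    funext x
    simp only [indicator, mem_Ico, mem_Ici, Pi.one_apply]
    by_cases h1 : u ≤ x
    · by_cases h2 : v ≤ x
      · simp [h1, h2, not_lt.2 h2]
      · simp [h1, h2, not_le.1 h2]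
    · have : ¬ v ≤ x := fun h => h1 (huv.trans h)
      simp [h1, this]
  rw [this]
  refine (var_sub_le _ _ _).trans ?_
  calc _ ≤ (1:ENNReal) + 1 := add_le_add (var_Ici u) (var_Ici v)
    _ = 2 := by norm_num

lemma corr_of_decay {T : ℝ → ℝ} (hTmeas : Measurable T) {μ : Measure ℝ} [IsProbabilityMeasure μ]
    {p : ℕ → ℝ} (hppos : ∀ n, 0 < p n)
    (hdecay : ∀ f g : ℝ → ℝ, Integrable f μ → BoundedVariationOn g (Set.Icc (0:ℝ) 1) →
      ∀ n : ℕ,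
        |(∫ x, f (T^[n] x) * g x ∂μ) - (∫ x, f x ∂μ) * (∫ x, g x ∂μ)| ≤
          (∫ x, |f x| ∂μ) *
            ((∫ x, |g x| ∂μ) + (eVariationOn g (Set.Icc (0:ℝ) 1)).toReal) * p n)
    (A : Set ℝ) (hA : MeasurableSet A) (u v : ℝ) (huv : u ≤ v) (n : ℕ) :
    |μ.real (T^[n] ⁻¹' A ∩ Ico u v) - μ.real A * μ.real (Ico u v)| ≤ 3 * μ.real A * p n := by
  classical
  have hv := var_Ico huv
  have h := hdecay (A.indicator 1) ((Ico u v).indicator 1)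
    ((integrable_const (1:ℝ)).indicator hA) (ne_top_of_le_ne_top (by simp) hv) n
  have e1 : (fun x => A.indicator (1 : ℝ → ℝ) (T^[n] x) * (Ico u v).indicator (1 : ℝ → ℝ) x) =
      (T^[n] ⁻¹' A ∩ Ico u v).indicator 1 := by
    funext x
    by_cases h1 : T^[n] x ∈ A <;> by_cases h2 : x ∈ Ico u v <;> simp [indicator, h1, h2]
  have e2 : ∀ (B : Set ℝ), (fun x => |B.indicator (1 : ℝ → ℝ) x|) = B.indicator 1 := by
    intro B; funext x; by_cases h1 : x ∈ B <;> simp [indicator, h1]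
  rw [e1, e2, e2, integral_indicator_one hA, integral_indicator_one measurableSet_Ico,
    integral_indicator_one ((hTmeas.iterate n hA).inter measurableSet_Ico)] at h
  refine h.trans ?_
  have h2 : (eVariationOn ((Ico u v).indicator (1 : ℝ → ℝ)) (Icc 0 1)).toReal ≤ 2 := by
    have := ENNReal.toReal_mono (by simp) hv
    simpa using this
  have h3 : μ.real (Ico u v) ≤ 1 := measureReal_le_one
  have h4 : 0 ≤ μ.real A := measureReal_nonneg
  have := (hppos n).le
  rw [mul_comm 3]
  gcongr
  linarith

lemma ergodic_of_corr {T : ℝ → ℝ} {μ : Measure ℝ} [IsProbabilityMeasure μ]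
    (hT : MeasurePreserving T μ μ) {p : ℕ → ℝ} (hpsum : Summable p)
    (hcorr : ∀ A, MeasurableSet A → ∀ u v : ℝ, u ≤ v → ∀ n : ℕ,
      |μ.real (T^[n] ⁻¹' A ∩ Ico u v) - μ.real A * μ.real (Ico u v)| ≤ 3 * μ.real A * p n) :
    Ergodic T μ := by
  refine ⟨hT, ⟨?_⟩⟩
  intro A hA hinv
  have hit : ∀ n, T^[n] ⁻¹' A = A := by
    intro n
    induction n with
    | zero => rfl
    | succ n ih => rw [Function.iterate_succ, preimage_comp, ih, hinv]
  have key : ∀ u v : ℝ, u ≤ v → μ.real (A ∩ Ico u v) = μ.real A * μ.real (Ico u v) := by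
    intro u v huv
    have h1 : ∀ n, |μ.real (A ∩ Ico u v) - μ.real A * μ.real (Ico u v)| ≤ 3 * μ.real A * p n := by
      intro n
      have := hcorr A hA u v huv n
      rwa [hit] at this
    have h2 : Tendsto (fun n => 3 * μ.real A * p n) atTop (nhds 0) := by
      have := hpsum.tendsto_atTop_zero.const_mul (3 * μ.real A)
      rwa [mul_zero] at this
    have h3 := ge_of_tendsto' h2 h1
    have := abs_nonpos_iff.1 h3
    linarith
  have hext : μ.restrict A = (μ A) • μ := by
    apply Measure.ext_of_Ico
    intro u v huv
    rw [Measure.restrict_apply measurableSet_Ico, Measure.smul_apply, smul_eq_mul, inter_comm]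
    have := key u v huv.le
    rw [← ENNReal.toReal_eq_toReal_iff' (by finiteness) (by finiteness), ENNReal.toReal_mul]
    exact this
  have hAA := congrArg (fun m : Measure ℝ => m A) hext
  simp only [Measure.restrict_apply_self, Measure.smul_apply, smul_eq_mul] at hAA
  rw [eventuallyConst_set']
  by_cases h0 : μ A = 0
  · left; exact ae_eq_empty.2 h0
  · right
    rw [ae_eq_univ]
    have h1 : μ A = 1 := by
      have h5 : μ A * 1 = μ A * μ A := by rw [mul_one]; exact hAA
      exact ((ENNReal.mul_right_inj h0 (measure_ne_top _ _)).1 h5).symm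
    rw [prob_compl_eq_zero_iff hA]
    exact h1

lemma corr_sym {T : ℝ → ℝ} {μ : Measure ℝ} [IsProbabilityMeasure μ]
    (hT : MeasurePreserving T μ μ) {p : ℕ → ℝ}
    (hcorr : ∀ A, MeasurableSet A → ∀ u v : ℝ, u ≤ v → ∀ n : ℕ,
      |μ.real (T^[n] ⁻¹' A ∩ Ico u v) - μ.real A * μ.real (Ico u v)| ≤ 3 * μ.real A * p n)
    {u v : ℝ} (huv : u ≤ v) {i j : ℕ} (hij : i ≤ j) :
    μ.real (T^[i] ⁻¹' (Ico u v) ∩ T^[j] ⁻¹' (Ico u v)) ≤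
      μ.real (Ico u v) ^ 2 + 3 * μ.real (Ico u v) * p (j - i) := by
  obtain ⟨k, rfl⟩ := Nat.exists_eq_add_of_le hij
  have e : T^[i] ⁻¹' (Ico u v) ∩ T^[i + k] ⁻¹' (Ico u v) =
      T^[i] ⁻¹' (T^[k] ⁻¹' (Ico u v) ∩ Ico u v) := by
    rw [preimage_inter, inter_comm, ← preimage_comp, ← Function.iterate_add, add_comm]
  rw [e, (hT.iterate i).measureReal_preimage
    (((hT.measurable.iterate k) measurableSet_Ico).inter measurableSet_Ico).nullMeasurableSet]
  have := hcorr (Ico u v) measurableSet_Ico u v huv k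
  rw [abs_le] at this
  simp only [Nat.add_sub_cancel_left]
  linarith [this.2]

lemma sum_dist_le {p : ℕ → ℝ} (hppos : ∀ n, 0 < p n) (hpsum : Summable p) (n i : ℕ) :
    ∑ j ∈ Finset.range n, (if i ≤ j then p (j - i) else p (i - j)) ≤ 2 * ∑' k, p k := by
  classical
  rw [Finset.sum_ite, two_mul]
  apply add_le_add
  · rw [← Finset.sum_image (s := (Finset.range n).filter (fun j => i ≤ j)) (f := p)
      (g := fun j => j - i)]
    · exact hpsum.sum_le_tsum _ (fun k _ => (hppos k).le)
    · intro a ha b hb hab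
      simp only [Finset.coe_filter, mem_ofPred_eq] at ha hb hab
      omega
  · rw [← Finset.sum_image (s := (Finset.range n).filter (fun j => ¬ i ≤ j)) (f := p)
      (g := fun j => i - j)]
    · exact hpsum.sum_le_tsum _ (fun k _ => (hppos k).le)
    · intro a ha b hb hab
      simp only [Finset.coe_filter, mem_ofPred_eq] at ha hb hab
      omega

lemma second_moment {T : ℝ → ℝ} {μ : Measure ℝ} [IsProbabilityMeasure μ]
    (hT : MeasurePreserving T μ μ) {p : ℕ → ℝ} (hppos : ∀ n, 0 < p n) (hpsum : Summable p)
    (hcorr : ∀ A, MeasurableSet A → ∀ u v : ℝ, u ≤ v → ∀ n : ℕ,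
      |μ.real (T^[n] ⁻¹' A ∩ Ico u v) - μ.real A * μ.real (Ico u v)| ≤ 3 * μ.real A * p n)
    {u v : ℝ} (huv : u ≤ v) (n : ℕ) :
    ∫ x, (∑ j ∈ Finset.range n, (T^[j] ⁻¹' (Ico u v)).indicator (1 : ℝ → ℝ) x) ^ 2 ∂μ ≤
      (n * μ.real (Ico u v)) ^ 2 + 6 * (∑' k, p k) * (n * μ.real (Ico u v)) := by
  classical
  set J := Ico u v with hJ
  have hJm : MeasurableSet J := measurableSet_Ico
  have hTj : ∀ j, MeasurableSet (T^[j] ⁻¹' J) := fun j => (hT.measurable.iterate j) hJm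
  have e1 : (fun x => (∑ j ∈ Finset.range n, (T^[j] ⁻¹' J).indicator (1 : ℝ → ℝ) x) ^ 2) =
      fun x => ∑ i ∈ Finset.range n, ∑ j ∈ Finset.range n,
        (T^[i] ⁻¹' J ∩ T^[j] ⁻¹' J).indicator (1 : ℝ → ℝ) x := by
    funext x
    rw [sq, Finset.sum_mul_sum]
    refine Finset.sum_congr rfl fun i _ => Finset.sum_congr rfl fun j _ => ?_
    rw [inter_indicator_one, Pi.mul_apply]
  have hint : ∀ i j, Integrable ((T^[i] ⁻¹' J ∩ T^[j] ⁻¹' J).indicator (1 : ℝ → ℝ)) μ := fun i j =>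
    (integrable_const (1:ℝ)).indicator ((hTj i).inter (hTj j))
  rw [e1, integral_finsetSum _ (fun i _ => integrable_finsetSum _ (fun j _ => hint i j))]
  have e2 : ∀ i ∈ Finset.range n, ∫ x, ∑ j ∈ Finset.range n,
        (T^[i] ⁻¹' J ∩ T^[j] ⁻¹' J).indicator (1 : ℝ → ℝ) x ∂μ ≤
        n * μ.real J ^ 2 + 3 * μ.real J * (2 * ∑' k, p k) := by
    intro i _
    rw [integral_finsetSum _ (fun j _ => hint i j)]
    calc _ ≤ ∑ j ∈ Finset.range n, (μ.real J ^ 2 +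
          3 * μ.real J * (if i ≤ j then p (j - i) else p (i - j))) := by
          apply Finset.sum_le_sum
          intro j _
          rw [integral_indicator_one ((hTj i).inter (hTj j))]
          split_ifs with h
          · exact corr_sym hT hcorr huv h
          · rw [inter_comm]; exact corr_sym hT hcorr huv (by omega)
      _ = n * μ.real J ^ 2 + 3 * μ.real J *
          ∑ j ∈ Finset.range n, (if i ≤ j then p (j - i) else p (i - j)) := by
          rw [Finset.sum_add_distrib, Finset.sum_const, Finset.card_range, nsmul_eq_mul,
            Finset.mul_sum]
      _ ≤ _ := by
          have := sum_dist_le hppos hpsum n i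
          gcongr
  refine (Finset.sum_le_sum e2).trans ?_
  rw [Finset.sum_const, Finset.card_range, nsmul_eq_mul]
  apply le_of_eq
  ring

lemma hit_prob {T : ℝ → ℝ} {μ : Measure ℝ} [IsProbabilityMeasure μ]
    (hT : MeasurePreserving T μ μ) {p : ℕ → ℝ} (hppos : ∀ n, 0 < p n) (hpsum : Summable p)
    (hcorr : ∀ A, MeasurableSet A → ∀ u v : ℝ, u ≤ v → ∀ n : ℕ,
      |μ.real (T^[n] ⁻¹' A ∩ Ico u v) - μ.real A * μ.real (Ico u v)| ≤ 3 * μ.real A * p n)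
    {u v : ℝ} (huv : u ≤ v) {A : Set ℝ} (hA : MeasurableSet A) (hAJ : A ⊆ Ico u v)
    {δ : ℝ} (hδ : 0 < δ) (hδA : δ * μ.real (Ico u v) ≤ μ.real A)
    {n : ℕ} (hn : 1 ≤ n * μ.real (Ico u v)) :
    δ ^ 2 / (1 + 6 * ∑' k, p k) ≤ μ.real {x | ∃ j < n, T^[j] x ∈ A} := by
  classical
  have hsm := second_moment hT hppos hpsum hcorr huv n
  set J := Ico u v with hJ
  set S := ∑' k, p k with hS
  have hS0 : 0 ≤ S := tsum_nonneg fun k => (hppos k).le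
  set a := n * μ.real J with ha
  set B := {x | ∃ j < n, T^[j] x ∈ A} with hB
  have hTj : ∀ {D : Set ℝ}, MeasurableSet D → ∀ j, MeasurableSet (T^[j] ⁻¹' D) :=
    fun hD j => (hT.measurable.iterate j) hD
  have hBm : MeasurableSet B := by
    have : B = ⋃ j ∈ Finset.range n, T^[j] ⁻¹' A := by
      ext x; simp [hB]
    rw [this]
    exact Finset.measurableSet_biUnion _ (fun j _ => hTj hA j)
  have hintI : ∀ {D : Set ℝ}, MeasurableSet D → Integrable (D.indicator (1 : ℝ → ℝ)) μ :=
    fun hD => (integrable_const (1:ℝ)).indicator hD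
  set Q := 1 + 6 * S with hQ
  have hQ0 : 0 < Q := by positivity
  set lam := Q * a / δ with hlam
  have hlam0 : 0 < lam := by positivity
  have hE : ∫ x, ∑ j ∈ Finset.range n, (T^[j] ⁻¹' A).indicator (1 : ℝ → ℝ) x ∂μ = n * μ.real A := by
    rw [integral_finsetSum _ (fun j _ => hintI (hTj hA j))]
    rw [Finset.sum_congr rfl (fun j _ => by
      rw [integral_indicator_one (hTj hA j),
        (hT.iterate j).measureReal_preimage hA.nullMeasurableSet])]
    rw [Finset.sum_const, Finset.card_range, nsmul_eq_mul]
  have hbd : ∀ x, ∑ j ∈ Finset.range n, (T^[j] ⁻¹' J).indicator (1 : ℝ → ℝ) x ≤ n := by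
    intro x
    calc _ ≤ ∑ j ∈ Finset.range n, (1:ℝ) := Finset.sum_le_sum fun j _ => by
            simp only [indicator]; split_ifs <;> simp
      _ = n := by simp
  have hJ0 : ∀ x, 0 ≤ ∑ j ∈ Finset.range n, (T^[j] ⁻¹' J).indicator (1 : ℝ → ℝ) x := fun x =>
    Finset.sum_nonneg fun j _ => indicator_nonneg (fun _ _ => zero_le_one) _
  have hmeasN : Measurable (fun x => ∑ j ∈ Finset.range n, (T^[j] ⁻¹' J).indicator (1 : ℝ → ℝ) x) :=
    Finset.measurable_fun_sum _ fun j _ => measurable_one.indicator (hTj measurableSet_Ico j)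
  have hint2 : Integrable (fun x => (∑ j ∈ Finset.range n, (T^[j] ⁻¹' J).indicator (1 : ℝ → ℝ) x) ^ 2) μ := by
    apply Integrable.of_bound (hmeasN.pow_const 2).aestronglyMeasurable ((n:ℝ) ^ 2)
    filter_upwards with x
    rw [Real.norm_of_nonneg (sq_nonneg _)]
    exact pow_le_pow_left₀ (hJ0 x) (hbd x) 2
  have hpt : ∀ x, ∑ j ∈ Finset.range n, (T^[j] ⁻¹' A).indicator (1 : ℝ → ℝ) x ≤
      (2 * lam)⁻¹ * (∑ j ∈ Finset.range n, (T^[j] ⁻¹' J).indicator (1 : ℝ → ℝ) x) ^ 2 +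
        lam / 2 * B.indicator (1 : ℝ → ℝ) x := by
    intro x
    by_cases hx : x ∈ B
    · rw [indicator_of_mem hx, Pi.one_apply, mul_one]
      have h1 : ∑ j ∈ Finset.range n, (T^[j] ⁻¹' A).indicator (1 : ℝ → ℝ) x ≤
          ∑ j ∈ Finset.range n, (T^[j] ⁻¹' J).indicator (1 : ℝ → ℝ) x :=
        Finset.sum_le_sum fun j _ => indicator_le_indicator_of_subset
          (preimage_mono hAJ) (fun _ => zero_le_one) x
      refine h1.trans ?_
      set y := ∑ j ∈ Finset.range n, (T^[j] ⁻¹' J).indicator (1 : ℝ → ℝ) x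
      have h2 : (2 * lam)⁻¹ * y ^ 2 + lam / 2 - y = (2 * lam)⁻¹ * (y - lam) ^ 2 := by
        field_simp; ring
      have h3 : 0 ≤ (2 * lam)⁻¹ * (y - lam) ^ 2 := by positivity
      linarith
    · have h1 : ∑ j ∈ Finset.range n, (T^[j] ⁻¹' A).indicator (1 : ℝ → ℝ) x = 0 := by
        apply Finset.sum_eq_zero
        intro j hj
        apply indicator_of_notMem
        intro hc
        exact hx ⟨j, Finset.mem_range.1 hj, hc⟩
      rw [h1, indicator_of_notMem hx]
      positivity
  have hI : (n:ℝ) * μ.real A ≤ (2 * lam)⁻¹ * (a ^ 2 + 6 * S * a) + lam / 2 * μ.real B := by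
    rw [← hE]
    refine (integral_mono (integrable_finsetSum _ (fun j _ => hintI (hTj hA j)))
      ((hint2.const_mul _).add ((hintI hBm).const_mul _)) hpt).trans ?_
    rw [integral_add' (hint2.const_mul _) ((hintI hBm).const_mul _), integral_const_mul,
      integral_const_mul, integral_indicator_one hBm]
    gcongr
  have h1 : a ^ 2 + 6 * S * a ≤ Q * a ^ 2 := by
    rw [hQ]; nlinarith [mul_nonneg hS0 (by linarith : (0:ℝ) ≤ a)]
  have h2 : δ * a ≤ n * μ.real A := by
    have : (n:ℝ) * (δ * μ.real J) ≤ n * μ.real A := by gcongr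
    rw [ha]; linarith
  have h3 : (2 * lam)⁻¹ * (a ^ 2 + 6 * S * a) ≤ δ * a / 2 := by
    calc _ ≤ (2 * lam)⁻¹ * (Q * a ^ 2) := by gcongr
      _ = δ * a / 2 := by rw [hlam]; field_simp
  have h4 : δ * a / 2 ≤ Q * a / δ / 2 * μ.real B := by linarith
  rw [div_le_iff₀ hQ0]
  have h5 : δ * (δ * a / 2) ≤ δ * (Q * a / δ / 2 * μ.real B) := by gcongr
  have h6 : δ * (Q * a / δ / 2 * μ.real B) = Q * a / 2 * μ.real B := by field_simp
  rw [h6] at h5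
  have h7 : (a / 2) * δ ^ 2 ≤ (a / 2) * (μ.real B * Q) := by linarith
  exact le_of_mul_le_mul_left h7 (by linarith)


def Hit (T : ℝ → ℝ) (μ : Measure ℝ) (d b t : ℝ) (q M m c N : ℕ) (x y : ℝ) : Prop :=
  ∃ i ≤ M, ∃ l ≤ N * (q + i), ∃ j, N ≤ j ∧ j < N + ⌈(2:ℝ) ^ (t * ((N * (q + i) : ℕ) : ℝ))⌉₊ + c ∧
    mq μ l y ≤ (2:ℝ) ^ (-(b * ((N * (q + i) : ℕ) : ℝ))) ∧ dix l (T^[j] x) = dix l y ∧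
    T^[j] x ∈ Hset μ d (1 / ((m:ℝ) + 1)) N (N * (q + i))

lemma measurable_Hit {T : ℝ → ℝ} (hT : Measurable T) (μ : Measure ℝ) (d b t : ℝ) (q M m c N : ℕ) :
    Measurable (fun z : ℝ × ℝ => Hit T μ d b t q M m c N z.1 z.2) := by
  unfold Hit
  refine Measurable.exists fun i => Measurable.and measurable_const ?_
  refine Measurable.exists fun l => Measurable.and measurable_const ?_
  refine Measurable.exists fun j => Measurable.and measurable_const ?_
  refine Measurable.and measurable_const ?_
  have hTj : Measurable (fun z : ℝ × ℝ => T^[j] z.1) := (hT.iterate j).comp measurable_fst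
  refine Measurable.and ?_ (Measurable.and ?_ ?_)
  · apply measurableSet_setOfPred.1
    exact measurableSet_le ((measurable_mq μ l).comp measurable_snd) measurable_const
  · apply measurableSet_setOfPred.1
    exact measurableSet_eq_fun ((measurable_dix l).comp hTj) ((measurable_dix l).comp measurable_snd)
  · apply measurableSet_setOfPred.1
    exact hTj (measurableSet_Hset μ d _ N _)

lemma measurable_freqHit {T : ℝ → ℝ} (hT : Measurable T) (μ : Measure ℝ) (d b t : ℝ) (q M m c : ℕ) :
    Measurable (fun z : ℝ × ℝ => ∃ᶠ N in atTop, Hit T μ d b t q M m c N z.1 z.2) := by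
  simp only [frequently_atTop]
  refine Measurable.forall fun n => Measurable.exists fun N => Measurable.and measurable_const ?_
  exact measurable_Hit hT μ d b t q M m c N

lemma hit_ae {T : ℝ → ℝ} {μ : Measure ℝ} [IsProbabilityMeasure μ]
    (hT : MeasurePreserving T μ μ) {p : ℕ → ℝ} (hppos : ∀ n, 0 < p n) (hpsum : Summable p)
    (hcorr : ∀ A, MeasurableSet A → ∀ u v : ℝ, u ≤ v → ∀ n : ℕ,
      |μ.real (T^[n] ⁻¹' A ∩ Ico u v) - μ.real A * μ.real (Ico u v)| ≤ 3 * μ.real A * p n)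
    (hsupp : μ (Ioo (0:ℝ) 1)ᶜ = 0)
    {d b t : ℝ} {q M m : ℕ} {y : ℝ}
    (hy : ∃ᶠ N : ℕ in atTop, ∃ i ≤ M, ∃ l ≤ N * (q + i),
      Evt μ d b t (1 / ((m:ℝ) + 1)) N (N * (q + i)) l y) :
    ∀ᵐ x ∂μ, ∃ c : ℕ, ∃ᶠ N in atTop, Hit T μ d b t q M m c N x y := by
  have hTm := hT.measurable
  have herg := ergodic_of_corr hT hpsum hcorr
  set Z := {x | ∃ c : ℕ, ∃ᶠ N in atTop, Hit T μ d b t q M m c N x y} with hZ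
  have hsec : Measurable (fun x : ℝ => (x, y)) := measurable_id.prodMk measurable_const
  have hZm : MeasurableSet Z := by
    apply measurableSet_setOfPred.2
    refine Measurable.exists fun c => ?_
    exact Measurable.comp (g := fun z : ℝ × ℝ => ∃ᶠ N in atTop, Hit T μ d b t q M m c N z.1 z.2)
      (f := fun x : ℝ => (x, y)) (measurable_freqHit hTm μ d b t q M m c) hsec
  have hZinv : T ⁻¹' Z ⊆ Z := by
    rintro x ⟨c, hc⟩
    refine ⟨c + 1, hc.mono ?_⟩
    rintro N ⟨i, hi, l, hl, j, hj1, hj2, h⟩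
    refine ⟨i, hi, l, hl, j + 1, by omega, by omega, ?_⟩
    rw [Function.iterate_succ_apply]
    exact h
  set κ := (1 / ((m:ℝ) + 1)) ^ 2 / (1 + 6 * ∑' k, p k) with hκ
  have hS0 : 0 ≤ ∑' k, p k := tsum_nonneg fun k => (hppos k).le
  have hκ0 : 0 < κ := by positivity
  set X : ℕ → Set ℝ := fun N => {x | Hit T μ d b t q M m 0 N x y} with hX
  have hXm : ∀ N, MeasurableSet (X N) := fun N =>
    measurableSet_setOfPred.2 (Measurable.comp
      (g := fun z : ℝ × ℝ => Hit T μ d b t q M m 0 N z.1 z.2)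
      (f := fun x : ℝ => (x, y)) (measurable_Hit hTm μ d b t q M m 0 N) hsec)
  have hXp : ∃ᶠ N in atTop, ENNReal.ofReal κ ≤ μ (X N) := by
    refine hy.mono ?_
    rintro N ⟨i, hi, l, hl, h1, h2, h3⟩
    set k := N * (q + i) with hk
    set n := ⌈(2:ℝ) ^ (t * (k : ℝ))⌉₊ with hn
    set H := Hset μ d (1 / ((m:ℝ) + 1)) N k with hH
    have hHm : MeasurableSet H := measurableSet_Hset _ _ _ _ _
    have hJ := dcell_eq_Ico l (dix l y)
    have hA : MeasurableSet (dcell l (dix l y) ∩ H) := (measurableSet_dcell _ _).inter hHm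
    have hmq : mq μ l y = μ.real (dcell l (dix l y)) := rfl
    have hprob := hit_prob hT hppos hpsum hcorr (A := dcell l (dix l y) ∩ H)
      (u := ((dix l y : ℤ) : ℝ) / 2 ^ l) (v := (((dix l y : ℤ) : ℝ) + 1) / 2 ^ l)
      (by gcongr; linarith) hA
      (by rw [← hJ]; exact inter_subset_left) (δ := 1 / ((m:ℝ) + 1)) (by positivity)
      (by
        rw [← hJ, ← hmq]
        refine h3.trans (le_of_eq ?_)
        unfold mq
        rw [Measure.restrict_apply (measurableSet_dcell _ _)]
        rfl) (n := n)
      (by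
        rw [← hJ, ← hmq]
        have e : (1:ℝ) = (2:ℝ) ^ (t * (k:ℝ)) * (2:ℝ) ^ (-(t * (k:ℝ))) := by
          rw [pw_mul]; simp
        rw [e]
        have := Nat.le_ceil ((2:ℝ) ^ (t * (k : ℝ)))
        have := pw_pos (-(t * (k:ℝ)))
        gcongr)
    set B := {x | ∃ j < n, T^[j] x ∈ dcell l (dix l y) ∩ H} with hB
    have hBm : MeasurableSet B := by
      have : B = ⋃ j ∈ Finset.range n, T^[j] ⁻¹' (dcell l (dix l y) ∩ H) := by
        ext x; simp only [hB, mem_ofPred_eq, mem_iUnion, Finset.mem_range, mem_preimage, exists_prop]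
      rw [this]
      exact Finset.measurableSet_biUnion _ (fun j _ => (hTm.iterate j) hA)
    have hBX : T^[N] ⁻¹' B ⊆ X N := by
      rintro x ⟨j, hj, hjc, hjH⟩
      rw [← Function.iterate_add_apply] at hjc hjH
      exact ⟨i, hi, l, hl, j + N, by omega, by simp only [← hk, ← hn]; omega, h2, hjc, hjH⟩
    calc ENNReal.ofReal κ ≤ ENNReal.ofReal (μ.real B) := ENNReal.ofReal_le_ofReal hprob
      _ = μ B := ENNReal.ofReal_toReal (measure_ne_top _ _)
      _ = μ (T^[N] ⁻¹' B) := ((hT.iterate N).measure_preimage hBm.nullMeasurableSet).symm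
      _ ≤ _ := measure_mono hBX
  have hZpos : ENNReal.ofReal κ ≤ μ Z := by
    have hsub : (⋂ n : ℕ, ⋃ N ≥ n, X N) ⊆ Z := by
      intro x hx
      refine ⟨0, ?_⟩
      rw [frequently_atTop]
      intro n
      have := mem_iInter.1 hx n
      simp only [mem_iUnion] at this
      obtain ⟨N, hN, hxN⟩ := this
      exact ⟨N, hN, hxN⟩
    refine le_trans ?_ (measure_mono hsub)
    rw [Antitone.measure_iInter]
    · apply le_iInf
      intro n
      obtain ⟨N, hN, h⟩ := frequently_atTop.1 hXp n
      refine h.trans (measure_mono ?_)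
      exact subset_biUnion_of_mem (u := X) hN
    · intro n n' h
      exact biUnion_subset_biUnion_left (fun N hN => le_trans h hN)
    · intro n
      exact (MeasurableSet.iUnion fun N => MeasurableSet.iUnion fun _ => hXm N).nullMeasurableSet
    · exact ⟨0, measure_ne_top _ _⟩
  rcases herg.ae_empty_or_univ_of_preimage_ae_le hZm.nullMeasurableSet
    (LE.le.eventuallyLE hZinv) with h | h
  · exfalso
    rw [ae_eq_empty] at h
    rw [h] at hZpos
    have : 0 < ENNReal.ofReal κ := ENNReal.ofReal_pos.2 hκ0
    exact absurd hZpos (not_le.2 this)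
  · exact ae_eq_univ.1 h

lemma hit_all {T : ℝ → ℝ} {μ : Measure ℝ} [IsProbabilityMeasure μ]
    (hT : MeasurePreserving T μ μ) {p : ℕ → ℝ} (hppos : ∀ n, 0 < p n) (hpsum : Summable p)
    (hcorr : ∀ A, MeasurableSet A → ∀ u v : ℝ, u ≤ v → ∀ n : ℕ,
      |μ.real (T^[n] ⁻¹' A ∩ Ico u v) - μ.real A * μ.real (Ico u v)| ≤ 3 * μ.real A * p n)
    (hsupp : μ (Ioo (0:ℝ) 1)ᶜ = 0)
    {C d b t τ : ℝ} (hC : 0 < C) (hd : 0 < d) (hdb : d < b) (hbt : b < t) (htτ : t < τ)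
    (hfr : ∀ l y, mq μ l y ≤ C * (2:ℝ) ^ (-(τ * l))) {q M : ℕ} (hq : 0 < q)
    (hM : (q : ℝ) + 1 ≤ (τ - d) * (q + M)) :
    ∀ᵐ x ∂μ, ∀ᵐ y ∂μ, ∃ m c : ℕ, ∃ᶠ N in atTop, Hit T μ d b t q M m c N x y := by
  rw [Measure.ae_ae_comm]
  · filter_upwards [spatial hsupp hC hd hdb hbt htτ hfr hq hM] with y ⟨m, hm⟩
    filter_upwards [hit_ae hT hppos hpsum hcorr hsupp hm] with x ⟨c, hc⟩
    exact ⟨m, c, hc⟩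
  · apply measurableSet_setOfPred.2
    refine Measurable.exists fun m => Measurable.exists fun c => ?_
    exact measurable_freqHit hT.measurable μ d b t q M m c


lemma single_null {μ : Measure ℝ} [IsProbabilityMeasure μ] {C τ : ℝ} (hτ : 0 < τ)
    (hfr : ∀ l y, mq μ l y ≤ C * (2:ℝ) ^ (-(τ * l))) (z : ℝ) : μ {z} = 0 := by
  have h1 : ∀ l : ℕ, μ.real {z} ≤ C * (2:ℝ) ^ (-(τ * l)) := by
    intro l
    refine le_trans ?_ (hfr l z)
    apply ENNReal.toReal_mono (measure_ne_top _ _)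
    apply measure_mono
    rw [singleton_subset_iff]
    exact mem_dcell_dix l z
  have h2 := ge_of_tendsto' (pw_tendsto hτ C) h1
  have h3 : μ.real {z} = 0 := le_antisymm h2 measureReal_nonneg
  exact (measureReal_eq_zero_iff).1 h3

lemma cdata_of_hit {T : ℝ → ℝ} {μ : Measure ℝ} [IsProbabilityMeasure μ] {r : ℕ → ℝ}
    {C d b t τ : ℝ} (hd : 0 < d) (hdb : d < b) (hbt : b < t) (htτ : t < τ)
    (hfr : ∀ l y, mq μ l y ≤ C * (2:ℝ) ^ (-(τ * l))) {q M : ℕ} (hq : 0 < q)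
    (he : 0 < b - d - d / q)
    (hrk : ∀ᶠ k : ℕ in atTop, ∀ j < 2 * ⌈(2:ℝ) ^ (t * (k : ℝ))⌉₊, (1/2 : ℝ) ^ k < r j)
    {x y : ℝ} {m c : ℕ} (hhit : ∃ᶠ N in atTop, Hit T μ d b t q M m c N x y)
    {δ₀ : ℝ} (hδ₀ : 0 < δ₀) (hlow : ∀ l : ℕ, δ₀ * (1/2) ^ l ≤ mq μ l y)
    (n₀ : ℕ) (η : ℝ) (hη : 0 < η) :
    ∃ l ≥ n₀, ∃ F K, CData μ (fun n => T^[n] x) r d n₀ η l (dix l y) F K := by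
  have hb : 0 < b := hd.trans hdb
  have ht : 0 < t := hb.trans hbt
  set e := b - d - d / q with hedef
  have hB : ∀ᶠ k : ℕ in atTop, (1:ℝ) * (2:ℝ) ^ (-(b * k)) < δ₀ * (1/2) ^ n₀ :=
    (pw_tendsto hb 1).eventually (gt_mem_nhds (by positivity))
  have hCc : ∀ᶠ k : ℕ in atTop, ((m:ℝ) + 1) * (2:ℝ) ^ (-(e * k)) < η :=
    (pw_tendsto he _).eventually (gt_mem_nhds hη)
  obtain ⟨k₀, hk₀⟩ := eventually_atTop.1 ((hB.and hCc).and hrk)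
  have hDd : ∀ᶠ N : ℕ in atTop, (N:ℝ) * ((2:ℝ) ^ (-t)) ^ N + c * (2:ℝ) ^ (-(t * N)) < 1 := by
    have h1 := tendsto_self_mul_const_pow_of_lt_one (pw_pos (-t)).le
      (Real.rpow_lt_one_of_one_lt_of_neg (by norm_num : (1:ℝ) < 2) (by linarith : -t < 0))
    have h2 := h1.add (pw_tendsto ht c)
    rw [add_zero] at h2
    exact h2.eventually (gt_mem_nhds one_pos)
  obtain ⟨N, ⟨i, hi, l, hl, j, hj1, hj2, hmq, hdix, hH⟩, hD, hN1, hN2, hN3⟩ :=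
    (hhit.and_eventually (hDd.and ((eventually_ge_atTop k₀).and
      ((eventually_ge_atTop n₀).and (eventually_ge_atTop 1))))).exists
  set k := N * (q + i) with hk
  have hNk : N ≤ k := Nat.le_mul_of_pos_right _ (by omega)
  obtain ⟨⟨hB, hCc⟩, hr⟩ := hk₀ k (hN1.trans hNk)
  set z := T^[j] x with hz
  set G := Gset μ d N k with hG
  have hGm : MeasurableSet G := measurableSet_Gset _ _ _ _
  have hzG : z ∈ G := hH.1
  have hzH := hH.2
  have hm1 : (0:ℝ) < (m:ℝ) + 1 := by positivity
  set F := dcell k (dix k z) ∩ G with hF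
  have hFm : MeasurableSet F := (measurableSet_dcell _ _).inter hGm
  have hmF : mq (μ.restrict G) k z = μ.real F := by
    unfold mq
    rw [Measure.restrict_apply (measurableSet_dcell _ _)]
    rfl
  have hFz : mq μ k z ≤ (m + 1) * μ.real F := by
    have : 1 / ((m:ℝ) + 1) * mq μ k z ≤ μ.real F := by rw [← hmF]; exact hzH
    rw [one_div, inv_mul_le_iff₀ hm1] at this
    exact this
  have hFpos : 0 < μ.real F := by
    have h1 : 0 < mq μ k z := hzG.1
    exact pos_of_mul_pos_right (h1.trans_le hFz) hm1.le
  have hcell : dcell k (dix k z) ⊆ dcell l (dix l y) :=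
    dcell_nested hl (mem_dcell.2 hdix) (mem_dcell_dix k z)
  have hln : n₀ ≤ l := by
    by_contra hc
    push Not at hc
    have h1 := mq_anti μ hc.le y
    have h2 := hlow n₀
    linarith
  have hjk : j < 2 * ⌈(2:ℝ) ^ (t * (k : ℝ))⌉₊ := by
    have h1 : ((N:ℝ) + c) * (2:ℝ) ^ (-(t * N)) < 1 := by
      rw [pw_eq] at hD
      rw [add_mul]
      convert hD using 4
      ring
    have h2 : (N:ℝ) + c ≤ (2:ℝ) ^ (t * (N:ℝ)) := by
      have h3 : ((N:ℝ) + c) * (2:ℝ) ^ (-(t * N)) * (2:ℝ) ^ (t * (N:ℝ)) ≤ 1 * (2:ℝ) ^ (t * (N:ℝ)) :=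
        mul_le_mul_of_nonneg_right h1.le (pw_pos _).le
      rw [mul_assoc, pw_mul, neg_add_cancel, Real.rpow_zero, mul_one, one_mul] at h3
      exact h3
    have h4 : (2:ℝ) ^ (t * (N:ℝ)) ≤ (2:ℝ) ^ (t * (k:ℝ)) := by
      apply pw_le
      have : (N:ℝ) ≤ k := by exact_mod_cast hNk
      gcongr
    have h5 := Nat.le_ceil ((2:ℝ) ^ (t * (k : ℝ)))
    have h6 : N + c ≤ ⌈(2:ℝ) ^ (t * (k : ℝ))⌉₊ := by
      have : ((N + c : ℕ):ℝ) ≤ (⌈(2:ℝ) ^ (t * (k : ℝ))⌉₊ : ℝ) := by push_cast; linarith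
      exact_mod_cast this
    omega
  refine ⟨l, hln, F, closure (dcell k (dix k z)), ?_⟩
  refine ⟨hFm, inter_subset_left.trans hcell, ?_, ?_, closure_mono hcell, ?_, ?_, ?_⟩
  · intro h0
    rw [measureReal_def, h0] at hFpos
    simp at hFpos
  · exact (isCompact_closedBall z ((1/2)^k)).of_isClosed_subset isClosed_closure
      (closure_dcell_sub k z)
  · have hlt : ((dix k z : ℤ) : ℝ) / 2 ^ k < (((dix k z : ℤ) : ℝ) + 1) / 2 ^ k := by
      gcongr; linarith
    apply measure_mono_null _ (single_null (ht.trans htτ) hfr (((dix k z : ℤ) : ℝ) / 2 ^ k))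
    rintro w ⟨hw1, hw2⟩
    have hw3 := hw1.1
    rw [dcell_eq_Ico] at hw3
    rw [dcell_eq_Ico, closure_Ico hlt.ne, interior_Icc] at hw2
    rw [mem_singleton_iff]
    by_contra hne
    exact hw2 ⟨lt_of_le_of_ne hw3.1 (Ne.symm hne), hw3.2⟩
  · intro w hw
    refine ⟨j, hN2.trans hj1, ?_⟩
    have h1 := closure_dcell_sub k z hw
    rw [Metric.mem_closedBall, Real.dist_eq, abs_sub_comm] at h1
    exact lt_of_le_of_lt h1 (hr j hjk)
  · intro l' i'
    have hreal : mq μ l y * μ.real (F ∩ dcell l' i') ≤ η * (2:ℝ) ^ (-(d * l')) * μ.real F := by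
      have hm0 := mq_nonneg μ l y
      have hkR : (0:ℝ) ≤ (k:ℝ) := by positivity
      rcases le_total l' k with hlk | hlk
      · have h1 : μ.real (F ∩ dcell l' i') ≤ μ.real F := measureReal_mono inter_subset_left
        have h2 : (2:ℝ) ^ (-(b * (k:ℝ))) ≤ η * (2:ℝ) ^ (-(d * l')) := by
          have hlk' : (l':ℝ) ≤ k := by exact_mod_cast hlk
          calc (2:ℝ) ^ (-(b * (k:ℝ))) = (2:ℝ) ^ (-((b - d) * (k:ℝ))) * (2:ℝ) ^ (-(d * (k:ℝ))) := by
                rw [pw_mul]; ring_nf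
            _ ≤ (2:ℝ) ^ (-(e * (k:ℝ))) * (2:ℝ) ^ (-(d * (l':ℝ))) := by
                have : e ≤ b - d := by rw [hedef]; linarith [div_nonneg hd.le (Nat.cast_nonneg (α := ℝ) q)]
                apply mul_le_mul
                · apply pw_le; gcongr
                · apply pw_le; gcongr
                · exact (pw_pos _).le
                · exact (pw_pos _).le
            _ ≤ η * (2:ℝ) ^ (-(d * (l':ℝ))) := by
                have : (2:ℝ) ^ (-(e * (k:ℝ))) ≤ η := by
                  refine le_trans ?_ hCc.le
                  apply le_mul_of_one_le_left (pw_pos _).le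
                  linarith [Nat.cast_nonneg (α := ℝ) m]
                exact mul_le_mul_of_nonneg_right this (pw_pos _).le
        exact mul_le_mul (hmq.trans h2) h1 measureReal_nonneg (mul_pos hη (pw_pos _)).le
      · rcases (F ∩ dcell l' i').eq_empty_or_nonempty with hemp | ⟨w, hwF, hwl⟩
        · rw [hemp, measureReal_empty, mul_zero]
          have := pw_pos (-(d * (l':ℝ)))
          positivity
        · have hwk : dix k w = dix k z := hwF.1
          have hwG := hwF.2.2 l' hlk
          rw [mq_congr μ hwk] at hwG
          have h1 : μ.real (F ∩ dcell l' i') ≤ mq μ l' w := by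
            have : dix l' w = i' := hwl
            unfold mq
            rw [this]
            exact measureReal_mono inter_subset_right
          have h2 : mq μ l' w ≤ (2:ℝ) ^ (d * (k + N) - d * l') * ((m + 1) * μ.real F) := by
            have h3 : mq μ l' w * (2:ℝ) ^ (d * (l':ℝ)) * (2:ℝ) ^ (-(d * (l':ℝ))) ≤
              (2:ℝ) ^ (d * ((k:ℝ) + N)) * ((m + 1) * μ.real F) * (2:ℝ) ^ (-(d * (l':ℝ))) := by
              apply mul_le_mul_of_nonneg_right _ (pw_pos _).le
              exact hwG.trans (mul_le_mul_of_nonneg_left hFz (pw_pos _).le)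
            rw [mul_assoc, pw_mul, add_neg_cancel, Real.rpow_zero, mul_one] at h3
            rw [sub_eq_add_neg, ← pw_mul]
            linarith
          have hNq : d * N ≤ d / q * k := by
            have h4 : (N:ℝ) * q ≤ k := by
              rw [hk]; push_cast
              have : (0:ℝ) ≤ N * i := by positivity
              linarith
            have hq' : (0:ℝ) < q := by exact_mod_cast hq
            rw [div_mul_eq_mul_div, le_div_iff₀ hq', mul_assoc]
            gcongr
          calc mq μ l y * μ.real (F ∩ dcell l' i')
              ≤ (2:ℝ) ^ (-(b * (k:ℝ))) * ((2:ℝ) ^ (d * (k + N) - d * l') * ((m + 1) * μ.real F)) :=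
                mul_le_mul hmq (h1.trans h2) measureReal_nonneg (pw_pos _).le
            _ = (2:ℝ) ^ (-(b * (k:ℝ)) + (d * (k + N) - d * l')) * ((m + 1) * μ.real F) := by
                rw [← mul_assoc, pw_mul]
            _ ≤ (2:ℝ) ^ (-(e * (k:ℝ)) + (-(d * l'))) * ((m + 1) * μ.real F) := by
                apply mul_le_mul_of_nonneg_right _ (by positivity)
                apply pw_le
                rw [hedef]
                linarith
            _ = ((m + 1) * (2:ℝ) ^ (-(e * (k:ℝ)))) * (2:ℝ) ^ (-(d * (l':ℝ))) * μ.real F := by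
                rw [← pw_mul]; ring
            _ ≤ _ := by
                apply mul_le_mul_of_nonneg_right _ hFpos.le
                exact mul_le_mul_of_nonneg_right hCc.le (pw_pos _).le
    rw [pw_eq]
    have e1 : -d * (l':ℝ) = -(d * l') := by ring
    rw [e1, ← ofReal_measureReal (measure_ne_top μ (dcell l (dix l y))),
      ← ofReal_measureReal (measure_ne_top μ (F ∩ dcell l' i')),
      ← ofReal_measureReal (measure_ne_top μ F), ← ENNReal.ofReal_mul measureReal_nonneg,
      ← ENNReal.ofReal_mul (mul_pos hη (pw_pos _)).le]
    exact ENNReal.ofReal_le_ofReal hreal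

lemma dim_ge {T : ℝ → ℝ} {μ : Measure ℝ} [IsProbabilityMeasure μ]
    (hT : MeasurePreserving T μ μ) {p : ℕ → ℝ} (hppos : ∀ n, 0 < p n) (hpsum : Summable p)
    (hcorr : ∀ A, MeasurableSet A → ∀ u v : ℝ, u ≤ v → ∀ n : ℕ,
      |μ.real (T^[n] ⁻¹' A ∩ Ico u v) - μ.real A * μ.real (Ico u v)| ≤ 3 * μ.real A * p n)
    (hsupp : μ (Ioo (0:ℝ) 1)ᶜ = 0) {r : ℕ → ℝ}
    {C d b t τ : ℝ} (hC : 1 ≤ C) (hd : 0 < d) (hdb : d < b) (hbt : b < t) (htτ : t < τ)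
    (hfr : ∀ l y, mq μ l y ≤ C * (2:ℝ) ^ (-(τ * l)))
    (hrk : ∀ᶠ k : ℕ in atTop, ∀ j < 2 * ⌈(2:ℝ) ^ (t * (k : ℝ))⌉₊, (1/2 : ℝ) ^ k < r j) :
    ∀ᵐ x ∂μ, ENNReal.ofReal d ≤
      dimH {y ∈ Set.Icc (0 : ℝ) 1 | ∃ᶠ n in Filter.atTop, |T^[n] x - y| < r n} := by
  have hC0 : 0 < C := by linarith
  obtain ⟨q, hq⟩ := exists_nat_gt (max 1 (d / (b - d)))
  have hq1 : (1:ℝ) < q := (le_max_left _ _).trans_lt hq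
  have hq2 : d / (b - d) < q := (le_max_right _ _).trans_lt hq
  have hq0 : 0 < q := by
    have : (0:ℝ) < q := by linarith
    exact_mod_cast this
  have hqR : (0:ℝ) < q := by linarith
  have he : 0 < b - d - d / q := by
    rw [div_lt_iff₀ (by linarith)] at hq2
    have : d / q < b - d := by rw [div_lt_iff₀ hqR]; linarith
    linarith
  obtain ⟨M, hM⟩ := exists_nat_gt (((q:ℝ) + 1) / (τ - d))
  have hM' : (q : ℝ) + 1 ≤ (τ - d) * (q + M) := by
    rw [div_lt_iff₀ (by linarith)] at hM
    have : 0 ≤ (τ - d) * q := mul_nonneg (by linarith) hqR.le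
    linarith
  filter_upwards [hit_all hT hppos hpsum hcorr hsupp hC0 hd hdb hbt htτ hfr hq0 hM'] with x hx
  refine cantor_dim (μ := μ) (xs := fun n => T^[n] x) (r := r) hC hd ?_ hsupp ?_
  · intro l i
    by_cases hne : (dcell l i).Nonempty
    · obtain ⟨y, hy⟩ := hne
      have hyi : dix l y = i := hy
      have h1 := hfr l y
      rw [← ofReal_measureReal (measure_ne_top μ (dcell l i))]
      apply ENNReal.ofReal_le_ofReal
      have h2 : mq μ l y = μ.real (dcell l i) := by unfold mq; rw [hyi]; rfl
      rw [← h2, pw_eq]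
      refine h1.trans ?_
      apply mul_le_mul_of_nonneg_left _ hC0.le
      apply pw_le
      have : d * l ≤ τ * l := mul_le_mul_of_nonneg_right (by linarith) (Nat.cast_nonneg _)
      linarith
    · rw [not_nonempty_iff_eq_empty] at hne
      rw [hne]; simp
  · filter_upwards [hx, mq_lower μ hsupp] with y ⟨m, c, hhit⟩ ⟨δ₀, hδ₀, hlow⟩ n₀ η hη
    exact cdata_of_hit hd hdb hbt htτ hfr hq0 he hrk hhit hδ₀ hlow n₀ η hη


lemma frost_of_ball {μ : Measure ℝ} [IsProbabilityMeasure μ]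
    (hsupp : μ (Set.Icc (0:ℝ) 1)ᶜ = 0) {τ cs : ℝ} (hτ : 0 < τ) (hcs : 0 < cs)
    (hb : ∀ u v : ℝ, 0 ≤ u → u ≤ v → v ≤ 1 →
        μ (Set.Icc u v) ≤ ENNReal.ofReal (cs * (v - u) ^ τ)) (l : ℕ) (y : ℝ) :
    mq μ l y ≤ max 1 cs * (2:ℝ) ^ (-(τ * l)) := by
  have hpos : 0 ≤ cs * (2:ℝ) ^ (-(τ * l)) := (mul_pos hcs (pw_pos _)).le
  have key : μ (dcell l (dix l y)) ≤ ENNReal.ofReal (cs * (2:ℝ) ^ (-(τ * l))) := by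
    set u := ((dix l y : ℤ) : ℝ) / 2 ^ l with hu
    have huv : (((dix l y : ℤ) : ℝ) + 1) / 2 ^ l = u + (1/2)^l := by
      rw [add_div, div_pow, one_pow]
    have hsub : dcell l (dix l y) ⊆ Icc (max 0 u) (min 1 (u + (1/2)^l)) ∪ (Icc (0:ℝ) 1)ᶜ := by
      intro w hw
      by_cases h01 : w ∈ Icc (0:ℝ) 1
      · left
        rw [dcell_eq_Ico, huv] at hw
        exact ⟨max_le h01.1 hw.1, le_min h01.2 hw.2.le⟩
      · right; exact h01
    calc _ ≤ _ := measure_mono hsub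
      _ ≤ _ := measure_union_le _ _
      _ = μ (Icc (max 0 u) (min 1 (u + (1/2)^l))) := by rw [hsupp, add_zero]
      _ ≤ _ := by
        rcases le_or_gt (max 0 u) (min 1 (u + (1/2)^l)) with hle | hlt
        · refine (hb _ _ (le_max_left _ _) hle (min_le_left _ _)).trans ?_
          apply ENNReal.ofReal_le_ofReal
          apply mul_le_mul_of_nonneg_left _ hcs.le
          have h1 : min 1 (u + (1/2)^l) - max 0 u ≤ (1/2)^l := by
            have := min_le_right 1 (u + (1/2)^l)
            have := le_max_right 0 u
            linarith
          refine (Real.rpow_le_rpow (by linarith) h1 hτ.le).trans (le_of_eq ?_)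
          rw [half_pow, ← Real.rpow_mul (by norm_num)]
          congr 1; ring
        · rw [Icc_eq_empty (not_le.2 hlt)]; simp
  have h2 := ENNReal.toReal_mono ENNReal.ofReal_ne_top key
  rw [ENNReal.toReal_ofReal hpos] at h2
  exact h2.trans (mul_le_mul_of_nonneg_right (le_max_right _ _) (pw_pos _).le)

lemma rate_r {r : ℕ → ℝ} (hrpos : ∀ n, 0 < r n) (hrdec : Antitone r) {t τ c : ℝ}
    (ht : 0 < t) (htτ : t < τ)
    (hc : ∀ n : ℕ, 1 ≤ n → ((n : ℝ) ^ 2)⁻¹ * ∑ j ∈ Finset.Icc 1 n, r j ^ (-τ) < c) :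
    ∀ᶠ k : ℕ in atTop, ∀ j < 2 * ⌈(2:ℝ) ^ (t * (k : ℝ))⌉₊, (1/2 : ℝ) ^ k < r j := by
  have hτ : 0 < τ := ht.trans htτ
  have hev : ∀ᶠ k : ℕ in atTop, (16 * c) * (2:ℝ) ^ (-((τ - t) * k)) < 1 :=
    (pw_tendsto (by linarith) _).eventually (gt_mem_nhds one_pos)
  filter_upwards [hev] with k hk j hj
  set n := 2 * ⌈(2:ℝ) ^ (t * (k : ℝ))⌉₊ with hn
  refine lt_of_lt_of_le ?_ (hrdec hj.le)
  by_contra hcon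
  push Not at hcon
  have hn1 : 1 ≤ n := by omega
  have hnR : (0:ℝ) < n := by exact_mod_cast hn1
  have h1 := hc (2 * n) (by omega)
  rw [inv_mul_lt_iff₀ (by positivity)] at h1
  have h2 : (n:ℝ) * r n ^ (-τ) ≤ ∑ j ∈ Finset.Icc 1 (2 * n), r j ^ (-τ) := by
    calc (n:ℝ) * r n ^ (-τ) = ∑ j ∈ Finset.Icc (n+1) (2 * n), r n ^ (-τ) := by
          rw [Finset.sum_const, Nat.card_Icc, nsmul_eq_mul]
          congr 2; omega
      _ ≤ ∑ j ∈ Finset.Icc (n+1) (2 * n), r j ^ (-τ) := by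
          apply Finset.sum_le_sum
          intro j hj
          rw [Finset.mem_Icc] at hj
          exact Real.rpow_le_rpow_of_nonpos (hrpos j) (hrdec (by omega)) (by linarith)
      _ ≤ _ := by
          apply Finset.sum_le_sum_of_subset_of_nonneg
          · apply Finset.Icc_subset_Icc_left; omega
          · intro j _ _
            exact Real.rpow_nonneg (hrpos j).le _
  have h3 : r n ^ (-τ) < 4 * c * n := by
    have h4 : (n:ℝ) * r n ^ (-τ) < n * (4 * c * n) := by
      refine (h2.trans_lt h1).trans_le (le_of_eq ?_)
      push_cast; ring
    exact lt_of_mul_lt_mul_left h4 hnR.le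
  have h5 : (2:ℝ) ^ (τ * (k:ℝ)) ≤ r n ^ (-τ) := by
    have h6 := Real.rpow_le_rpow_of_nonpos (hrpos n) hcon (by linarith : -τ ≤ 0)
    refine le_trans (le_of_eq ?_) h6
    rw [half_pow, ← Real.rpow_mul (by norm_num)]
    congr 1; ring
  have hc0 : 0 < c := by
    have : 0 < 4 * c * n := (Real.rpow_pos_of_pos (hrpos n) _).trans h3
    have := pos_of_mul_pos_left this hnR.le
    linarith
  have h6 : (n:ℝ) ≤ 4 * (2:ℝ) ^ (t * (k:ℝ)) := by
    have h7 := Nat.ceil_lt_add_one (pw_pos (t * (k:ℝ))).le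
    have h8 : (1:ℝ) ≤ (2:ℝ) ^ (t * (k:ℝ)) := Real.one_le_rpow (by norm_num) (by positivity)
    rw [hn]; push_cast
    linarith
  have h7 : (2:ℝ) ^ (τ * (k:ℝ)) < 16 * c * (2:ℝ) ^ (t * (k:ℝ)) := by
    have : 4 * c * n ≤ 4 * c * (4 * (2:ℝ) ^ (t * (k:ℝ))) := by gcongr
    linarith
  have h8 : (16 * c) * (2:ℝ) ^ (-((τ - t) * k)) * (2:ℝ) ^ (τ * (k:ℝ)) ≤ 1 * (2:ℝ) ^ (τ * (k:ℝ)) :=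
    mul_le_mul_of_nonneg_right hk.le (pw_pos _).le
  rw [mul_assoc, pw_mul, one_mul] at h8
  have e : -((τ - t) * (k:ℝ)) + τ * k = t * k := by ring
  rw [e] at h8
  linarith

lemma final_step {T : ℝ → ℝ} (hTmeas : Measurable T)
    {μφ : Measure ℝ} [IsProbabilityMeasure μφ]
    (hsupp : μφ (Set.Icc (0:ℝ) 1)ᶜ = 0)
    (hinv : μφ.map T = μφ)
    {p : ℕ → ℝ} (hppos : ∀ n, 0 < p n) (hpsum : Summable p)
    (hdecay : ∀ f g : ℝ → ℝ, Integrable f μφ → BoundedVariationOn g (Set.Icc (0:ℝ) 1) →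
      ∀ n : ℕ,
        |(∫ x, f (T^[n] x) * g x ∂μφ) - (∫ x, f x ∂μφ) * (∫ x, g x ∂μφ)| ≤
          (∫ x, |f x| ∂μφ) *
            ((∫ x, |g x| ∂μφ) + (eVariationOn g (Set.Icc (0:ℝ) 1)).toReal) * p n)
    {s₀ : ℝ}
    (hball : ∀ s : ℝ, 0 < s → s < s₀ → ∃ cs : ℝ, 0 < cs ∧
      ∀ u v : ℝ, 0 ≤ u → u ≤ v → v ≤ 1 →
        μφ (Set.Icc u v) ≤ ENNReal.ofReal (cs * (v - u) ^ s))
    {r : ℕ → ℝ} (hrpos : ∀ n, 0 < r n) (hrdec : Antitone r)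
    {s : ℝ}
    (hs : s = sSup {t : ℝ | t < s₀ ∧ ∃ c : ℝ, 0 < c ∧ ∀ n : ℕ, 1 ≤ n →
      ((n : ℝ) ^ 2)⁻¹ * ∑ j ∈ Finset.Icc 1 n, r j ^ (-t) < c}) :
    ∀ᵐ x ∂μφ, ENNReal.ofReal s ≤
      dimH {y ∈ Set.Icc (0 : ℝ) 1 | ∃ᶠ n in Filter.atTop, |T^[n] x - y| < r n} := by
  have hT : MeasurePreserving T μφ μφ := ⟨hTmeas, hinv⟩
  have hcorr := fun A hA u v huv n => corr_of_decay hTmeas hppos hdecay A hA u v huv n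
  have hall : ∀ᵐ x ∂μφ, ∀ d : ℚ, 0 < (d:ℝ) → (d:ℝ) < s → ENNReal.ofReal (d:ℝ) ≤
      dimH {y ∈ Set.Icc (0 : ℝ) 1 | ∃ᶠ n in Filter.atTop, |T^[n] x - y| < r n} := by
    rw [ae_all_iff]
    intro d
    by_cases hd : 0 < (d:ℝ) ∧ (d:ℝ) < s
    · obtain ⟨hd0, hds⟩ := hd
      have hex : ∃ τ ∈ {t : ℝ | t < s₀ ∧ ∃ c : ℝ, 0 < c ∧ ∀ n : ℕ, 1 ≤ n →
          ((n : ℝ) ^ 2)⁻¹ * ∑ j ∈ Finset.Icc 1 n, r j ^ (-t) < c}, (d:ℝ) < τ := by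
        rw [hs] at hds
        apply exists_lt_of_lt_csSup _ hds
        by_contra hne
        rw [not_nonempty_iff_eq_empty] at hne
        rw [hne, Real.sSup_empty] at hds
        linarith
      obtain ⟨τ, ⟨hτs, c, hc0, hc⟩, hdτ⟩ := hex
      have hτ : 0 < τ := hd0.trans hdτ
      obtain ⟨cs, hcs, hb⟩ := hball τ hτ hτs
      have hfr := frost_of_ball hsupp hτ hcs hb
      have hsupp' : μφ (Ioo (0:ℝ) 1)ᶜ = 0 := by
        have hsub : (Ioo (0:ℝ) 1)ᶜ ⊆ (Icc (0:ℝ) 1)ᶜ ∪ ({0} ∪ {1}) := by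
          intro w hw
          by_cases h01 : w ∈ Icc (0:ℝ) 1
          · right
            by_cases h0 : w = 0
            · left; exact h0
            · right
              by_contra h1
              exact hw ⟨lt_of_le_of_ne h01.1 (Ne.symm h0), lt_of_le_of_ne h01.2 h1⟩
          · left; exact h01
        apply measure_mono_null hsub
        exact measure_union_null hsupp
          (measure_union_null (single_null hτ hfr 0) (single_null hτ hfr 1))
      obtain ⟨b, hb1, hb2⟩ := exists_between hdτ
      obtain ⟨t, ht1, ht2⟩ := exists_between hb2
      have hrk := rate_r hrpos hrdec (by linarith : 0 < t) ht2 hc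
      filter_upwards [dim_ge hT hppos hpsum hcorr hsupp' (le_max_left 1 cs) hd0 hb1 ht1 ht2
        hfr hrk] with x hx _ _
      exact hx
    · filter_upwards with x h1 h2
      exact absurd ⟨h1, h2⟩ hd
  filter_upwards [hall] with x hx
  by_contra hlt
  rw [not_le] at hlt
  set D := dimH {y ∈ Set.Icc (0 : ℝ) 1 | ∃ᶠ n in Filter.atTop, |T^[n] x - y| < r n} with hD
  have hDtop : D ≠ ⊤ := hlt.ne_top
  have hs0 : D.toReal < s := by
    rw [← ENNReal.ofReal_toReal hDtop] at hlt
    exact (ENNReal.ofReal_lt_ofReal_iff_of_nonneg ENNReal.toReal_nonneg).1 hlt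
  obtain ⟨d, hd1, hd2⟩ := exists_rat_btwn hs0
  have hd0 : (0:ℝ) < d := lt_of_le_of_lt ENNReal.toReal_nonneg hd1
  have h := hx d hd0 hd2
  have h2 := ENNReal.toReal_mono hDtop h
  rw [ENNReal.toReal_ofReal hd0.le] at h2
  linarith


end

theorem stmt_2
    (T : ℝ → ℝ) (hT : Set.MapsTo T (Set.Icc (0:ℝ) 1) (Set.Icc (0:ℝ) 1))
    (hTmeas : Measurable T)
    -- the finite partition of [0,1] into intervals
    (m : ℕ) (hm : 0 < m) (a : ℕ → ℝ) (ha0 : a 0 = 0) (ham : a m = 1)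
    (hasm : ∀ i < m, a i < a (i + 1))
    -- piecewise monotone, C¹ and uniformly expanding on each partition interval
    (lam : ℝ) (hlam : 1 < lam)
    (hpiece : ∀ i < m, ∃ U : Set ℝ, IsOpen U ∧ Set.Icc (a i) (a (i + 1)) ⊆ U ∧
      ∃ Ti : ℝ → ℝ, ContDiffOn ℝ 1 Ti U ∧
        (∀ x ∈ Set.Ico (a i) (a (i + 1)), Ti x = T x) ∧
        (StrictMonoOn Ti U ∨ StrictAntiOn Ti U) ∧
        ∀ x ∈ U, lam ≤ |deriv Ti x|)
    -- bounded distortion for the derivative of T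
    (hdistT : ∃ D : ℝ, 1 ≤ D ∧ ∀ n : ℕ, ∀ x ∈ Set.Icc (0:ℝ) 1, ∀ y ∈ Set.Icc (0:ℝ) 1,
      SameCylinder T m a n x y →
        |(∏ k ∈ Finset.range n, deriv T (T^[k] x)) /
          (∏ k ∈ Finset.range n, deriv T (T^[k] y))| ≤ D)
    -- the potential φ has bounded distortion
    (φ : ℝ → ℝ)
    (hdistφ : ∃ Dφ : ℝ, ∀ n : ℕ, ∀ x ∈ Set.Icc (0:ℝ) 1, ∀ y ∈ Set.Icc (0:ℝ) 1,
      SameCylinder T m a n x y →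
        |∑ k ∈ Finset.range n, (φ (T^[k] x) - φ (T^[k] y))| ≤ Dφ)
    -- the conformal measure ν_φ and the Gibbs measure μ_φ = h_φ · ν_φ
    (P : ℝ) (ν : Measure ℝ)
    (hconf : ∀ i < m, ∀ A : Set ℝ, MeasurableSet A → A ⊆ Set.Ico (a i) (a (i + 1)) →
      ν (T '' A) = ∫⁻ x in A, ENNReal.ofReal (Real.exp (P - φ x)) ∂ν)
    (hφ : ℝ → ℝ) (c₁ c₂ : ℝ) (hc₁ : 0 < c₁)
    (hφbd : ∀ x ∈ Set.Icc (0:ℝ) 1, c₁ ≤ hφ x ∧ hφ x ≤ c₂)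
    (μφ : Measure ℝ) [IsProbabilityMeasure μφ]
    (hμν : μφ = ν.withDensity (fun x => ENNReal.ofReal (hφ x)))
    (hsupp : μφ (Set.Icc (0:ℝ) 1)ᶜ = 0)
    (hinv : μφ.map T = μφ)
    -- summable decay of correlations
    (p : ℕ → ℝ) (hppos : ∀ n, 0 < p n) (hpsum : Summable p)
    (hdecay : ∀ f g : ℝ → ℝ, Integrable f μφ → BoundedVariationOn g (Set.Icc (0:ℝ) 1) →
      ∀ n : ℕ,
        |(∫ x, f (T^[n] x) * g x ∂μφ) - (∫ x, f x ∂μφ) * (∫ x, g x ∂μφ)| ≤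
          (∫ x, |f x| ∂μφ) *
            ((∫ x, |g x| ∂μφ) + (eVariationOn g (Set.Icc (0:ℝ) 1)).toReal) * p n)
    -- the measure of intervals decays polynomially
    (s₀ : ℝ) (hs₀ : 0 < s₀)
    (hball : ∀ s : ℝ, 0 < s → s < s₀ → ∃ cs : ℝ, 0 < cs ∧
      ∀ u v : ℝ, 0 ≤ u → u ≤ v → v ≤ 1 →
        μφ (Set.Icc u v) ≤ ENNReal.ofReal (cs * (v - u) ^ s))
    -- the sequence of radii and the dimension bound
    (r : ℕ → ℝ) (hrpos : ∀ n, 0 < r n) (hrdec : Antitone r)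
    (s : ℝ)
    (hs : s = sSup {t : ℝ | t < s₀ ∧ ∃ c : ℝ, 0 < c ∧ ∀ n : ℕ, 1 ≤ n →
      ((n : ℝ) ^ 2)⁻¹ * ∑ j ∈ Finset.Icc 1 n, r j ^ (-t) < c}) :
    ∀ᵐ x ∂μφ, ENNReal.ofReal s ≤ dimH (hitSet T x r) := by
  exact final_step hTmeas hsupp hinv hppos hpsum hdecay hball hrpos hrdec hs
end
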